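/- Suppose Ω satisfies the non-degeneracy assumption. Then there exists κ₀ > 0 such that for every κ ≥ κ₀ the equation λ₁(κH) = κ² has exactly one solution H > 0. -/

import Mathlib

open MeasureTheory Filter Set Topology

noncomputable section

namespace SC

/-- The plane `ℝ²`. -/
abbrev Plane := ℝ × ℝ

/-- Squared Euclidean norm on the plane. -/
def esq (v : Plane) : ℝ := v.1 ^ 2 + v.2 ^ 2

/-- Euclidean dot product on the plane. -/
def dot2 (v w : Plane) : ℝ := v.1 * w.1 + v.2 * w.2

/-- The reference vector potential `F₀(x) = (-x₂/2, x₁/2)`, with `curl F₀ = 1`. -/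
def F0 : Plane → Plane := fun x => (-x.2 / 2, x.1 / 2)

/-- `u` is of class `Cⁿ` on a neighborhood of the closure of `Ω`. -/
def CNearCl {E : Type*} [NormedAddCommGroup E] [NormedSpace ℝ E]
    (n : ℕ) (Ω : Set Plane) (u : Plane → E) : Prop :=
  ∃ U : Set Plane, IsOpen U ∧ closure Ω ⊆ U ∧ ContDiffOn ℝ n u U

/-- The pointwise squared magnetic gradient `|(-i∇ - B·A)u|²`. -/
def magSq (B : ℝ) (A : Plane → Plane) (u : Plane → ℂ) (x : Plane) : ℝ :=
  ‖(-Complex.I) * fderiv ℝ u x ((1 : ℝ), (0 : ℝ)) - ((B * (A x).1 : ℝ) : ℂ) * u x‖ ^ 2 +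
  ‖(-Complex.I) * fderiv ℝ u x ((0 : ℝ), (1 : ℝ)) - ((B * (A x).2 : ℝ) : ℂ) * u x‖ ^ 2

/-- `curl A = ∂₁A₂ - ∂₂A₁`. -/
def curl2 (A : Plane → Plane) (x : Plane) : ℝ :=
  fderiv ℝ (fun y => (A y).2) x ((1 : ℝ), (0 : ℝ)) -
    fderiv ℝ (fun y => (A y).1) x ((0 : ℝ), (1 : ℝ))

/-- The variational ground state energy `λ₁(B·A)` of the magnetic Neumann Laplacian. -/
def lam1A (Ω : Set Plane) (B : ℝ) (A : Plane → Plane) : ℝ :=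
  sInf { r : ℝ | ∃ u : Plane → ℂ, CNearCl 1 Ω u ∧ (∫ x in Ω, ‖u x‖ ^ 2) ≠ 0 ∧
    r = (∫ x in Ω, magSq B A u x) / (∫ x in Ω, ‖u x‖ ^ 2) }

/-- `λ₁(B) = λ₁(B·F₀)`. -/
def lam1 (Ω : Set Plane) (B : ℝ) : ℝ := lam1A Ω B F0

/-- The Ginzburg–Landau energy functional. -/
def GLenergy (Ω : Set Plane) (κ H : ℝ) (ψ : Plane → ℂ) (A : Plane → Plane) : ℝ :=
  ∫ x in Ω, (magSq (κ * H) A ψ x - κ ^ 2 * ‖ψ x‖ ^ 2 + κ ^ 2 / 2 * ‖ψ x‖ ^ 4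
    + κ ^ 2 * H ^ 2 * (curl2 A x - 1) ^ 2)

/-- Admissible Ginzburg–Landau configurations. -/
def GLadm (Ω : Set Plane) (ψ : Plane → ℂ) (A : Plane → Plane) : Prop :=
  CNearCl 1 Ω ψ ∧ CNearCl 1 Ω A

/-- The normal state is a minimizer at `(κ, H)`. -/
def NormalMin (Ω : Set Plane) (κ H : ℝ) : Prop :=
  ∀ ψ A, GLadm Ω ψ A → 0 ≤ GLenergy Ω κ H ψ A

/-- The normal state is the unique minimizer at `(κ, H)`. -/
def NormalUnique (Ω : Set Plane) (κ H : ℝ) : Prop :=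
  NormalMin Ω κ H ∧
  ∀ ψ A, GLadm Ω ψ A → (∫ x in Ω, ‖ψ x‖ ^ 2) ≠ 0 → 0 < GLenergy Ω κ H ψ A

/-- `(ψ, A)` is a minimizer of the Ginzburg–Landau energy at `(κ, H)`. -/
def IsGLMin (Ω : Set Plane) (κ H : ℝ) (ψ : Plane → ℂ) (A : Plane → Plane) : Prop :=
  GLadm Ω ψ A ∧ ∀ ψ' A', GLadm Ω ψ' A' → GLenergy Ω κ H ψ A ≤ GLenergy Ω κ H ψ' A'

/-- Lower global critical field. -/
def HC3low (Ω : Set Plane) (κ : ℝ) : ℝ := sInf {H : ℝ | 0 < H ∧ NormalMin Ω κ H}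

/-- Upper global critical field. -/
def HC3up (Ω : Set Plane) (κ : ℝ) : ℝ :=
  sInf {H : ℝ | 0 < H ∧ ∀ H', H < H' → NormalUnique Ω κ H'}

/-- Lower local critical field. -/
def HlocLow (Ω : Set Plane) (κ : ℝ) : ℝ :=
  sInf {H : ℝ | 0 < H ∧ κ ^ 2 ≤ lam1 Ω (κ * H)}

/-- Upper local critical field. -/
def HlocUp (Ω : Set Plane) (κ : ℝ) : ℝ :=
  sInf {H : ℝ | 0 < H ∧ ∀ H', H < H' → κ ^ 2 ≤ lam1 Ω (κ * H')}

/-- The inward unit normal `ν(s) = (-γ₂'(s), γ₁'(s))`. -/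
def nuVec (γ : ℝ → Plane) (s : ℝ) : Plane := (-(deriv γ s).2, (deriv γ s).1)

/-- The curvature `k(s) = ⟨γ''(s), ν(s)⟩`. -/
def curvOf (γ : ℝ → Plane) (s : ℝ) : ℝ := dot2 (deriv (deriv γ) s) (nuVec γ s)

/-- The maximal curvature. -/
def kmaxOf (γ : ℝ → Plane) : ℝ := sSup (Set.range (curvOf γ))

/-- A smooth counterclockwise arclength parametrization of the boundary of `Ω`. -/
structure BoundaryParam (Ω : Set Plane) where
  γ : ℝ → Plane
  L : ℝ
  L_pos : 0 < L
  smooth : ContDiff ℝ (⊤ : ℕ∞) γ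
  periodic : Function.Periodic γ L
  unit_speed : ∀ s, esq (deriv γ s) = 1
  injOn : Set.InjOn γ (Set.Ico 0 L)
  range_eq : Set.range γ = frontier Ω
  inward : ∀ s, ∃ ε > 0, ∀ t ∈ Set.Ioo (0 : ℝ) ε, γ s + t • nuVec γ s ∈ Ω

/-- The non-degeneracy assumption: finitely many points of maximal curvature,
all of them non-degenerate maxima. -/
def NonDegen {Ω : Set Plane} (P : BoundaryParam Ω) : Prop :=
  ∃ (N : ℕ) (s : Fin N → ℝ), 0 < N ∧ (∀ j, s j ∈ Set.Ico 0 P.L) ∧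
    (∀ j, curvOf P.γ (s j) = kmaxOf P.γ) ∧
    (∀ t ∈ Set.Ico 0 P.L, (∀ j, t ≠ s j) → curvOf P.γ t < kmaxOf P.γ) ∧
    (∀ j, deriv (deriv (curvOf P.γ)) (s j) < 0)

/-- The ground state energy `μ(ζ)` of the de Gennes half-line model operator. -/
def muGen (ζ : ℝ) : ℝ :=
  sInf { r : ℝ | ∃ φ : ℝ → ℝ, ContDiff ℝ 1 φ ∧ HasCompactSupport φ ∧
    (∃ τ, 0 < τ ∧ φ τ ≠ 0) ∧
    r = (∫ τ in Set.Ioi (0 : ℝ), ((deriv φ τ) ^ 2 + (τ + ζ) ^ 2 * (φ τ) ^ 2)) /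
        (∫ τ in Set.Ioi (0 : ℝ), (φ τ) ^ 2) }

/-- The de Gennes constant `Θ₀`. -/
def Theta0 : ℝ := sInf (Set.range muGen)

/-- Standard facts about the de Gennes constant, taken as hypotheses. -/
structure DeGennes where
  ξ₀ : ℝ
  u₀ : ℝ → ℝ
  theta_lb : 1 / 2 < Theta0
  theta_ub : Theta0 < 1
  ξ₀_mem : ξ₀ ∈ Set.Ioo (-1 : ℝ) 0
  ξ₀_min : muGen ξ₀ = Theta0
  ξ₀_uniq : ∀ ζ, muGen ζ = Theta0 → ζ = ξ₀
  ξ₀_sq : ξ₀ ^ 2 = Theta0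
  u₀_pos : ∀ τ, 0 ≤ τ → 0 < u₀ τ
  u₀_smooth : ContDiffOn ℝ 2 u₀ (Set.Ici 0)
  u₀_sq_int : IntegrableOn (fun τ => (u₀ τ) ^ 2) (Set.Ioi 0)
  u₀_normalized : (∫ τ in Set.Ioi (0 : ℝ), (u₀ τ) ^ 2) = 1
  u₀_neumann : derivWithin u₀ (Set.Ici 0) 0 = 0
  u₀_ode : ∀ τ ∈ Set.Ioi (0 : ℝ),
    -(deriv (deriv u₀) τ) + (τ + ξ₀) ^ 2 * u₀ τ = Theta0 * u₀ τ

/-- The universal constant `C₁ = u₀(0)²/3`. -/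
def DeGennes.C1 (D : DeGennes) : ℝ := (D.u₀ 0) ^ 2 / 3

/-- Condition (★) on a vector field `A` at field strength `B` with constant `C₀`. -/
def StarCond (Ω : Set Plane) (C₀ B : ℝ) (A : Plane → Plane) : Prop :=
  CNearCl 2 Ω A ∧
  (∀ x ∈ closure Ω, ‖A x‖ ≤ C₀) ∧
  (∀ x ∈ closure Ω, ‖fderiv ℝ A x‖ ≤ C₀) ∧
  (∀ x ∈ closure Ω, ‖fderiv ℝ (fderiv ℝ A) x‖ ≤ C₀) ∧
  (∀ x ∈ closure Ω, |curl2 A x - 1| ≤ C₀ * B ^ (-(1 : ℝ) / 4)) ∧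
  (∀ x ∈ closure Ω, ‖fderiv ℝ (curl2 A) x‖ ≤ C₀ * B ^ (-(1 : ℝ) / 4)) ∧
  (∀ x ∈ frontier Ω, curl2 A x = 1)

/-- The open unit disc. -/
def unitDisc : Set Plane := {x : Plane | x.1 ^ 2 + x.2 ^ 2 < 1}

/-- `Δ_B`: distance from `B/2 + ξ₀√B + δ₀` to the nearest integer. -/
def DeltaB (ξ₀ δ₀ B : ℝ) : ℝ :=
  sInf (Set.range (fun m : ℤ => |(m : ℝ) - B / 2 - ξ₀ * Real.sqrt B - δ₀|))

/-- Euclidean distance to the boundary of `Ω`. -/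
def distBdry (Ω : Set Plane) (x : Plane) : ℝ :=
  sInf ((fun y => Real.sqrt (esq (x - y))) '' frontier Ω)

end SC


namespace SC

/-- The Gaussian moment integral `∫₀^∞ s^(q-1) exp(-2 y s - s²) ds`. -/
def gaussMoment (q y : ℝ) : ℝ :=
  ∫ s in Ioi (0 : ℝ), s ^ (q - 1) * Real.exp (-(2 * y * s) - s ^ 2)

lemma exp_quadratic_le (y s : ℝ) :
    Real.exp (-(2 * y * s) - s ^ 2) ≤ Real.exp (2 * y ^ 2) * Real.exp (-(1 / 2) * s ^ 2) := by
  rw [← Real.exp_add]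
  apply Real.exp_le_exp.mpr
  nlinarith [sq_nonneg (2 * y + s)]

lemma integrableOn_rpow_exp_half {q : ℝ} (hq : 0 < q) :
    IntegrableOn (fun s : ℝ => s ^ (q - 1) * Real.exp (-(1 / 2) * s ^ 2)) (Ioi 0) :=
  integrableOn_rpow_mul_exp_neg_mul_sq (by norm_num) (by linarith)

lemma integrableOn_gaussMoment {q : ℝ} (hq : 0 < q) (y : ℝ) :
    IntegrableOn (fun s : ℝ => s ^ (q - 1) * Real.exp (-(2 * y * s) - s ^ 2)) (Ioi 0) := by
  refine Integrable.mono' ((integrableOn_rpow_exp_half hq).const_mul (Real.exp (2 * y ^ 2))) ?_ ?_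
  · exact (by fun_prop : Measurable fun s : ℝ =>
      s ^ (q - 1) * Real.exp (-(2 * y * s) - s ^ 2)).aestronglyMeasurable
  · filter_upwards [ae_restrict_mem measurableSet_Ioi] with s hs
    have h0 : 0 ≤ s ^ (q - 1) := Real.rpow_nonneg (le_of_lt hs) _
    rw [Real.norm_of_nonneg (by positivity)]
    calc _ ≤ s ^ (q - 1) * (Real.exp (2 * y ^ 2) * Real.exp (-(1 / 2) * s ^ 2)) := by
          gcongr; exact exp_quadratic_le y s
      _ = _ := by ring

lemma gaussMoment_pos {q : ℝ} (hq : 0 < q) (y : ℝ) : 0 < gaussMoment q y := by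
  unfold gaussMoment
  rw [setIntegral_pos_iff_support_of_nonneg_ae]
  · rw [show (Function.support fun s : ℝ => s ^ (q - 1) * Real.exp (-(2 * y * s) - s ^ 2)) ∩
      Ioi 0 = Ioi 0 from ?_]
    · simp
    · apply inter_eq_right.mpr
      intro s hs
      have : 0 < s ^ (q - 1) := Real.rpow_pos_of_pos hs _
      simp only [Function.mem_support]
      positivity
  · filter_upwards [ae_restrict_mem measurableSet_Ioi] with s hs
    have h0 : 0 ≤ s ^ (q - 1) := Real.rpow_nonneg (le_of_lt hs) _
    simp only [Pi.zero_apply]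
    positivity
  · exact integrableOn_gaussMoment hq y

lemma hasDerivAt_gaussMoment {q : ℝ} (hq : 0 < q) (y : ℝ) :
    HasDerivAt (gaussMoment q) (-2 * gaussMoment (q + 1) y) y := by
  have key := hasDerivAt_integral_of_dominated_loc_of_deriv_le
    (μ := volume.restrict (Ioi (0 : ℝ)))
    (F := fun y s => s ^ (q - 1) * Real.exp (-(2 * y * s) - s ^ 2))
    (F' := fun y s => -2 * (s ^ (q + 1 - 1) * Real.exp (-(2 * y * s) - s ^ 2)))
    (x₀ := y) (s := Metric.ball y 1)
    (bound := fun s => 2 * Real.exp (2 * (|y| + 1) ^ 2) *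
      (s ^ (q + 1 - 1) * Real.exp (-(1 / 2) * s ^ 2)))
    (Metric.ball_mem_nhds y one_pos) ?_ (integrableOn_gaussMoment hq y) ?_ ?_ ?_ ?_
  · have := key.2
    rw [integral_const_mul] at this
    exact this
  · exact Eventually.of_forall fun y => (by fun_prop : Measurable fun s : ℝ =>
      s ^ (q - 1) * Real.exp (-(2 * y * s) - s ^ 2)).aestronglyMeasurable
  · exact (by fun_prop : Measurable fun s : ℝ =>
      -2 * (s ^ (q + 1 - 1) * Real.exp (-(2 * y * s) - s ^ 2))).aestronglyMeasurable
  · filter_upwards [ae_restrict_mem measurableSet_Ioi] with s hs y' hy'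
    have h0 : 0 ≤ s ^ (q + 1 - 1) := Real.rpow_nonneg (le_of_lt hs) _
    rw [norm_mul, show ‖(-2 : ℝ)‖ = 2 by norm_num,
      Real.norm_of_nonneg (mul_nonneg h0 (Real.exp_pos _).le)]
    have h1 : Real.exp (2 * y' ^ 2) ≤ Real.exp (2 * (|y| + 1) ^ 2) := by
      apply Real.exp_le_exp.mpr
      have : |y'| ≤ |y| + 1 := by
        rw [Metric.mem_ball, Real.dist_eq] at hy'
        have := abs_sub_abs_le_abs_sub y' y
        linarith
      have h2 : y' ^ 2 ≤ (|y| + 1) ^ 2 := by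
        rw [← sq_abs y']; gcongr
      linarith
    have h3 := (exp_quadratic_le y' s).trans
      (mul_le_mul_of_nonneg_right h1 (Real.exp_pos _).le)
    calc _ ≤ 2 * (s ^ (q + 1 - 1) * (Real.exp (2 * (|y| + 1) ^ 2) *
          Real.exp (-(1 / 2) * s ^ 2))) := by gcongr
      _ = _ := by ring
  · exact (integrableOn_rpow_exp_half (by linarith)).const_mul _
  · filter_upwards [ae_restrict_mem measurableSet_Ioi] with s hs y' _
    have h1 : HasDerivAt (fun y => Real.exp (-(2 * y * s) - s ^ 2))
        (Real.exp (-(2 * y' * s) - s ^ 2) * (-(2 * s))) y' := by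
      apply HasDerivAt.exp
      have := (((hasDerivAt_id y').const_mul 2).mul_const s).neg.sub_const (s ^ 2)
      simpa using this
    have h2 := h1.const_mul (s ^ (q - 1))
    refine h2.congr_deriv ?_
    rw [show q + 1 - 1 = (q - 1) + 1 by ring, Real.rpow_add hs, Real.rpow_one]
    ring

lemma gaussMoment_recurrence {q : ℝ} (hq : 0 < q) (y : ℝ) :
    2 * gaussMoment (q + 2) y + 2 * y * gaussMoment (q + 1) y = q * gaussMoment q y := by
  set f : ℝ → ℝ := fun s => s ^ q * Real.exp (-(2 * y * s) - s ^ 2) with hf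
  set f' : ℝ → ℝ := fun s => q * (s ^ (q - 1) * Real.exp (-(2 * y * s) - s ^ 2)) -
    2 * y * (s ^ (q + 1 - 1) * Real.exp (-(2 * y * s) - s ^ 2)) -
    2 * (s ^ (q + 2 - 1) * Real.exp (-(2 * y * s) - s ^ 2)) with hf'
  have hd : ∀ s ∈ Ioi (0 : ℝ), HasDerivAt f (f' s) s := by
    intro s hs
    have h1 : HasDerivAt (fun s => Real.exp (-(2 * y * s) - s ^ 2))
        (Real.exp (-(2 * y * s) - s ^ 2) * (-(2 * y) - 2 * s)) s := by
      apply HasDerivAt.exp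
      exact (((hasDerivAt_id s).const_mul (2 * y)).neg.sub (hasDerivAt_pow 2 s)).congr_deriv
        (by simp)
    have h2 := (Real.hasDerivAt_rpow_const (p := q) (Or.inl (ne_of_gt hs))).mul h1
    refine h2.congr_deriv ?_
    simp only [hf']
    rw [show q + 1 - 1 = q by ring, show q + 2 - 1 = q + 1 by ring, Real.rpow_add hs q 1,
      Real.rpow_one]
    ring
  have hi0 := (integrableOn_gaussMoment hq y).const_mul q
  have hi1 := (integrableOn_gaussMoment (by linarith : 0 < q + 1) y).const_mul (2 * y)
  have hi2 := (integrableOn_gaussMoment (by linarith : 0 < q + 2) y).const_mul 2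
  have hi' : IntegrableOn f' (Ioi 0) := (hi0.sub hi1).sub hi2
  have hif : IntegrableOn f (Ioi 0) := by
    have := integrableOn_gaussMoment (by linarith : 0 < q + 1) y
    simpa [hf] using this
  have ht := tendsto_zero_of_hasDerivAt_of_integrableOn_Ioi (a := 0) hd hi' hif
  have hc : ContinuousWithinAt f (Ici 0) 0 := by
    apply ContinuousAt.continuousWithinAt
    apply ContinuousAt.mul
    · exact Real.continuousAt_rpow_const _ _ (Or.inr hq.le)
    · fun_prop
  have := integral_Ioi_of_hasDerivAt_of_tendsto hc hd hi' ht
  have h0 : f 0 = 0 := by simp [hf, Real.zero_rpow hq.ne']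
  have e : ∫ s in Ioi 0, f' s = q * gaussMoment q y - 2 * y * gaussMoment (q + 1) y -
      2 * gaussMoment (q + 2) y := by
    simp only [gaussMoment, ← integral_const_mul]
    rw [← integral_sub hi0 hi1, ← integral_sub _ hi2]
    exact hi0.sub hi1
  linarith

lemma continuousOn_gaussMoment_comp {S : Set ℝ} {f g : ℝ → ℝ} {q₁ q₂ : ℝ} (hq₁ : 0 < q₁)
    (hf : ContinuousOn f S) (hg : ContinuousOn g S)
    (hf1 : ∀ c ∈ S, q₁ ≤ f c) (hf2 : ∀ c ∈ S, f c ≤ q₂) (hg1 : ∀ c ∈ S, |g c| ≤ 1) :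
    ContinuousOn (fun c => gaussMoment (f c) (g c)) S := by
  unfold gaussMoment
  have hi : IntegrableOn (fun s : ℝ => Real.exp 2 * (s ^ (q₁ - 1) * Real.exp (-(1 / 2) * s ^ 2)) +
      Real.exp 2 * (s ^ (max q₂ q₁ - 1) * Real.exp (-(1 / 2) * s ^ 2))) (Ioi 0) :=
    ((integrableOn_rpow_exp_half hq₁).const_mul _).add
      ((integrableOn_rpow_exp_half (lt_max_of_lt_right hq₁)).const_mul _)
  refine continuousOn_of_dominated (bound := fun s => _) ?_ ?_ hi ?_
  · intro c _
    exact (by fun_prop : Measurable fun s : ℝ =>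
      s ^ (f c - 1) * Real.exp (-(2 * g c * s) - s ^ 2)).aestronglyMeasurable
  · intro c hc
    filter_upwards [ae_restrict_mem measurableSet_Ioi] with s hs
    have hs0 : 0 < s := hs
    have h0 : 0 ≤ s ^ (f c - 1) := Real.rpow_nonneg hs0.le _
    rw [Real.norm_of_nonneg (by positivity)]
    have h1 : s ^ (f c - 1) ≤ s ^ (q₁ - 1) + s ^ (max q₂ q₁ - 1) := by
      have ha : 0 < s ^ (q₁ - 1) := Real.rpow_pos_of_pos hs0 _
      have hb : 0 < s ^ (max q₂ q₁ - 1) := Real.rpow_pos_of_pos hs0 _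
      rcases le_total s 1 with h | h
      · have := Real.rpow_le_rpow_of_exponent_ge hs0 h (by linarith [hf1 c hc] : q₁ - 1 ≤ f c - 1)
        linarith
      · have := Real.rpow_le_rpow_of_exponent_le h
          (by linarith [hf2 c hc, le_max_left q₂ q₁] : f c - 1 ≤ max q₂ q₁ - 1)
        linarith
    have h2 : Real.exp (-(2 * g c * s) - s ^ 2) ≤ Real.exp 2 * Real.exp (-(1 / 2) * s ^ 2) := by
      refine (exp_quadratic_le _ _).trans ?_
      gcongr
      have : g c ^ 2 ≤ 1 := by rw [← sq_abs]; nlinarith [hg1 c hc, abs_nonneg (g c)]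
      linarith
    calc _ ≤ (s ^ (q₁ - 1) + s ^ (max q₂ q₁ - 1)) * (Real.exp 2 * Real.exp (-(1 / 2) * s ^ 2)) := by
          gcongr
      _ = _ := by ring
  · filter_upwards [ae_restrict_mem measurableSet_Ioi] with s hs
    have hs0 : s ≠ 0 := ne_of_gt hs
    apply ContinuousOn.mul
    · exact ContinuousOn.rpow continuousOn_const (hf.sub continuousOn_const)
        (fun _ _ => Or.inl hs0)
    · fun_prop

/-- There is `c ∈ (0,1)` for which the decaying solution with energy `c²` satisfies the
Neumann condition at `-c`. -/
lemma exists_neumann_parameter : ∃ c : ℝ, 0 < c ∧ c < 1 ∧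
    c * gaussMoment ((1 - c ^ 2) / 2) (-c) = 2 * gaussMoment ((1 - c ^ 2) / 2 + 1) (-c) := by
  set C : ℝ := ∫ s in Ioi (0 : ℝ), (Real.exp 2 * (s ^ ((1 : ℝ) - 1) * Real.exp (-(1 / 2) * s ^ 2)) +
      Real.exp 2 * (s ^ ((2 : ℝ) - 1) * Real.exp (-(1 / 2) * s ^ 2))) with hC
  have hi : IntegrableOn (fun s : ℝ =>
      Real.exp 2 * (s ^ ((1 : ℝ) - 1) * Real.exp (-(1 / 2) * s ^ 2)) +
      Real.exp 2 * (s ^ ((2 : ℝ) - 1) * Real.exp (-(1 / 2) * s ^ 2))) (Ioi 0) :=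
    ((integrableOn_rpow_exp_half one_pos).const_mul _).add
      ((integrableOn_rpow_exp_half two_pos).const_mul _)
  have hC0 : 0 ≤ C := by
    apply setIntegral_nonneg measurableSet_Ioi
    intro s hs
    have hs0 : 0 < s := hs
    have := Real.rpow_nonneg hs0.le ((1 : ℝ) - 1)
    have := Real.rpow_nonneg hs0.le ((2 : ℝ) - 1)
    positivity
  set p : ℝ := min (1 / 4) (1 / (8 * Real.exp 1 * (C + 1))) with hp
  have hp0 : 0 < p := by
    apply lt_min (by norm_num)
    positivity
  have hp1 : p ≤ 1 / 4 := min_le_left _ _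
  have hp2 : p * (8 * Real.exp 1 * (C + 1)) ≤ 1 := by
    have : p ≤ 1 / (8 * Real.exp 1 * (C + 1)) := min_le_right _ _
    rwa [le_div_iff₀ (by positivity)] at this
  set c₁ := Real.sqrt (1 - 2 * p) with hc₁
  have hc₁sq : c₁ ^ 2 = 1 - 2 * p := Real.sq_sqrt (by linarith)
  have hc₁0 : 0 ≤ c₁ := Real.sqrt_nonneg _
  have hc₁1 : c₁ < 1 := by nlinarith
  have hc₁h : 1 / 2 ≤ c₁ := by nlinarith
  set G : ℝ → ℝ := fun c => c * gaussMoment ((1 - c ^ 2) / 2) (-c) -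
    2 * gaussMoment ((1 - c ^ 2) / 2 + 1) (-c) with hG
  have hGc : ContinuousOn G (Icc 0 c₁) := by
    have hle : ∀ c ∈ Icc 0 c₁, c ^ 2 ≤ c₁ ^ 2 := fun c hc => by
      have := hc.1; have := hc.2; gcongr
    apply ContinuousOn.sub
    · apply continuousOn_id.mul
      refine continuousOn_gaussMoment_comp (q₁ := p) (q₂ := 1) hp0 (by fun_prop) (by fun_prop)
        ?_ ?_ ?_
      · intro c hc; have := hle c hc; linarith
      · intro c hc; nlinarith [sq_nonneg c]
      · intro c hc; rw [abs_neg, abs_of_nonneg hc.1]; linarith [hc.2]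
    · apply continuousOn_const.mul
      refine continuousOn_gaussMoment_comp (q₁ := p) (q₂ := 2) hp0 (by fun_prop) (by fun_prop)
        ?_ ?_ ?_
      · intro c hc; have := hle c hc; linarith
      · intro c hc; nlinarith [sq_nonneg c]
      · intro c hc; rw [abs_neg, abs_of_nonneg hc.1]; linarith [hc.2]
  have hG0 : G 0 < 0 := by
    simp only [hG]
    have := gaussMoment_pos (q := (1 - 0 ^ 2) / 2 + 1) (by norm_num) (-0)
    linarith
  have hq : (1 - c₁ ^ 2) / 2 = p := by rw [hc₁sq]; ring
  have hup : gaussMoment (p + 1) (-c₁) ≤ C := by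
    unfold gaussMoment
    rw [hC]
    apply setIntegral_mono_on (integrableOn_gaussMoment (by linarith) _) hi measurableSet_Ioi
    intro s hs
    have hs0 : 0 < s := hs
    have h1 : s ^ (p + 1 - 1) ≤ s ^ ((1 : ℝ) - 1) + s ^ ((2 : ℝ) - 1) := by
      have ha : 0 < s ^ ((1 : ℝ) - 1) := Real.rpow_pos_of_pos hs0 _
      have hb : 0 < s ^ ((2 : ℝ) - 1) := Real.rpow_pos_of_pos hs0 _
      rcases le_total s 1 with h | h
      · have := Real.rpow_le_rpow_of_exponent_ge hs0 h (by linarith : (1 : ℝ) - 1 ≤ p + 1 - 1)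
        linarith
      · have := Real.rpow_le_rpow_of_exponent_le h (by linarith : p + 1 - 1 ≤ (2 : ℝ) - 1)
        linarith
    have h2 : Real.exp (-(2 * -c₁ * s) - s ^ 2) ≤ Real.exp 2 * Real.exp (-(1 / 2) * s ^ 2) := by
      refine (exp_quadratic_le _ _).trans ?_
      gcongr
      nlinarith
    have h3 : 0 ≤ s ^ (p + 1 - 1) := Real.rpow_nonneg hs0.le _
    calc _ ≤ (s ^ ((1 : ℝ) - 1) + s ^ ((2 : ℝ) - 1)) *
          (Real.exp 2 * Real.exp (-(1 / 2) * s ^ 2)) := by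
          apply mul_le_mul h1 h2 (Real.exp_pos _).le (h3.trans h1)
      _ = _ := by ring
  have hlo : Real.exp (-1) / p ≤ gaussMoment p (-c₁) := by
    unfold gaussMoment
    have h1 : ∫ s in Ioc (0 : ℝ) 1, Real.exp (-1) * s ^ (p - 1) = Real.exp (-1) / p := by
      rw [← intervalIntegral.integral_of_le zero_le_one, intervalIntegral.integral_const_mul,
        integral_rpow (Or.inl (by linarith))]
      simp [Real.zero_rpow hp0.ne']
      ring
    rw [← h1]
    have hI := integrableOn_gaussMoment hp0 (-c₁)
    have hI' : IntegrableOn (fun s : ℝ => s ^ (p - 1)) (Ioc 0 1) := by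
      have := (intervalIntegral.intervalIntegrable_rpow' (by linarith : -1 < p - 1)
        (a := 0) (b := 1))
      rwa [intervalIntegrable_iff_integrableOn_Ioc_of_le zero_le_one] at this
    calc _ ≤ ∫ s in Ioc (0 : ℝ) 1, s ^ (p - 1) * Real.exp (-(2 * -c₁ * s) - s ^ 2) := by
          apply setIntegral_mono_on (hI'.const_mul _) (hI.mono_set Ioc_subset_Ioi_self)
            measurableSet_Ioc
          intro s hs
          rw [mul_comm]
          have := Real.rpow_nonneg hs.1.le (p - 1)
          gcongr
          nlinarith [hs.1, hs.2]
      _ ≤ _ := by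
          apply setIntegral_mono_set hI
          · filter_upwards [ae_restrict_mem measurableSet_Ioi] with s hs
            have h0 : 0 ≤ s ^ (p - 1) := Real.rpow_nonneg (le_of_lt hs) _
            simp only [Pi.zero_apply]
            positivity
          · exact Ioc_subset_Ioi_self.eventuallyLE
  have hG1 : 0 < G c₁ := by
    simp only [hG, hq]
    have h1 : 8 * (C + 1) ≤ Real.exp (-1) / p := by
      rw [le_div_iff₀ hp0, Real.exp_neg, le_inv_comm₀ (by positivity) (by positivity)]
      rw [le_inv_comm₀ (by positivity) (by positivity)]
      rw [← one_div, le_div_iff₀ (Real.exp_pos 1)]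
      linarith
    have h2 : 8 * (C + 1) ≤ gaussMoment p (-c₁) := h1.trans hlo
    nlinarith
  obtain ⟨c, hc, hc0⟩ := intermediate_value_Ioo hc₁0 hGc ⟨hG0, hG1⟩
  exact ⟨c, hc.1, hc.2.trans hc₁1, by simp only [hG] at hc0; linarith⟩

/-- The ground state of the de Gennes half-line operator, packaged through its logarithmic
derivative `m`, together with the first order corrector `n` and uniform bounds. -/
structure HalfLine where
  c : ℝ
  C1 : ℝ
  K : ℝ
  w0 : ℝ
  m : ℝ → ℝ
  m1 : ℝ → ℝ
  m2 : ℝ → ℝ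
  n : ℝ → ℝ
  n1 : ℝ → ℝ
  u : ℝ → ℝ
  c_pos : 0 < c
  c_lt : c < 1
  C1_pos : 0 < C1
  K_pos : 0 < K
  w0_pos : 0 < w0
  hasDerivAt_m : ∀ x, HasDerivAt m (m1 x) x
  hasDerivAt_m1 : ∀ x, HasDerivAt m1 (m2 x) x
  hasDerivAt_n : ∀ x, HasDerivAt n (n1 x) x
  hasDerivAt_u : ∀ x, HasDerivAt u (m x * u x) x
  m1_eq : ∀ x, m1 x = (x - c) ^ 2 - c ^ 2 - m x ^ 2
  m2_eq : ∀ x, m2 x = 2 * (x - c) - 2 * m x * m1 x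
  n1_eq : ∀ x, n1 x = 2 * x * (m1 x + c ^ 2) + C1 - 2 * m x * n x
  m_zero : m 0 = 0
  n_zero : n 0 = 0
  m_lower : ∀ x, 0 ≤ x → -x ≤ m x
  m_upper : ∀ x, 0 ≤ x → m x ≤ c - x
  m1_lower : ∀ x, 0 ≤ x → -1 ≤ m1 x
  m1_upper : ∀ x, 0 ≤ x → m1 x ≤ 0
  weight_lower : ∀ x, 0 ≤ x → w0 ≤ (1 - m1 x ^ 2) * (1 + x) ^ 2
  m1_decay : ∀ x, 0 ≤ x → (1 + m1 x) * (1 + x) ^ 2 ≤ K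
  m2_decay : ∀ x, 0 ≤ x → |m2 x| * (1 + x) ≤ K
  n_bound : ∀ x, 0 ≤ x → |n x| ≤ K
  u_pos : ∀ x, 0 < u x
  u_decay : ∀ x, 0 ≤ x → u x ≤ K * Real.exp (-(x - c) ^ 2 / 2)

lemma gaussMoment_antitone {q : ℝ} (hq : 0 < q) : Antitone (gaussMoment q) := by
  apply antitone_of_deriv_nonpos
  · exact fun y => (hasDerivAt_gaussMoment hq y).differentiableAt
  · intro y
    rw [(hasDerivAt_gaussMoment hq y).deriv]
    have := gaussMoment_pos (by linarith : 0 < q + 1) y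
    linarith

/-- Comparison principle for the first order operator `f ↦ f' + 2 m f`. -/
lemma nonneg_of_damped_deriv_nonpos {u m f f' : ℝ → ℝ} {a : ℝ}
    (hu : ∀ x, HasDerivAt u (m x * u x) x) (hup : ∀ x, 0 < u x)
    (hf : ∀ x, a ≤ x → HasDerivAt f (f' x) x) (hle : ∀ x, a ≤ x → f' x + 2 * m x * f x ≤ 0)
    (hlim : Tendsto (fun x => u x ^ 2 * f x) atTop (𝓝 0)) {x : ℝ} (hx : a ≤ x) : 0 ≤ f x := by
  have hd : ∀ x, a ≤ x →
      HasDerivAt (fun x => u x ^ 2 * f x) (u x ^ 2 * (f' x + 2 * m x * f x)) x := by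
    intro x hx
    refine (((hu x).pow 2).mul (hf x hx)).congr_deriv ?_
    simp only [Pi.pow_apply]
    push_cast
    ring
  have hanti : AntitoneOn (fun x => u x ^ 2 * f x) (Ici a) := by
    apply antitoneOn_of_deriv_nonpos (convex_Ici a)
    · exact fun x hx => (hd x hx).continuousAt.continuousWithinAt
    · intro x hx
      rw [interior_Ici] at hx
      exact (hd x (le_of_lt hx)).differentiableAt.differentiableWithinAt
    · intro x hx
      rw [interior_Ici] at hx
      rw [(hd x (le_of_lt hx)).deriv]
      exact mul_nonpos_of_nonneg_of_nonpos (sq_nonneg _) (hle x (le_of_lt hx))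
  have h0 : 0 ≤ u x ^ 2 * f x := by
    apply le_of_tendsto hlim
    filter_upwards [eventually_ge_atTop x] with z hz
    exact hanti hx (hx.trans hz) hz
  exact nonneg_of_mul_nonneg_right h0 (pow_pos (hup x) 2)

lemma tendsto_sq_mul_exp_neg_sq (c : ℝ) (hc0 : 0 < c) (hc1 : c < 1) :
    Tendsto (fun x : ℝ => (1 + x) ^ 2 * Real.exp (-(x - c) ^ 2)) atTop (𝓝 0) := by
  have h : Tendsto (fun x : ℝ => Real.exp 3 * (x ^ 0 * Real.exp (-x) +
      2 * (x ^ 1 * Real.exp (-x)) + x ^ 2 * Real.exp (-x))) atTop (𝓝 0) := by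
    have h0 := Real.tendsto_pow_mul_exp_neg_atTop_nhds_zero 0
    have h1 := Real.tendsto_pow_mul_exp_neg_atTop_nhds_zero 1
    have h2 := Real.tendsto_pow_mul_exp_neg_atTop_nhds_zero 2
    simpa using ((h0.add (h1.const_mul 2)).add h2).const_mul (Real.exp 3)
  refine squeeze_zero' (Eventually.of_forall fun x => by positivity) ?_ h
  filter_upwards [eventually_ge_atTop 0] with x hx
  have : Real.exp (-(x - c) ^ 2) ≤ Real.exp 3 * Real.exp (-x) := by
    rw [← Real.exp_add]
    apply Real.exp_le_exp.mpr
    nlinarith [sq_nonneg (x - 3 / 2)]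
  calc _ ≤ (1 + x) ^ 2 * (Real.exp 3 * Real.exp (-x)) := by gcongr
    _ = _ := by ring

set_option maxHeartbeats 2000000 in
lemma exists_halfLine : Nonempty HalfLine := by
  obtain ⟨c, hc0, hc1, hcJ⟩ := exists_neumann_parameter
  set p : ℝ := (1 - c ^ 2) / 2 with hp
  clear_value p
  have hp0 : 0 < p := by rw [hp]; nlinarith
  have hp1 : p ≤ 1 / 2 := by rw [hp]; nlinarith [sq_nonneg c]
  have hpc : c ^ 2 = 1 - 2 * p := by rw [hp]; ring
  have hJ0 : ∀ y, 0 < gaussMoment p y := gaussMoment_pos hp0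
  have hJ1 : ∀ y, 0 < gaussMoment (p + 1) y := gaussMoment_pos (by linarith)
  set e : ℝ → ℝ := fun x => gaussMoment (p + 1) (x - c) / gaussMoment p (x - c) with he
  set v : ℝ → ℝ := fun x => p / 2 - (x - c) * e x - e x ^ 2 with hv
  have he_pos : ∀ x, 0 < e x := fun x => div_pos (hJ1 _) (hJ0 _)
  have hsub : ∀ x : ℝ, HasDerivAt (fun x : ℝ => x - c) 1 x := fun x =>
    (hasDerivAt_id x).sub_const c
  have hdJ : ∀ q, 0 < q → ∀ x, HasDerivAt (fun x => gaussMoment q (x - c))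
      (-2 * gaussMoment (q + 1) (x - c)) x := by
    intro q hq x
    have h := (hasDerivAt_gaussMoment hq (x - c)).comp x (hsub x)
    rw [mul_one] at h
    exact h
  have hde : ∀ x, HasDerivAt e (-2 * v x) x := by
    intro x
    refine ((hdJ (p + 1) (by linarith) x).div (hdJ p hp0 x) (hJ0 _).ne').congr_deriv ?_
    have h := gaussMoment_recurrence hp0 (x - c)
    have := (hJ0 (x - c)).ne'
    simp only [hv, he, show p + 1 + 1 = p + 2 by ring]
    field_simp
    linear_combination (-gaussMoment p (x - c)) * h
  have he0 : e 0 = c / 2 := by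
    simp only [he, zero_sub]
    rw [div_eq_div_iff (hJ0 _).ne' two_ne_zero]
    linarith
  set m : ℝ → ℝ := fun x => -(x - c) - 2 * e x with hm
  have hdm : ∀ x, HasDerivAt m (-1 + 4 * v x) x := fun x =>
    ((hsub x).neg.sub ((hde x).const_mul 2)).congr_deriv (by ring)
  have hdv : ∀ x, HasDerivAt v (-e x - 2 * m x * v x) x := by
    intro x
    refine (((hasDerivAt_const x (p / 2)).sub ((hsub x).mul (hde x))).sub
      ((hde x).pow 2)).congr_deriv ?_
    simp only [hm]
    push_cast
    ring
  set u : ℝ → ℝ := fun x => Real.exp (-(x - c) ^ 2 / 2) * gaussMoment p (x - c) with hu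
  have hu_pos : ∀ x, 0 < u x := fun x => mul_pos (Real.exp_pos _) (hJ0 _)
  have hdu : ∀ x, HasDerivAt u (m x * u x) x := by
    intro x
    have h1 : HasDerivAt (fun x : ℝ => -(x - c) ^ 2 / 2) (-(x - c)) x :=
      ((((hsub x).pow 2).neg).div_const 2).congr_deriv (by push_cast; ring)
    refine (h1.exp.mul (hdJ p hp0 x)).congr_deriv ?_
    have := (hJ0 (x - c)).ne'
    simp only [hm, hu, he]
    field_simp
    ring
  have hu_sq : ∀ x, u x ^ 2 = Real.exp (-(x - c) ^ 2) * gaussMoment p (x - c) ^ 2 := by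
    intro x
    simp only [hu, mul_pow, ← Real.exp_nat_mul]
    congr 2
    push_cast
    ring
  clear_value u m v
  obtain ⟨A, hA0, hA⟩ : ∃ A, 0 < A ∧ ∀ x, 0 ≤ x →
      u x ^ 2 * (1 + e x + e x ^ 2) ≤ A * Real.exp (-(x - c) ^ 2) := by
    set a := gaussMoment p (-c)
    set b := gaussMoment (p + 1) (-c)
    have ha : 0 < a := hJ0 _
    have hb : 0 < b := hJ1 _
    refine ⟨a ^ 2 + a * b + b ^ 2, by positivity, fun x hx => ?_⟩
    have h1 : gaussMoment p (x - c) ≤ a := gaussMoment_antitone hp0 (by linarith)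
    have h2 : gaussMoment (p + 1) (x - c) ≤ b := gaussMoment_antitone (by linarith) (by linarith)
    have h3 := hJ0 (x - c)
    have h4 := hJ1 (x - c)
    calc u x ^ 2 * (1 + e x + e x ^ 2) = (gaussMoment p (x - c) ^ 2 +
          gaussMoment p (x - c) * gaussMoment (p + 1) (x - c) + gaussMoment (p + 1) (x - c) ^ 2) *
          Real.exp (-(x - c) ^ 2) := by
          rw [hu_sq]
          simp only [he]
          field_simp
      _ ≤ _ := by gcongr
  have hlim : ∀ (f : ℝ → ℝ) (C : ℝ), (∀ x, 0 ≤ x → |f x| ≤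
      C * (1 + x) ^ 2 * (1 + e x + e x ^ 2)) → Tendsto (fun x => u x ^ 2 * f x) atTop (𝓝 0) := by
    intro f C hf
    have hC : 0 ≤ C := by
      have h := (abs_nonneg _).trans (hf 0 le_rfl)
      have h2 : 0 < 1 + e 0 + e 0 ^ 2 := by have := he_pos 0; positivity
      nlinarith
    have ht := (tendsto_sq_mul_exp_neg_sq c hc0 hc1).const_mul (C * A)
    rw [mul_zero] at ht
    refine squeeze_zero_norm' ?_ ht
    filter_upwards [eventually_ge_atTop 0] with x hx
    rw [Real.norm_eq_abs, abs_mul, abs_of_nonneg (sq_nonneg _)]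
    calc _ ≤ u x ^ 2 * (C * (1 + x) ^ 2 * (1 + e x + e x ^ 2)) := by
          gcongr; exact hf x hx
      _ = C * (1 + x) ^ 2 * (u x ^ 2 * (1 + e x + e x ^ 2)) := by ring
      _ ≤ C * (1 + x) ^ 2 * (A * Real.exp (-(x - c) ^ 2)) :=
          mul_le_mul_of_nonneg_left (hA x hx) (by positivity)
      _ = _ := by ring
  have hvb : ∀ x, 0 ≤ x → |v x| ≤ (1 + x) ^ 2 * (1 + e x + e x ^ 2) := by
    intro x hx
    have h := he_pos x
    simp only [hv]
    rw [abs_le]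
    constructor <;> nlinarith [mul_nonneg hx h.le, sq_nonneg x, mul_nonneg (sq_nonneg x) h.le,
      mul_nonneg (sq_nonneg x) (sq_nonneg (e x)), mul_nonneg hx (sq_nonneg (e x)),
      mul_pos hc0 h, mul_pos (sub_pos.mpr hc1) h]
  clear_value e
  have hinv : ∀ x : ℝ, 0 ≤ x → HasDerivAt (fun x : ℝ => 1 / (1 + x)) (-(1 / (1 + x) ^ 2)) x := by
    intro x hx
    have h := ((hasDerivAt_id x).const_add 1).inv (by simp only [id]; linarith : 1 + id x ≠ 0)
    simp only [one_div]
    exact h.congr_deriv (by simp only [id]; field_simp)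
  have hinv2 : ∀ x : ℝ, 0 ≤ x →
      HasDerivAt (fun x : ℝ => 1 / (1 + x) ^ 2) (-(2 / (1 + x) ^ 3)) x := by
    intro x hx
    have h := (hinv x hx).pow 2
    have e1 : (fun x : ℝ => 1 / (1 + x) ^ 2) = (fun x : ℝ => 1 / (1 + x)) ^ 2 := by
      ext x; simp
    rw [e1]
    refine h.congr_deriv ?_
    push_cast
    field_simp
  have hE : ∀ x, 0 < 1 + e x + e x ^ 2 := fun x => by have := he_pos x; positivity
  have hX : ∀ x, 0 ≤ x → 1 ≤ (1 + x) ^ 2 * (1 + e x + e x ^ 2) := by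
    intro x hx
    have := he_pos x
    nlinarith [sq_nonneg x, mul_nonneg (sq_nonneg x) (hE x).le, mul_nonneg hx (hE x).le,
      sq_nonneg (e x)]
  have hX1 : ∀ x, 0 ≤ x → e x ≤ (1 + x) ^ 2 * (1 + e x + e x ^ 2) := by
    intro x hx
    have := he_pos x
    nlinarith [sq_nonneg x, mul_nonneg (sq_nonneg x) (hE x).le, mul_nonneg hx (hE x).le,
      sq_nonneg (e x)]
  have hi1 : ∀ x : ℝ, 0 ≤ x → 0 < 1 / (1 + x) ∧ 1 / (1 + x) ≤ 1 := fun x hx =>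
    ⟨by positivity, by rw [div_le_one (by linarith)]; linarith⟩
  have hi2 : ∀ x : ℝ, 0 ≤ x → 0 < 1 / (1 + x) ^ 2 ∧ 1 / (1 + x) ^ 2 ≤ 1 := fun x hx =>
    ⟨by positivity, by rw [div_le_one (by positivity)]; nlinarith⟩
  -- positivity of the variance, and consequences
  have hv_nonneg : ∀ x, 0 ≤ x → 0 ≤ v x := by
    intro x hx
    refine nonneg_of_damped_deriv_nonpos hdu hu_pos (fun x _ => hdv x) (fun x _ => ?_)
      (hlim v 1 fun x hx => by rw [one_mul]; exact hvb x hx) hx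
    linarith [he_pos x]
  have he_anti : AntitoneOn e (Ici 0) := by
    apply antitoneOn_of_deriv_nonpos (convex_Ici 0)
    · exact fun x hx => (hde x).continuousAt.continuousWithinAt
    · exact fun x hx => (hde x).differentiableAt.differentiableWithinAt
    · intro x hx
      rw [interior_Ici] at hx
      rw [(hde x).deriv]
      linarith [hv_nonneg x (le_of_lt hx)]
  have he_le : ∀ x, 0 ≤ x → e x ≤ c / 2 := fun x hx => by
    rw [← he0]; exact he_anti (by simp) hx hx
  have hm_lo : ∀ x, 0 ≤ x → -x ≤ m x := fun x hx => by
    simp only [hm]; linarith [he_le x hx]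
  have hm_up : ∀ x, 0 ≤ x → m x ≤ c - x := fun x hx => by
    simp only [hm]; linarith [he_pos x]
  have he_lo : ∀ x, 0 ≤ x → p / 3 * (1 / (1 + x)) ≤ e x := by
    intro x hx
    have := nonneg_of_damped_deriv_nonpos (f := fun x => e x - p / 3 * (1 / (1 + x)))
      hdu hu_pos (fun x hx => (hde x).sub ((hinv x hx).const_mul (p / 3))) (fun x hx => ?_)
      (hlim _ 1 fun x hx => ?_) hx
    · linarith
    · have h1 := hi1 x hx
      have h2 := hi2 x hx
      have h3 : 1 / (1 + x) * x ≤ 1 := by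
        rw [div_mul_eq_mul_div, one_mul, div_le_one (by linarith)]; linarith
      have h4 : -(1 / (1 + x) * m x) ≤ 1 := by nlinarith [hm_lo x hx]
      have : (-2) * v x + 2 * m x * e x = -(p + 2 * e x ^ 2) := by
        simp only [hv, hm]; ring
      nlinarith [sq_nonneg (e x)]
    · have h1 := hi1 x hx
      rw [one_mul, abs_le]
      constructor <;> nlinarith [hX x hx, hX1 x hx, he_pos x]
  have hv_lo : ∀ x, 0 ≤ x → p / 12 * (1 / (1 + x) ^ 2) ≤ v x := by
    intro x hx
    have := nonneg_of_damped_deriv_nonpos (f := fun x => v x - p / 12 * (1 / (1 + x) ^ 2))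
      hdu hu_pos (fun x hx => (hdv x).sub ((hinv2 x hx).const_mul (p / 12))) (fun x hx => ?_)
      (hlim _ 2 fun x hx => ?_) hx
    · linarith
    · have h0 := he_lo x hx
      have h2 : 2 / (1 + x) ^ 3 ≤ 2 * (1 / (1 + x)) := by
        rw [mul_one_div]
        apply div_le_div_of_nonneg_left (by norm_num) (by linarith)
        nlinarith [pow_nonneg hx 2, pow_nonneg hx 3]
      have h3 : -(1 / (1 + x) ^ 2 * m x) ≤ 1 / (1 + x) := by
        have : 1 / (1 + x) ^ 2 * (1 + x) = 1 / (1 + x) := by field_simp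
        nlinarith [hm_lo x hx, (hi2 x hx).1]
      nlinarith
    · have h1 := hi2 x hx
      have h2 := abs_le.mp (hvb x hx)
      have h3 := hX x hx
      rw [abs_le]
      constructor <;> nlinarith
  have hv0 : v 0 = 1 / 4 := by
    simp only [hv, he0]; nlinarith
  have hv_up : ∀ x, 0 ≤ x → v x ≤ 1 / 4 := by
    have hbig : ∀ x, c ≤ x → v x ≤ 1 / 4 := by
      intro x hx
      have := nonneg_of_damped_deriv_nonpos (f := fun x => 1 / 4 - v x)
        hdu hu_pos (fun x _ => (hdv x).const_sub (1 / 4)) (fun x hx => ?_)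
        (hlim _ 2 fun x hx => ?_) hx
      · linarith
      · simp only [hm]; nlinarith
      · have h2 := abs_le.mp (hvb x hx)
        have h3 := hX x hx
        rw [abs_le]
        constructor <;> nlinarith
    intro x hx
    rcases le_total c x with h | h
    · exact hbig x h
    · have hmono : MonotoneOn (fun x => u x ^ 2 * (1 / 4 - v x)) (Icc 0 c) := by
        have hd : ∀ x, HasDerivAt (fun x => u x ^ 2 * (1 / 4 - v x))
            (u x ^ 2 * (-(x - c) / 2)) x := by
          intro x
          refine (((hdu x).pow 2).mul ((hdv x).const_sub (1 / 4))).congr_deriv ?_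
          simp only [hm, Pi.pow_apply]
          push_cast
          ring
        apply monotoneOn_of_deriv_nonneg (convex_Icc 0 c)
        · exact fun x hx => (hd x).continuousAt.continuousWithinAt
        · exact fun x hx => (hd x).differentiableAt.differentiableWithinAt
        · intro x hx
          rw [interior_Icc] at hx
          rw [(hd x).deriv]
          have := hx.2
          exact mul_nonneg (sq_nonneg _) (by linarith)
      have h1 := hmono ⟨le_rfl, hc0.le⟩ ⟨hx, h⟩ hx
      simp only [hv0, sub_self, mul_zero] at h1
      have := nonneg_of_mul_nonneg_right h1 (pow_pos (hu_pos x) 2)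
      linarith
  have hm2 : ∀ x, 2 ≤ x → m x ≤ -(1 / 3) * (1 + x) := fun x hx => by
    linarith [hm_up x (by linarith)]
  have he_up : ∀ x, 0 ≤ x → e x ≤ 3 / 2 * (1 / (1 + x)) := by
    have hbig : ∀ x, 2 ≤ x → e x ≤ 3 / 2 * (1 / (1 + x)) := by
      intro x hx
      have := nonneg_of_damped_deriv_nonpos (f := fun x => 3 / 2 * (1 / (1 + x)) - e x)
        hdu hu_pos (fun x hx => ((hinv x (by linarith)).const_mul (3 / 2)).sub (hde x))
        (fun x hx => ?_) (hlim _ 2 fun x hx => ?_) hx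
      · linarith
      · have hx0 : 0 ≤ x := by linarith
        have h1 := hi1 x hx0
        have h2 := hi2 x hx0
        have h4 : 1 / (1 + x) * m x ≤ -(1 / 3) := by
          have := mul_le_mul_of_nonneg_left (hm2 x hx) h1.1.le
          have h5 : 1 / (1 + x) * (-(1 / 3) * (1 + x)) = -(1 / 3) := by field_simp
          linarith
        have : (-2) * v x + 2 * m x * e x = -(p + 2 * e x ^ 2) := by
          simp only [hv, hm]; ring
        nlinarith [he_le x hx0, he_pos x]
      · have h1 := hi1 x hx
        rw [abs_le]
        constructor <;> nlinarith [hX x hx, hX1 x hx, he_pos x]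
    intro x hx
    rcases le_total 2 x with h | h
    · exact hbig x h
    · have h1 : 1 / 3 ≤ 1 / (1 + x) := one_div_le_one_div_of_le (by linarith) (by linarith)
      linarith [he_le x hx]
  have hv_up2 : ∀ x, 0 ≤ x → v x ≤ 9 / 4 * (1 / (1 + x) ^ 2) := by
    have hbig : ∀ x, 2 ≤ x → v x ≤ 9 / 4 * (1 / (1 + x) ^ 2) := by
      intro x hx
      have := nonneg_of_damped_deriv_nonpos (f := fun x => 9 / 4 * (1 / (1 + x) ^ 2) - v x)
        hdu hu_pos (fun x hx => ((hinv2 x (by linarith)).const_mul (9 / 4)).sub (hdv x))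
        (fun x hx => ?_) (hlim _ 4 fun x hx => ?_) hx
      · linarith
      · have hx0 : 0 ≤ x := by linarith
        have h1 := hi1 x hx0
        have h2 := hi2 x hx0
        have h3 : 0 ≤ 2 / (1 + x) ^ 3 := by positivity
        have h4 : 1 / (1 + x) ^ 2 * m x ≤ -(1 / 3) * (1 / (1 + x)) := by
          have := mul_le_mul_of_nonneg_left (hm2 x hx) h2.1.le
          have h5 : 1 / (1 + x) ^ 2 * (-(1 / 3) * (1 + x)) = -(1 / 3) * (1 / (1 + x)) := by
            field_simp
          linarith
        have := he_up x hx0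
        linarith
      · have h1 := hi2 x hx
        have h2 := abs_le.mp (hvb x hx)
        have h3 := hX x hx
        rw [abs_le]
        constructor <;> nlinarith
    intro x hx
    rcases le_total 2 x with h | h
    · exact hbig x h
    · have h1 : 1 / 9 ≤ 1 / (1 + x) ^ 2 := one_div_le_one_div_of_le (by positivity) (by nlinarith)
      linarith [hv_up x hx]
  -- the tail function
  have hu_cont : Continuous u := continuous_iff_continuousAt.mpr fun x => (hdu x).continuousAt
  have hu2_int : IntegrableOn (fun x => u x ^ 2) (Ioi 0) := by
    have hg : IntegrableOn (fun x : ℝ => A * Real.exp 3 * Real.exp (-x)) (Ioi 0) :=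
      (integrableOn_exp_neg_Ioi 0).const_mul _
    refine Integrable.mono' hg (hu_cont.pow 2).aestronglyMeasurable ?_
    filter_upwards [ae_restrict_mem measurableSet_Ioi] with x hx
    have hx0 : 0 < x := hx
    rw [Real.norm_of_nonneg (sq_nonneg _)]
    have : Real.exp (-(x - c) ^ 2) ≤ Real.exp 3 * Real.exp (-x) := by
      rw [← Real.exp_add]
      apply Real.exp_le_exp.mpr
      nlinarith [sq_nonneg (x - 3 / 2)]
    calc u x ^ 2 ≤ u x ^ 2 * (1 + e x + e x ^ 2) := by
          nlinarith [sq_nonneg (u x), he_pos x, sq_nonneg (e x),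
            mul_nonneg (sq_nonneg (u x)) (he_pos x).le,
            mul_nonneg (sq_nonneg (u x)) (sq_nonneg (e x))]
      _ ≤ A * Real.exp (-(x - c) ^ 2) := hA x hx0.le
      _ ≤ A * (Real.exp 3 * Real.exp (-x)) := by gcongr
      _ = _ := by ring
  set N := ∫ x in Ioi (0 : ℝ), u x ^ 2 with hN
  have hN0 : 0 < N := by
    rw [hN, setIntegral_pos_iff_support_of_nonneg_ae _ hu2_int]
    · rw [show (Function.support fun x => u x ^ 2) = univ from ?_]
      · simp
      · ext x; simp [(hu_pos x).ne']
    · exact Eventually.of_forall fun x => sq_nonneg _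
  set I : ℝ → ℝ := fun x => N - ∫ t in (0 : ℝ)..x, u t ^ 2 with hI
  have hdI : ∀ x, HasDerivAt I (-(u x ^ 2)) x := by
    intro x
    exact (intervalIntegral.integral_hasDerivAt_right
      ((hu_cont.pow 2).intervalIntegrable _ _)
      ((hu_cont.pow 2).stronglyMeasurableAtFilter _ _) (hu_cont.pow 2).continuousAt).const_sub N
  have hI_lim : Tendsto I atTop (𝓝 0) := by
    have := (intervalIntegral_tendsto_integral_Ioi 0 hu2_int tendsto_id).const_sub N
    rw [← hN, sub_self] at this
    exact this
  set R : ℝ → ℝ := fun x => I x / u x ^ 2 with hR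
  have hdR : ∀ x, HasDerivAt R (-1 - 2 * m x * R x) x := by
    intro x
    refine ((hdI x).div ((hdu x).pow 2) (pow_pos (hu_pos x) 2).ne').congr_deriv ?_
    have := (hu_pos x).ne'
    simp only [hR, Pi.pow_apply]
    push_cast
    field_simp
  have huR : ∀ x, u x ^ 2 * R x = I x := fun x => by
    have := (hu_pos x).ne'
    simp only [hR]
    field_simp
  have hR_nonneg : ∀ x, 0 ≤ x → 0 ≤ R x := by
    intro x hx
    refine nonneg_of_damped_deriv_nonpos hdu hu_pos (fun x _ => hdR x) (fun x _ => ?_) ?_ hx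
    · linarith
    · simpa only [huR] using hI_lim
  have hR0 : 0 < R 0 := by
    simp only [hR, hI, intervalIntegral.integral_same, sub_zero]
    exact div_pos hN0 (pow_pos (hu_pos 0) 2)
  obtain ⟨KR, hKR0, hKR⟩ : ∃ KR, 0 < KR ∧ ∀ x, 0 ≤ x → R x ≤ KR := by
    have hRc : ContinuousOn R (Icc 0 2) := fun x _ => (hdR x).continuousAt.continuousWithinAt
    obtain ⟨K0, hK0⟩ := (isCompact_Icc.bddAbove_image hRc)
    refine ⟨max K0 1, lt_max_of_lt_right one_pos, fun x hx => ?_⟩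
    rcases le_total x 2 with h | h
    · exact (hK0 ⟨x, ⟨hx, h⟩, rfl⟩).trans (le_max_left _ _)
    · have := nonneg_of_damped_deriv_nonpos (f := fun x => max K0 1 - R x) hdu hu_pos
        (fun x _ => (hdR x).const_sub _) (fun x hx => ?_) ?_ h
      · linarith
      · have h1 : (1 : ℝ) ≤ max K0 1 := le_max_right _ _
        have h2 := hm2 x hx
        nlinarith
      · have h1 := hlim (fun _ => max K0 1) (max K0 1) (fun x hx => by
          have h1 : (1 : ℝ) ≤ max K0 1 := le_max_right _ _
          rw [abs_of_nonneg (by linarith)]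
          nlinarith [hX x hx])
        have h2 := h1.sub hI_lim
        simpa only [mul_sub, huR, sub_zero] using h2
  set C1 := 1 / (3 * R 0) with hC1
  have hC1_pos : 0 < C1 := by positivity
  set m1 : ℝ → ℝ := fun x => -1 + 4 * v x with hm1
  set m2 : ℝ → ℝ := fun x => 2 * (x - c) - 2 * m x * m1 x with hm2'
  have hdm1 : ∀ x, HasDerivAt m1 (m2 x) x := fun x =>
    (((hdv x).const_mul 4).const_add (-1)).congr_deriv (by simp only [hm2', hm1, hm]; ring)
  have hm1_eq : ∀ x, m1 x = (x - c) ^ 2 - c ^ 2 - m x ^ 2 := fun x => by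
    simp only [hm1, hm, hv]; linear_combination hpc
  set n : ℝ → ℝ := fun x => 1 / 3 - (2 * x + c) * m x / 3 + x * (2 * x - c) * m1 x / 3 - C1 * R x
    with hn
  clear_value C1 R
  set n1 : ℝ → ℝ := fun x => 2 * x * (m1 x + c ^ 2) + C1 - 2 * m x * n x with hn1
  have hdn : ∀ x, HasDerivAt n (n1 x) x := by
    intro x
    have ha : HasDerivAt (fun x : ℝ => 2 * x + c) 2 x := by
      simpa using ((hasDerivAt_id x).const_mul 2).add_const c
    have hb : HasDerivAt (fun x : ℝ => x * (2 * x - c)) (4 * x - c) x :=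
      ((hasDerivAt_id x).mul (((hasDerivAt_id x).const_mul 2).sub_const c)).congr_deriv
        (by simp only [id]; ring)
    refine ((((ha.mul (hdm x)).div_const 3).const_sub (1 / 3)).add
      ((hb.mul (hdm1 x)).div_const 3)).sub ((hdR x).const_mul C1) |>.congr_deriv ?_
    simp only [hn1, hn, hm2']
    have h := hm1_eq x
    have h' : -1 + 4 * v x = m1 x := rfl
    rw [h']
    generalize m1 x = M1 at h ⊢
    subst h
    ring
  have hn_eq : ∀ x, n x = (1 - c ^ 2 + 2 * e x * (2 * x + c) + 4 * v x * (x * (2 * x - c))) / 3 -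
      C1 * R x := fun x => by
    simp only [hn, hm, hm1]; ring
  refine ⟨⟨c, C1, 36 + 30 + C1 * KR + Real.exp 0 * gaussMoment p (-c), p / 6, m, m1, m2, n, n1, u,
    hc0, hc1, hC1_pos, ?_, by positivity, hdm, hdm1, hdn, hdu, hm1_eq, fun x => rfl, fun x => rfl,
    ?_, ?_, hm_lo, hm_up, ?_, ?_, ?_, ?_, ?_, ?_, hu_pos, ?_⟩⟩
  · have := hJ0 (-c); positivity
  · simp only [hm, he0]; ring
  · simp only [hn, show m 0 = 0 by simp only [hm, he0]; ring]
    have := hR0.ne'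
    simp only [hC1]
    field_simp
    ring
  · intro x hx; simp only [hm1]; linarith [hv_nonneg x hx]
  · intro x hx; simp only [hm1]; linarith [hv_up x hx]
  · intro x hx
    have h1 := hv_lo x hx
    have h2 := hv_up x hx
    have h3 : p / 12 ≤ v x * (1 + x) ^ 2 := by
      rw [mul_one_div, div_le_iff₀ (by positivity)] at h1
      exact h1
    simp only [hm1]
    nlinarith [mul_nonneg (sub_nonneg.mpr h2) ((div_nonneg hp0.le (by norm_num)).trans h3)]
  · intro x hx
    have h1 := hv_up2 x hx
    rw [mul_one_div, le_div_iff₀ (by positivity)] at h1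
    have := mul_pos hC1_pos hKR0
    have := mul_pos (Real.exp_pos 0) (hJ0 (-c))
    simp only [hm1]
    linarith
  · intro x hx
    have h1 := hv_up2 x hx
    have h2 := he_up x hx
    rw [mul_one_div, le_div_iff₀ (by positivity)] at h1 h2
    have := mul_pos hC1_pos hKR0
    have := mul_pos (Real.exp_pos 0) (hJ0 (-c))
    have h3 : m2 x = -4 * e x - 8 * m x * v x := by simp only [hm2', hm1, hm]; ring
    have h4 : |m x| ≤ 1 + x := abs_le.mpr ⟨by linarith [hm_lo x hx], by linarith [hm_up x hx]⟩
    have h5 : |m2 x| ≤ 4 * e x + 8 * (1 + x) * v x := by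
      rw [h3]
      have h6 : |m x * v x| ≤ (1 + x) * v x := by
        rw [abs_mul, abs_of_nonneg (hv_nonneg x hx)]
        exact mul_le_mul_of_nonneg_right h4 (hv_nonneg x hx)
      have h7 := abs_le.mp h6
      have := he_pos x
      rw [abs_le]
      constructor <;> linarith
    nlinarith [mul_le_mul_of_nonneg_right h5 (by linarith : 0 ≤ 1 + x)]
  · intro x hx
    have h1 := hv_up2 x hx
    have h2 := he_up x hx
    rw [mul_one_div, le_div_iff₀ (by positivity)] at h1 h2
    have h3 := hv_nonneg x hx
    have h4 := he_pos x
    have h5 := mul_pos (Real.exp_pos 0) (hJ0 (-c))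
    have h6 := mul_le_mul_of_nonneg_left (hKR x hx) hC1_pos.le
    have h7 := mul_nonneg hC1_pos.le (hR_nonneg x hx)
    have h8 : 2 * e x * (2 * x + c) ≤ 6 := by nlinarith
    have h9 : 0 ≤ 2 * e x * (2 * x + c) := by positivity
    have h10 : |4 * v x * (x * (2 * x - c))| ≤ 18 := by
      rw [abs_mul, abs_of_nonneg (by positivity)]
      have : |x * (2 * x - c)| ≤ 2 * (1 + x) ^ 2 := by
        rw [abs_le]; constructor <;> nlinarith
      nlinarith
    have h11 := abs_le.mp h10
    rw [hn_eq, abs_le]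
    constructor <;> nlinarith
  · intro x hx
    have h1 : gaussMoment p (x - c) ≤ gaussMoment p (-c) :=
      gaussMoment_antitone hp0 (by linarith)
    have := mul_pos hC1_pos hKR0
    have h2 := Real.exp_pos (-(x - c) ^ 2 / 2)
    have h3 := hJ0 (-c)
    simp only [hu, Real.exp_zero]
    nlinarith [mul_le_mul_of_nonneg_left h1 h2.le]

lemma inv_one_sub_le {a : ℝ} (ha : |a| ≤ 1 / 2) : 1 / (1 - a) ≤ 1 + a + 2 * a ^ 2 := by
  have h := abs_le.mp ha
  rw [div_le_iff₀ (by linarith)]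
  nlinarith [mul_nonneg (sq_nonneg a) (by linarith : 0 ≤ 1 - 2 * a)]

lemma perturbed_square_le {t a a0 δ Y Q q : ℝ} (ht : 0 ≤ t) (ha : |a| ≤ a0 * t)
    (hat : a0 * t ≤ 1 / 2) (ha0 : 1 ≤ a0) (hδ0 : 0 ≤ δ) (hδ1 : δ ≤ 1) (hQ : |Q| ≤ q) :
    ((1 - δ * t) * Y + Q) ^ 2 * (1 + a + 2 * a ^ 2) ≤
      (1 - 2 * (δ * t) + a + (2 + 2 * a0 ^ 2 + 2 * a0) * t ^ 2) * Y ^ 2 + 2 * Q * Y +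
        q * (2 * a0 + 2) * t * (1 + Y ^ 2) + 2 * q ^ 2 := by
  have hq : 0 ≤ q := (abs_nonneg _).trans hQ
  have ha' := abs_le.mp ha
  have ht2 : t ≤ 1 / 2 := by nlinarith
  have hθ0 : 0 ≤ δ * t := by positivity
  have hθ1 : δ * t ≤ t := by nlinarith
  have hasq : a ^ 2 ≤ a0 ^ 2 * t ^ 2 := by
    rw [← sq_abs, ← mul_pow]; gcongr
  have hasq' : 2 * a ^ 2 ≤ a0 * t := by nlinarith
  have hg0 : 0 ≤ 1 + a + 2 * a ^ 2 := by nlinarith [sq_nonneg a]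
  have hg2 : 1 + a + 2 * a ^ 2 ≤ 2 := by nlinarith
  have h1 : (1 - δ * t) ^ 2 * (1 + a + 2 * a ^ 2) ≤
      1 - 2 * (δ * t) + a + (2 + 2 * a0 ^ 2 + 2 * a0) * t ^ 2 := by
    have e1 : (δ * t) ^ 2 * (1 + a + 2 * a ^ 2) ≤ 2 * t ^ 2 := by
      have : (δ * t) ^ 2 ≤ t ^ 2 := by gcongr
      nlinarith [sq_nonneg (δ * t)]
    have e2 : -(2 * (δ * t) * a) ≤ 2 * a0 * t ^ 2 := by
      have : δ * t * (-a) ≤ t * (a0 * t) := by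
        calc δ * t * (-a) ≤ δ * t * (a0 * t) := by gcongr; linarith
          _ ≤ t * (a0 * t) := by gcongr
      nlinarith
    have e3 : 0 ≤ δ * t * a ^ 2 := by positivity
    nlinarith
  have h2 : |(1 - δ * t) * (1 + a + 2 * a ^ 2) - 1| ≤ (2 * a0 + 2) * t := by
    have e3 : δ * t * (1 + a + 2 * a ^ 2) ≤ t * 2 := by gcongr
    have e4 : 0 ≤ δ * t * (1 + a + 2 * a ^ 2) := by positivity
    rw [abs_le]
    constructor <;> nlinarith [sq_nonneg a]
  have h3 : 2 * (Q * Y) * ((1 - δ * t) * (1 + a + 2 * a ^ 2) - 1) ≤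
      q * (2 * a0 + 2) * t * (1 + Y ^ 2) := by
    have e1 : |2 * (Q * Y)| ≤ q * (1 + Y ^ 2) := by
      rw [abs_mul, abs_two, abs_mul]
      have : 2 * |Y| ≤ 1 + Y ^ 2 := by nlinarith [sq_nonneg (|Y| - 1), sq_abs Y]
      nlinarith [abs_nonneg Y, abs_nonneg Q]
    calc _ ≤ |2 * (Q * Y) * ((1 - δ * t) * (1 + a + 2 * a ^ 2) - 1)| := le_abs_self _
      _ ≤ (q * (1 + Y ^ 2)) * ((2 * a0 + 2) * t) := by rw [abs_mul]; gcongr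
      _ = _ := by ring
  have h4 : Q ^ 2 * (1 + a + 2 * a ^ 2) ≤ 2 * q ^ 2 := by
    have : Q ^ 2 ≤ q ^ 2 := by rw [← sq_abs]; gcongr
    nlinarith [sq_nonneg Q]
  nlinarith [mul_le_mul_of_nonneg_right h1 (sq_nonneg Y)]

lemma HalfLine.weight_nonneg (D : HalfLine) {x : ℝ} (hx : 0 ≤ x) : 0 ≤ 1 - D.m1 x ^ 2 := by
  have h1 := D.m1_lower x hx
  have h2 := D.m1_upper x hx
  nlinarith

/-- The region where `t` is not controlled by `h` carries positive energy. -/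
lemma HalfLine.le_absorb (D : HalfLine) {h x r t σ : ℝ} (hh : 0 ≤ h) (hx : 0 ≤ x)
    (ht : t = h * x) (hr : t ≤ r) :
    t ≤ t * (D.m x + σ * D.m1 x) ^ 2 / 4 + 4 * r / D.w0 * (σ ^ 2 * (1 - D.m1 x ^ 2)) + 7 * h := by
  have hw := D.weight_lower x hx
  have hw0 := D.w0_pos
  have ht0 : 0 ≤ t := by rw [ht]; positivity
  have hr0 : 0 ≤ r := ht0.trans hr
  have hm1 := D.m1_lower x hx
  have hm1' := D.m1_upper x hx
  have hwn := D.weight_nonneg hx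
  have hs : 0 ≤ 4 * r / D.w0 * (σ ^ 2 * (1 - D.m1 x ^ 2)) := by positivity
  set Y := D.m x + σ * D.m1 x with hY
  have hYn : 0 ≤ t * Y ^ 2 := by positivity
  by_cases hY2 : 4 ≤ Y ^ 2
  · nlinarith
  by_cases hx7 : x ≤ 7
  · nlinarith
  push Not at hY2 hx7
  have hY3 : -2 < Y := by nlinarith
  have hmu := D.m_upper x hx
  have hc := D.c_lt
  have hσ : x - 3 ≤ |σ| := by
    have e1 : x - 3 ≤ σ * D.m1 x := by linarith
    have e2 : σ * D.m1 x ≤ |σ| * 1 := by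
      calc σ * D.m1 x ≤ |σ * D.m1 x| := le_abs_self _
        _ = |σ| * |D.m1 x| := abs_mul _ _
        _ ≤ |σ| * 1 := by gcongr; exact abs_le.mpr ⟨hm1, by linarith⟩
    linarith
  have hσ2 : (1 + x) ^ 2 ≤ 4 * σ ^ 2 := by
    rw [← sq_abs σ]
    nlinarith [abs_nonneg σ]
  have hkey : D.w0 ≤ 4 * (σ ^ 2 * (1 - D.m1 x ^ 2)) := by
    nlinarith [mul_le_mul_of_nonneg_left hσ2 hwn]
  have : r ≤ 4 * r / D.w0 * (σ ^ 2 * (1 - D.m1 x ^ 2)) := by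
    rw [div_mul_eq_mul_div, le_div_iff₀ hw0]
    nlinarith
  linarith

set_option maxHeartbeats 800000 in
lemma HalfLine.symbol_lower_aux (D : HalfLine) {k δ r h x σ a0 G C : ℝ}
    (hδ0 : 0 < δ) (hδ1 : δ ≤ 1) (hh : 0 < h) (hx : 0 ≤ x) (hr : h * x ≤ r)
    (ha0 : a0 = 2 * (|k| + 1)) (hG : G = 4 * |k| * D.K + D.K + 1)
    (hC : C = 2 + 2 * a0 ^ 2 + 2 * a0 + |k| * D.K * (2 * a0 + 2) + 2 * (|k| * D.K) ^ 2)
    (hr1 : a0 * r ≤ 1 / 2) (hr2 : C * r ≤ δ / 16) (hr3 : 8 * G ^ 2 * r ≤ δ * D.w0)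
    (hr4 : 48 * δ * r ≤ D.w0) (hh1 : C * h ≤ δ / 16) :
    0 < 1 - 2 * (k + δ / 8) * (h * x) ∧
    D.c ^ 2 - h * k * D.C1 - (21 * δ + 8 * G ^ 2 * h / D.w0 + C * r + C * h) * h ≤
      (1 + 2 * (k - δ / 8) * (h * x)) * (x - D.c + σ) ^ 2
      - ((1 - δ * (h * x)) * D.m1 x - δ * h * D.m x + h * k * D.n1 x)
      - ((1 - δ * (h * x)) * D.m2 x - δ * h * D.m1 x) * σ
      - ((1 - δ * (h * x)) * D.m x + h * k * D.n x + (1 - δ * (h * x)) * D.m1 x * σ) ^ 2 /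
          (1 - 2 * (k + δ / 8) * (h * x)) := by
  have hK := D.K_pos
  have hw0 := D.w0_pos
  set t := h * x with ht
  have ht0 : 0 ≤ t := by rw [ht]; positivity
  have habsorb := D.le_absorb (σ := σ) hh.le hx ht hr
  have hk := neg_abs_le k
  have hk' := le_abs_self k
  have hk0 := abs_nonneg k
  have ha1 : 1 ≤ a0 := by linarith
  have hat : a0 * t ≤ 1 / 2 := (mul_le_mul_of_nonneg_left hr (by linarith)).trans hr1
  have hCn : 0 ≤ C := by rw [hC]; positivity
  have ha : |2 * (k + δ / 8) * t| ≤ a0 * t := by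
    rw [abs_mul, abs_of_nonneg ht0]
    gcongr
    rw [abs_le]; constructor <;> linarith
  have hb1 : 0 < 1 - 2 * (k + δ / 8) * t := by
    have := (abs_le.mp (ha.trans hat)).2; linarith
  refine ⟨hb1, ?_⟩
  set Y := D.m x + σ * D.m1 x with hY
  set X := x - D.c + σ with hX
  set w := 1 - D.m1 x ^ 2 with hw
  have hQ : |h * k * D.n x| ≤ h * (|k| * D.K) := by
    rw [abs_mul, abs_mul, abs_of_pos hh, mul_assoc]
    have := D.n_bound x hx
    gcongr
  have hN : ((1 - δ * t) * D.m x + h * k * D.n x + (1 - δ * t) * D.m1 x * σ) ^ 2 /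
      (1 - 2 * (k + δ / 8) * t) ≤
      (1 - 2 * (δ * t) + 2 * (k + δ / 8) * t + (2 + 2 * a0 ^ 2 + 2 * a0) * t ^ 2) * Y ^ 2 +
        2 * (h * k * D.n x) * Y +
        h * (|k| * D.K) * (2 * a0 + 2) * t * (1 + Y ^ 2) + 2 * (h * (|k| * D.K)) ^ 2 := by
    refine le_trans ?_ (perturbed_square_le ht0 ha hat ha1 hδ0.le hδ1 hQ)
    rw [div_eq_mul_one_div, show (1 - δ * t) * D.m x + h * k * D.n x + (1 - δ * t) * D.m1 x * σ =
      (1 - δ * t) * Y + h * k * D.n x by rw [hY]; ring]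
    gcongr
    exact inv_one_sub_le (ha.trans hat)
  have hXY : X ^ 2 = Y ^ 2 + (D.m1 x + σ * D.m2 x) + D.c ^ 2 + σ ^ 2 * w := by
    rw [hX, hY, hw, D.m2_eq]
    linear_combination (-1) * D.m1_eq x
  have hwn : 0 ≤ w := D.weight_nonneg hx
  have hwl := D.weight_lower x hx
  have hm2 : |D.m2 x| * (1 + x) ≤ D.K := D.m2_decay x hx
  have hxm2 : |x * D.m2 x| ≤ D.K := by
    rw [abs_mul, abs_of_nonneg hx]; linarith [abs_nonneg (D.m2 x)]
  have hm1 : |D.m1 x| ≤ 1 :=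
    abs_le.mpr ⟨D.m1_lower x hx, (D.m1_upper x hx).trans zero_le_one⟩
  have hml := D.m_lower x hx
  have hn := D.n_bound x hx
  -- all terms linear in `σ`
  have hlin : -(h * |σ| * G) ≤ h * σ * (k * (2 * (x * D.m2 x) - 2 * (D.n x * D.m1 x)) +
      δ * (3 / 4 * (x * D.m2 x) + D.m1 x)) := by
    have hnm : |D.n x * D.m1 x| ≤ D.K := by
      rw [abs_mul]
      calc |D.n x| * |D.m1 x| ≤ D.K * 1 := by gcongr
        _ = D.K := mul_one _
    have e : |k * (2 * (x * D.m2 x) - 2 * (D.n x * D.m1 x)) +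
      δ * (3 / 4 * (x * D.m2 x) + D.m1 x)| ≤ G := by
      have e1 : |2 * (x * D.m2 x) - 2 * (D.n x * D.m1 x)| ≤ 4 * D.K := by
        have h1 := abs_le.mp hxm2; have h2 := abs_le.mp hnm
        rw [abs_le]; constructor <;> linarith
      have e2 : |3 / 4 * (x * D.m2 x) + D.m1 x| ≤ D.K + 1 := by
        have h1 := abs_le.mp hxm2; have h2 := abs_le.mp hm1
        rw [abs_le]; constructor <;> linarith
      calc _ ≤ |k * (2 * (x * D.m2 x) - 2 * (D.n x * D.m1 x))| +
            |δ * (3 / 4 * (x * D.m2 x) + D.m1 x)| := abs_add_le _ _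
        _ ≤ |k| * (4 * D.K) + 1 * (D.K + 1) := by
            rw [abs_mul, abs_mul, abs_of_pos hδ0]; gcongr
        _ = G := by rw [hG]; ring
    have := neg_abs_le (h * σ * (k * (2 * (x * D.m2 x) - 2 * (D.n x * D.m1 x)) +
      δ * (3 / 4 * (x * D.m2 x) + D.m1 x)))
    rw [abs_mul, abs_mul, abs_of_pos hh] at this
    have h2 : h * |σ| * |k * (2 * (x * D.m2 x) - 2 * (D.n x * D.m1 x)) +
      δ * (3 / 4 * (x * D.m2 x) + D.m1 x)| ≤ h * |σ| * G := by gcongr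
    linarith
  have hyoung : h * |σ| * G ≤ σ ^ 2 * w / 8 + 4 * G ^ 2 / D.w0 * (h ^ 2 + r * t) := by
    have hGn : 0 ≤ G := by rw [hG]; positivity
    have e1 : 4 * G ^ 2 / D.w0 * (h ^ 2 + r * t) =
        (4 * G ^ 2 * (h ^ 2 + r * t)) / D.w0 := by ring
    have e2 : σ ^ 2 * w / 8 + (4 * G ^ 2 * (h ^ 2 + r * t)) / D.w0 - h * |σ| * G =
        (σ ^ 2 * w * D.w0 + 32 * G ^ 2 * (h ^ 2 + r * t) - 8 * h * |σ| * G * D.w0) /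
          (8 * D.w0) := by
      field_simp
      ring
    have e3 : 0 ≤ σ ^ 2 * w * D.w0 + 32 * G ^ 2 * (h ^ 2 + r * t) - 8 * h * |σ| * G * D.w0 := by
      have f1 : (h * (1 + x)) ^ 2 ≤ 2 * (h ^ 2 + r * t) := by
        have : h * (1 + x) = h + t := by rw [ht]; ring
        rw [this]
        linarith [sq_nonneg (h - t), mul_le_mul_of_nonneg_right hr ht0]
      have hx1 : 0 < 1 + x := by linarith
      have f2 : 8 * h * |σ| * G * D.w0 * (1 + x) ^ 2 ≤
          σ ^ 2 * D.w0 * D.w0 + 16 * G ^ 2 * (h * (1 + x)) ^ 2 * (1 + x) ^ 2 := by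
        rw [← sq_abs σ]
        linarith [sq_nonneg (|σ| * D.w0 - 4 * G * (h * (1 + x)) * (1 + x))]
      have f3 : σ ^ 2 * D.w0 * D.w0 ≤ σ ^ 2 * D.w0 * (w * (1 + x) ^ 2) := by gcongr
      have f4 : 16 * G ^ 2 * (h * (1 + x)) ^ 2 * (1 + x) ^ 2 ≤
          16 * G ^ 2 * (2 * (h ^ 2 + r * t)) * (1 + x) ^ 2 := by gcongr
      have f5 : 0 ≤ (σ ^ 2 * w * D.w0 + 32 * G ^ 2 * (h ^ 2 + r * t) -
          8 * h * |σ| * G * D.w0) * (1 + x) ^ 2 := by linarith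
      exact nonneg_of_mul_nonneg_left f5 (by positivity)
    have e4 := div_nonneg e3 (by positivity : 0 ≤ 8 * D.w0)
    rw [← e2] at e4
    rw [e1]
    linarith
  have hGr : 4 * G ^ 2 / D.w0 * (r * t) ≤ δ / 2 * t := by
    have : 4 * G ^ 2 / D.w0 * r ≤ δ / 2 := by
      rw [div_mul_eq_mul_div, div_le_iff₀ hw0]; linarith
    have := mul_le_mul_of_nonneg_right this ht0
    linarith
  have hσr : 3 * δ * (4 * r / D.w0 * (σ ^ 2 * w)) ≤ σ ^ 2 * w / 4 := by
    have : 3 * δ * (4 * r / D.w0) ≤ 1 / 4 := by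
      rw [mul_div_assoc', div_le_iff₀ hw0]; linarith
    have h0 : 0 ≤ σ ^ 2 * w := by positivity
    have := mul_le_mul_of_nonneg_right this h0
    linarith
  have hC1 : (2 + 2 * a0 ^ 2 + 2 * a0) * t ^ 2 * Y ^ 2 ≤ δ / 16 * (t * Y ^ 2) := by
    have h0 : 0 ≤ t * Y ^ 2 := by positivity
    have h1 : 2 + 2 * a0 ^ 2 + 2 * a0 ≤ C := by
      rw [hC]
      have : 0 ≤ |k| * D.K * (2 * a0 + 2) + 2 * (|k| * D.K) ^ 2 := by positivity
      linarith
    have h2 : (2 + 2 * a0 ^ 2 + 2 * a0) * t ≤ δ / 16 := by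
      calc _ ≤ C * r := by gcongr
        _ ≤ _ := hr2
    have := mul_le_mul_of_nonneg_right h2 h0
    linarith
  have hC2 : h * (|k| * D.K) * (2 * a0 + 2) * t * (1 + Y ^ 2) ≤
      δ / 16 * (t * Y ^ 2) + C * r * h := by
    have h0 : 0 ≤ t * Y ^ 2 := by positivity
    have h1 : |k| * D.K * (2 * a0 + 2) ≤ C := by
      rw [hC]
      have : 0 ≤ 2 + 2 * a0 ^ 2 + 2 * a0 + 2 * (|k| * D.K) ^ 2 := by positivity
      linarith
    have h2 : |k| * D.K * (2 * a0 + 2) * h * (t * Y ^ 2) ≤ δ / 16 * (t * Y ^ 2) := by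
      gcongr
      calc _ ≤ C * h := by gcongr
        _ ≤ _ := hh1
    have h3 : |k| * D.K * (2 * a0 + 2) * t * h ≤ C * r * h := by gcongr
    linarith
  have hC3 : 2 * (h * (|k| * D.K)) ^ 2 ≤ C * h * h := by
    have h1 : 2 * (|k| * D.K) ^ 2 ≤ C := by
      rw [hC]
      have : 0 ≤ 2 + 2 * a0 ^ 2 + 2 * a0 + |k| * D.K * (2 * a0 + 2) := by positivity
      linarith
    calc _ = 2 * (|k| * D.K) ^ 2 * (h * h) := by ring
      _ ≤ C * (h * h) := by gcongr
      _ = _ := by ring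
  have hσk : σ ^ 2 * w / 2 ≤ σ ^ 2 * w * (1 + 2 * (k - δ / 8) * t) := by
    have h0 : 0 ≤ σ ^ 2 * w := by positivity
    have : (1 : ℝ) / 2 ≤ 1 + 2 * (k - δ / 8) * t := by
      have : -(a0 * t) ≤ 2 * (k - δ / 8) * t := by
        rw [← neg_mul]; gcongr; linarith
      linarith
    have := mul_le_mul_of_nonneg_left this h0
    linarith
  have hm1t : -t ≤ t * D.m1 x := by
    have := mul_le_mul_of_nonneg_left (D.m1_lower x hx) ht0; linarith
  have hmh : -t ≤ h * D.m x := by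
    have := mul_le_mul_of_nonneg_left hml hh.le; linarith
  have hc2 : t * D.c ^ 2 ≤ t := by
    have : D.c ^ 2 ≤ 1 := pow_le_one₀ D.c_pos.le D.c_lt.le
    have := mul_le_mul_of_nonneg_left this ht0
    linarith
  have hexp : (1 + 2 * (k - δ / 8) * t) * X ^ 2
      - ((1 - δ * t) * D.m1 x - δ * h * D.m x + h * k * D.n1 x)
      - ((1 - δ * t) * D.m2 x - δ * h * D.m1 x) * σ
      - ((1 - 2 * (δ * t) + 2 * (k + δ / 8) * t) * Y ^ 2 + 2 * (h * k * D.n x) * Y) =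
      D.c ^ 2 - h * k * D.C1 + σ ^ 2 * w * (1 + 2 * (k - δ / 8) * t) +
      h * σ * (k * (2 * (x * D.m2 x) - 2 * (D.n x * D.m1 x)) +
      δ * (3 / 4 * (x * D.m2 x) + D.m1 x)) + 3 / 4 * δ * (t * D.m1 x) + δ * (h * D.m x) -
      δ / 4 * (t * D.c ^ 2) + 3 / 2 * δ * (t * Y ^ 2) := by
    rw [hXY, D.n1_eq, hY, ht]
    ring
  have hG2 : 4 * G ^ 2 / D.w0 * h ^ 2 ≤ 8 * G ^ 2 * h / D.w0 * h := by
    have : 0 ≤ 4 * G ^ 2 * h ^ 2 / D.w0 := by positivity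
    have e : 8 * G ^ 2 * h / D.w0 * h = 2 * (4 * G ^ 2 * h ^ 2 / D.w0) := by ring
    have e' : 4 * G ^ 2 / D.w0 * h ^ 2 = 4 * G ^ 2 * h ^ 2 / D.w0 := by ring
    linarith
  have hab3 : 3 * δ * t ≤ 3 / 4 * δ * (t * Y ^ 2) +
      3 * δ * (4 * r / D.w0 * (σ ^ 2 * w)) + 21 * δ * h := by
    have := mul_le_mul_of_nonneg_left habsorb (by positivity : 0 ≤ 3 * δ)
    linarith
  have htY : 0 ≤ δ * (t * Y ^ 2) := by positivity
  have q1 := mul_le_mul_of_nonneg_left hm1t (by positivity : 0 ≤ 3 / 4 * δ)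
  have q2 := mul_le_mul_of_nonneg_left hmh hδ0.le
  have q3 := mul_le_mul_of_nonneg_left hc2 (by positivity : 0 ≤ δ / 4)
  have q4 : 0 ≤ δ * t := by positivity
  have q5 : 0 ≤ σ ^ 2 * w := by positivity
  linarith only [hN, hexp, hlin, hyoung, hGr, hσr, hC1, hC2, hC3, hσk, q1, q2, q3, q4,
    q5, hG2, hab3, htY]

/-- Pointwise lower bound for the symbol of the curvature-perturbed half-line operator. -/
lemma HalfLine.symbol_lower (D : HalfLine) (k : ℝ) {η : ℝ} (hη : 0 < η) :
    ∃ ε > 0, ∃ δ > 0, ∃ r > 0, ∃ h0 > 0, ∀ h x σ : ℝ, 0 < h → h < h0 → 0 ≤ x → h * x ≤ r →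
    0 < 1 - 2 * (k + ε) * (h * x) ∧
    D.c ^ 2 - h * k * D.C1 - η * h ≤
      (1 + 2 * (k - ε) * (h * x)) * (x - D.c + σ) ^ 2
      - ((1 - δ * (h * x)) * D.m1 x - δ * h * D.m x + h * k * D.n1 x)
      - ((1 - δ * (h * x)) * D.m2 x - δ * h * D.m1 x) * σ
      - ((1 - δ * (h * x)) * D.m x + h * k * D.n x + (1 - δ * (h * x)) * D.m1 x * σ) ^ 2 /
          (1 - 2 * (k + ε) * (h * x)) := by
  have hK := D.K_pos
  have hw0 := D.w0_pos
  obtain ⟨δ, hδ⟩ : ∃ δ, δ = min 1 (η / 84) := ⟨_, rfl⟩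
  obtain ⟨a0, ha0⟩ : ∃ a0, a0 = 2 * (|k| + 1) := ⟨_, rfl⟩
  obtain ⟨G, hG⟩ : ∃ G, G = 4 * |k| * D.K + D.K + 1 := ⟨_, rfl⟩
  obtain ⟨C, hC⟩ : ∃ C, C = 2 + 2 * a0 ^ 2 + 2 * a0 + |k| * D.K * (2 * a0 + 2) +
    2 * (|k| * D.K) ^ 2 := ⟨_, rfl⟩
  have hδ0 : 0 < δ := by rw [hδ]; exact lt_min one_pos (by linarith)
  have hδ1 : δ ≤ 1 := by rw [hδ]; exact min_le_left _ _
  have hδη : δ ≤ η / 84 := by rw [hδ]; exact min_le_right _ _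
  have ha0p : 0 < a0 := by rw [ha0]; positivity
  have hGp : 0 < G := by rw [hG]; positivity
  have hCp : 0 < C := by rw [hC]; positivity
  have small : ∀ a b : ℝ, 0 < a → 0 < b → ∃ r > 0, ∀ r' ≤ r, a * r' ≤ b := by
    intro a b ha hb
    refine ⟨b / a, by positivity, fun r' hr' => ?_⟩
    rw [le_div_iff₀ ha] at hr'
    linarith
  obtain ⟨r1, hr1, H1⟩ := small a0 (1 / 2) ha0p (by norm_num)
  obtain ⟨r2, hr2, H2⟩ := small C (δ / 16) hCp (by positivity)
  obtain ⟨r3, hr3, H3⟩ := small (8 * G ^ 2) (δ * D.w0) (by positivity) (by positivity)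
  obtain ⟨r4, hr4, H4⟩ := small (48 * δ) D.w0 (by positivity) hw0
  obtain ⟨r5, hr5, H5⟩ := small C (η / 4) hCp (by positivity)
  obtain ⟨r6, hr6, H6⟩ := small (8 * G ^ 2 / D.w0) (η / 4) (by positivity) (by positivity)
  refine ⟨δ / 8, by positivity, δ, hδ0, min (min r1 r2) (min r3 (min r4 r5)), by positivity,
    min r2 (min r5 r6), by positivity, fun h x σ hh hh0 hx hr => ?_⟩
  have l1 : min (min r1 r2) (min r3 (min r4 r5)) ≤ r1 := by simp
  have l2 : min (min r1 r2) (min r3 (min r4 r5)) ≤ r2 := by simp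
  have l3 : min (min r1 r2) (min r3 (min r4 r5)) ≤ r3 := by simp
  have l4 : min (min r1 r2) (min r3 (min r4 r5)) ≤ r4 := by simp
  have l5 : min (min r1 r2) (min r3 (min r4 r5)) ≤ r5 := by simp
  have m2 : min r2 (min r5 r6) ≤ r2 := by simp
  have m5 : min r2 (min r5 r6) ≤ r5 := by simp
  have m6 : min r2 (min r5 r6) ≤ r6 := by simp
  have key := D.symbol_lower_aux (σ := σ) hδ0 hδ1 hh hx hr ha0 hG hC (H1 _ l1) (H2 _ l2)
    (H3 _ l3) (H4 _ l4) (H2 h (by linarith))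
  refine ⟨key.1, le_trans ?_ key.2⟩
  have g1 := H5 _ l5
  have g2 := H5 h (by linarith)
  have g3 := H6 h (by linarith)
  have : 21 * δ + 8 * G ^ 2 * h / D.w0 + C * min (min r1 r2) (min r3 (min r4 r5)) + C * h ≤ η := by
    have e : 8 * G ^ 2 * h / D.w0 = 8 * G ^ 2 / D.w0 * h := by ring
    rw [e]
    linarith
  have := mul_le_mul_of_nonneg_right this hh.le
  linarith

lemma HasCompactSupport.section_fst {E : Type*} [Zero E] {f : Plane → E}
    (hf : HasCompactSupport f) (x : ℝ) : HasCompactSupport fun s => f (s, x) := by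
  refine HasCompactSupport.intro (hf.isCompact.image continuous_fst) fun s hs => ?_
  by_contra h
  exact hs ⟨(s, x), subset_tsupport f h, rfl⟩

lemma HasCompactSupport.inner_left {f g : Plane → ℂ} (hf : HasCompactSupport f) :
    HasCompactSupport fun z => inner ℝ (f z) (g z) := by
  refine hf.mono fun z hz hfz => hz ?_
  simp only [hfz, inner_zero_left]

/-- The partial derivative in the first coordinate of a complex function on the plane. -/
def pd1 (V : Plane → ℂ) (z : Plane) : ℂ := fderiv ℝ V z (1, 0)

/-- The partial derivative in the second coordinate. -/
def pd2 (V : Plane → ℂ) (z : Plane) : ℂ := fderiv ℝ V z (0, 1)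

lemma continuous_pd1 {V : Plane → ℂ} (hV : ContDiff ℝ 1 V) : Continuous (pd1 V) :=
  (hV.continuous_fderiv one_ne_zero).clm_apply continuous_const

lemma continuous_pd2 {V : Plane → ℂ} (hV : ContDiff ℝ 1 V) : Continuous (pd2 V) :=
  (hV.continuous_fderiv one_ne_zero).clm_apply continuous_const

lemma hasCompactSupport_pd1 {V : Plane → ℂ} (hV : HasCompactSupport V) :
    HasCompactSupport (pd1 V) := hV.fderiv_apply ℝ (1, 0)

lemma hasCompactSupport_pd2 {V : Plane → ℂ} (hV : HasCompactSupport V) :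
    HasCompactSupport (pd2 V) := hV.fderiv_apply ℝ (0, 1)

lemma hasDerivAt_pd1 {V : Plane → ℂ} {s x : ℝ} (hV : DifferentiableAt ℝ V (s, x)) :
    HasDerivAt (fun s => V (s, x)) (pd1 V (s, x)) s :=
  hV.hasFDerivAt.comp_hasDerivAt (f := fun s : ℝ => (s, x)) s
    ((hasDerivAt_id s).prodMk (hasDerivAt_const s x))

lemma hasDerivAt_pd2 {V : Plane → ℂ} {s x : ℝ} (hV : DifferentiableAt ℝ V (s, x)) :
    HasDerivAt (fun x => V (s, x)) (pd2 V (s, x)) x :=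
  hV.hasFDerivAt.comp_hasDerivAt (f := fun x : ℝ => (s, x)) x
    ((hasDerivAt_const x s).prodMk (hasDerivAt_id x))

lemma hasDerivAt_line_integral {V U : Plane → ℂ} (hV : ContDiff ℝ 1 V) (hVc : HasCompactSupport V)
    (hU : Continuous U) (hUc : HasCompactSupport U) {G : ℝ → ℝ}
    (hG : ∀ x x', G x' - G x =
      ∫ s : ℝ, inner ℝ (V (s, x') - V (s, x)) (U (s, x') + U (s, x))) (x : ℝ) :
    HasDerivAt G (∫ s : ℝ, 2 * inner ℝ (pd2 V (s, x)) (U (s, x))) x := by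
  obtain ⟨M, hM⟩ := ContDiff.lipschitzWith_of_hasCompactSupport hVc hV one_ne_zero
  obtain ⟨M', hM'⟩ := hUc.exists_bound_of_continuous hU
  have hK : IsCompact (Prod.fst '' tsupport U) := hUc.isCompact.image continuous_fst
  rw [hasDerivAt_iff_tendsto_slope]
  have hs : ∀ x', slope G x x' = ∫ s : ℝ, inner ℝ ((x' - x)⁻¹ • (V (s, x') - V (s, x)))
      (U (s, x') + U (s, x)) := by
    intro x'
    rw [slope_def_field, hG, div_eq_inv_mul, ← integral_const_mul]
    simp only [real_inner_smul_left]
  simp only [funext hs]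
  have hlim : ∀ s, Tendsto (fun x' => inner ℝ ((x' - x)⁻¹ • (V (s, x') - V (s, x)))
      (U (s, x') + U (s, x))) (𝓝[≠] x) (𝓝 (2 * inner ℝ (pd2 V (s, x)) (U (s, x)))) := by
    intro s
    have h1 := (hasDerivAt_iff_tendsto_slope.mp
      (hasDerivAt_pd2 (s := s) (hV.differentiable one_ne_zero (s, x))))
    have h2 : Tendsto (fun x' => U (s, x') + U (s, x)) (𝓝[≠] x) (𝓝 (U (s, x) + U (s, x))) := by
      apply Tendsto.mono_left _ nhdsWithin_le_nhds
      exact Continuous.tendsto (by fun_prop) x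
    have := h1.inner (𝕜 := ℝ) h2
    rw [inner_add_right, ← two_mul] at this
    exact this
  refine tendsto_integral_filter_of_dominated_convergence
    (fun s => (Prod.fst '' tsupport U).indicator (fun _ => M * (2 * M')) s) ?_ ?_ ?_
    (Eventually.of_forall hlim)
  · refine Eventually.of_forall fun x' => Continuous.aestronglyMeasurable ?_
    have := hV.continuous
    fun_prop
  · filter_upwards [self_mem_nhdsWithin] with x' hx'
    refine Eventually.of_forall fun s => ?_
    by_cases hsK : s ∈ Prod.fst '' tsupport U
    · rw [indicator_of_mem hsK]
      refine (norm_inner_le_norm _ _).trans ?_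
      have h1 : ‖(x' - x)⁻¹ • (V (s, x') - V (s, x))‖ ≤ M := by
        have hne : 0 < |x' - x| := abs_pos.mpr (sub_ne_zero.mpr hx')
        rw [norm_smul, norm_inv, Real.norm_eq_abs, inv_mul_le_iff₀ hne]
        have := hM.norm_sub_le (s, x') (s, x)
        rw [Prod.mk_sub_mk, sub_self, Prod.norm_mk, norm_zero, Real.norm_eq_abs,
          max_eq_right (abs_nonneg _)] at this
        linarith
      have h2 : ‖U (s, x') + U (s, x)‖ ≤ 2 * M' :=
        (norm_add_le _ _).trans (by linarith [hM' (s, x'), hM' (s, x)])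
      gcongr
    · rw [indicator_of_notMem hsK]
      have : ∀ y, U (s, y) = 0 := fun y => by
        by_contra h
        exact hsK ⟨(s, y), subset_tsupport U h, rfl⟩
      simp [this]
  · exact (integrable_indicator_iff hK.isClosed.measurableSet).mpr
      (integrableOn_const hK.measure_lt_top.ne)

/-- `s ↦ ∫ ⟨V, V⟩`: derivative of the line mass. -/
lemma hasDerivAt_line_mass {V : Plane → ℂ} (hV : ContDiff ℝ 1 V) (hVc : HasCompactSupport V)
    (x : ℝ) : HasDerivAt (fun x => ∫ s : ℝ, inner ℝ (V (s, x)) (V (s, x)))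
      (∫ s : ℝ, 2 * inner ℝ (pd2 V (s, x)) (V (s, x))) x := by
  refine hasDerivAt_line_integral hV hVc hV.continuous hVc (fun x x' => ?_) x
  have hVcont := hV.continuous
  have hi : ∀ x, Integrable fun s => inner ℝ (V (s, x)) (V (s, x)) := fun x =>
    Continuous.integrable_of_hasCompactSupport (by fun_prop)
      (HasCompactSupport.section_fst (HasCompactSupport.inner_left hVc) x)
  rw [← integral_sub (hi x') (hi x)]
  congr 1
  ext s
  simp only [inner_sub_left, inner_add_right, real_inner_comm (V (s, x)) (V (s, x'))]
  ring

/-- The line momentum `∫ ⟨V, -i∂₁V⟩` is differentiable in the transversal variable. -/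
lemma hasDerivAt_line_momentum {V : Plane → ℂ} (hV : ContDiff ℝ 1 V) (hVc : HasCompactSupport V)
    (x : ℝ) :
    HasDerivAt (fun x => ∫ s : ℝ, inner ℝ (V (s, x)) (-Complex.I * pd1 V (s, x)))
      (∫ s : ℝ, 2 * inner ℝ (pd2 V (s, x)) (-Complex.I * pd1 V (s, x))) x := by
  have hVcont := hV.continuous
  have hpd := continuous_pd1 hV
  have hpc := hasCompactSupport_pd1 hVc
  have hUc : HasCompactSupport fun z => -Complex.I * pd1 V z := hpc.mul_left
  refine hasDerivAt_line_integral (U := fun z => -Complex.I * pd1 V z) hV hVc (by fun_prop) hUc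
    (fun x x' => ?_) x
  have hi : ∀ x x', Integrable fun s => inner ℝ (V (s, x)) (-Complex.I * pd1 V (s, x')) := by
    intro x x'
    refine Continuous.integrable_of_hasCompactSupport (by fun_prop) ?_
    refine (HasCompactSupport.section_fst hVc x).mono fun s hs hfz => hs ?_
    simp only [hfz, inner_zero_left]
  have hcross : ∫ s : ℝ, (inner ℝ (V (s, x')) (-Complex.I * pd1 V (s, x)) -
      inner ℝ (V (s, x)) (-Complex.I * pd1 V (s, x'))) = 0 := by
    have hd : ∀ s, HasDerivAt (fun s => inner ℝ (V (s, x')) (-Complex.I * V (s, x)))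
        (inner ℝ (V (s, x')) (-Complex.I * pd1 V (s, x)) -
          inner ℝ (V (s, x)) (-Complex.I * pd1 V (s, x'))) s := by
      intro s
      have h1 := hasDerivAt_pd1 (s := s) (hV.differentiable one_ne_zero (s, x))
      have h2 := hasDerivAt_pd1 (s := s) (hV.differentiable one_ne_zero (s, x'))
      refine (h2.inner ℝ (h1.const_mul (-Complex.I))).congr_deriv ?_
      simp only [Complex.inner, Complex.mul_re, Complex.mul_im, Complex.conj_re, Complex.conj_im,
        Complex.neg_re, Complex.neg_im, Complex.I_re, Complex.I_im]
      ring
    refine integral_eq_zero_of_hasDerivAt_of_integrable hd ((hi x' x).sub (hi x x')) ?_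
    refine Continuous.integrable_of_hasCompactSupport (by fun_prop) ?_
    refine (HasCompactSupport.section_fst hVc x').mono fun s hs hfz => hs ?_
    simp only [hfz, inner_zero_left]
  have hA : Integrable fun s => (inner ℝ (V (s, x')) (-Complex.I * pd1 V (s, x')) -
      inner ℝ (V (s, x)) (-Complex.I * pd1 V (s, x))) := (hi x' x').sub (hi x x)
  have hB : Integrable fun s => (inner ℝ (V (s, x')) (-Complex.I * pd1 V (s, x)) -
      inner ℝ (V (s, x)) (-Complex.I * pd1 V (s, x'))) := (hi x' x).sub (hi x x')
  rw [← integral_sub (hi x' x') (hi x x), ← add_zero (integral _ _), ← hcross,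
    ← integral_add hA hB]
  congr 1
  ext s
  simp only [inner_sub_left, inner_add_right]
  ring

/-- Integration by parts over a half-plane. -/
lemma halfPlane_integral_by_parts {Ψ₀ Ψ₁ : Plane → ℝ} (h0 : Continuous Ψ₀) (h1 : Continuous Ψ₁)
    (hc0 : HasCompactSupport Ψ₀) (hc1 : HasCompactSupport Ψ₁)
    (hd : ∀ x, HasDerivAt (fun x => ∫ s : ℝ, Ψ₀ (s, x)) (∫ s : ℝ, Ψ₁ (s, x)) x)
    {f f' : ℝ → ℝ} (hf : ∀ x, HasDerivAt f (f' x) x) (hf' : Continuous f') {α : ℝ}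
    (hα : ∀ s, f α * Ψ₀ (s, α) = 0) :
    ∫ z in univ ×ˢ Ioi α, (f z.2 * Ψ₁ z + f' z.2 * Ψ₀ z) = 0 := by
  have hfc : Continuous f := continuous_iff_continuousAt.mpr fun x => (hf x).continuousAt
  have hInt : Integrable (fun z : Plane => f z.2 * Ψ₁ z + f' z.2 * Ψ₀ z) :=
    Continuous.integrable_of_hasCompactSupport (by fun_prop) (hc1.mul_left.add hc0.mul_left)
  have hmeas : (volume : Measure Plane).restrict (univ ×ˢ Ioi α) =
      (volume : Measure ℝ).prod ((volume : Measure ℝ).restrict (Ioi α)) := by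
    rw [Measure.volume_eq_prod, ← Measure.prod_restrict, Measure.restrict_univ]
  have hInt' := hInt.integrableOn (s := univ ×ˢ Ioi α)
  rw [IntegrableOn, hmeas] at hInt'
  rw [hmeas, integral_prod_symm _ hInt']
  have hi : ∀ x, Integrable (fun s : ℝ => Ψ₀ (s, x)) := fun x =>
    Continuous.integrable_of_hasCompactSupport (by fun_prop)
      (HasCompactSupport.section_fst hc0 x)
  have hi1 : ∀ x, Integrable (fun s : ℝ => Ψ₁ (s, x)) := fun x =>
    Continuous.integrable_of_hasCompactSupport (by fun_prop)
      (HasCompactSupport.section_fst hc1 x)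
  have hsplit : ∀ x : ℝ, ∫ s : ℝ, (f x * Ψ₁ (s, x) + f' x * Ψ₀ (s, x)) =
      f x * (∫ s : ℝ, Ψ₁ (s, x)) + f' x * ∫ s : ℝ, Ψ₀ (s, x) := by
    intro x
    rw [integral_add ((hi1 x).const_mul _) ((hi x).const_mul _), integral_const_mul,
      integral_const_mul]
  have hi2 := hInt'.integral_prod_right
  simp only [hsplit] at hi2 ⊢
  have hD : ∀ x, HasDerivAt (fun x => f x * ∫ s : ℝ, Ψ₀ (s, x))
      (f x * (∫ s : ℝ, Ψ₁ (s, x)) + f' x * ∫ s : ℝ, Ψ₀ (s, x)) x := fun x =>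
    ((hf x).mul (hd x)).congr_deriv (by ring)
  obtain ⟨R, hR⟩ := (hc0.isCompact.image continuous_snd).isBounded.subset_closedBall 0
  have hlim : Tendsto (fun x => f x * ∫ s : ℝ, Ψ₀ (s, x)) atTop (𝓝 0) := by
    refine tendsto_const_nhds.congr' ?_
    filter_upwards [eventually_gt_atTop R] with x hx
    have : ∀ s, Ψ₀ (s, x) = 0 := fun s => by
      by_contra h
      have := hR ⟨(s, x), subset_tsupport _ h, rfl⟩
      rw [mem_closedBall_zero_iff, Real.norm_eq_abs] at this
      linarith [le_abs_self x]
    simp [this]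
  rw [integral_Ioi_of_hasDerivAt_of_tendsto (hD α).continuousAt.continuousWithinAt
    (fun x _ => hD x) hi2 hlim, ← integral_const_mul]
  simp [hα]

lemma quadratic_form_nonneg {A C D : ℝ} (h : ∀ σ : ℝ, 0 ≤ A * σ ^ 2 + 2 * C * σ + D) (v w : ℂ) :
    0 ≤ A * ‖w‖ ^ 2 + 2 * C * inner ℝ v w + D * ‖v‖ ^ 2 := by
  have hA : 0 ≤ A := by
    by_contra! hA
    have h1 := h ((|C| + |D| + 1) / (-A) + 1)
    have hq : 0 ≤ (|C| + |D| + 1) / (-A) := div_nonneg (by positivity) (by linarith)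
    obtain ⟨q, hqd⟩ : ∃ q, q = (|C| + |D| + 1) / (-A) := ⟨_, rfl⟩
    rw [← hqd] at h1 hq
    have hq2 : A * q = -(|C| + |D| + 1) := by
      rw [hqd, div_neg, mul_neg, mul_div_cancel₀ _ hA.ne]
    have e : A * (q + 1) ^ 2 + 2 * C * (q + 1) + D =
        (A * q) * (q + 2) + A + 2 * C * (q + 1) + D := by ring
    rw [e, hq2] at h1
    nlinarith [le_abs_self C, le_abs_self D, abs_nonneg C, abs_nonneg D,
      mul_nonneg (abs_nonneg D) hq, mul_nonneg hq (sub_nonneg.mpr (le_abs_self C)),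
      h (1 : ℝ), h (-1 : ℝ), h 0, h (2 : ℝ)]
  rcases eq_or_ne v 0 with rfl | hv
  · simp only [inner_zero_left, norm_zero]
    nlinarith [mul_nonneg hA (sq_nonneg ‖w‖)]
  · have hn : 0 < ‖v‖ ^ 2 := by positivity
    have hs : inner ℝ v w ^ 2 ≤ ‖v‖ ^ 2 * ‖w‖ ^ 2 := by
      rw [← mul_pow]; exact sq_le_sq' (neg_le_of_abs_le (abs_real_inner_le_norm v w))
        (le_of_abs_le (abs_real_inner_le_norm v w))
    obtain ⟨σ, hσ⟩ : ∃ σ, inner ℝ v w = σ * ‖v‖ ^ 2 := ⟨inner ℝ v w / ‖v‖ ^ 2, by field_simp⟩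
    rw [hσ] at hs ⊢
    have hw : σ ^ 2 * ‖v‖ ^ 2 ≤ ‖w‖ ^ 2 := by
      have : (σ ^ 2 * ‖v‖ ^ 2) * ‖v‖ ^ 2 ≤ ‖w‖ ^ 2 * ‖v‖ ^ 2 := by linarith [hs]
      exact le_of_mul_le_mul_right this hn
    have h2 := mul_le_mul_of_nonneg_left hw hA
    have h3 := mul_nonneg (h σ) hn.le
    linarith

lemma weighted_pointwise {b₁ b₂ E a n n' r r' : ℝ} (hb : 0 < b₁)
    (h : ∀ σ, E ≤ b₂ * (a + σ) ^ 2 - n' - r' * σ - (n + r * σ) ^ 2 / b₁) (v w d : ℂ) :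
    E * ‖v‖ ^ 2 + (2 * r * inner ℝ d w + 2 * n * inner ℝ d v + n' * ‖v‖ ^ 2 + r' * inner ℝ v w)
      ≤ b₁ * ‖d‖ ^ 2 + b₂ * ‖w + a * v‖ ^ 2 := by
  have h1 := quadratic_form_nonneg (A := b₂ - r ^ 2 / b₁) (C := b₂ * a - r' / 2 - n * r / b₁)
    (D := b₂ * a ^ 2 - n' - E - n ^ 2 / b₁)
    (fun σ => by
      have e : (b₂ - r ^ 2 / b₁) * σ ^ 2 + 2 * (b₂ * a - r' / 2 - n * r / b₁) * σ +
          (b₂ * a ^ 2 - n' - E - n ^ 2 / b₁) =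
          b₂ * (a + σ) ^ 2 - n' - r' * σ - (n + r * σ) ^ 2 / b₁ - E := by ring
      rw [e]; linarith [h σ]) v w
  have h2 : 0 ≤ ‖(b₁ : ℂ) * d - (n * v + r * w)‖ ^ 2 / b₁ := by positivity
  simp only [Complex.inner, Complex.sq_norm, Complex.normSq_apply, Complex.mul_re, Complex.mul_im,
    Complex.conj_re, Complex.conj_im, Complex.add_re, Complex.add_im, Complex.sub_re,
    Complex.sub_im, Complex.ofReal_re, Complex.ofReal_im] at h1 h2 ⊢
  have e2 : ∀ X Y : ℝ, ((b₁ * d.re - 0 * d.im - X) * (b₁ * d.re - 0 * d.im - X) +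
      (b₁ * d.im + 0 * d.re - Y) * (b₁ * d.im + 0 * d.re - Y)) / b₁ =
      b₁ * (d.re ^ 2 + d.im ^ 2) - 2 * (d.re * X + d.im * Y) + (X ^ 2 + Y ^ 2) / b₁ := by
    intro X Y; field_simp; ring
  rw [e2] at h2
  simp only [div_eq_mul_inv] at h1 h2
  linarith only [h1, h2]

/-- Energy lower bound on a half-plane from a pointwise inequality for symbols. -/
lemma weighted_energy {V : Plane → ℂ} (hV : ContDiff ℝ 1 V) (hVc : HasCompactSupport V)
    {α R B ξ E : ℝ} (hR : ∀ z : Plane, R < z.2 → V z = 0) {n n' r r' b₁ b₂ : ℝ → ℝ}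
    (hn : ∀ x, HasDerivAt n (n' x) x) (hr : ∀ x, HasDerivAt r (r' x) x)
    (hn' : Continuous n') (hr' : Continuous r') (hb₁ : Continuous b₁) (hb₂ : Continuous b₂)
    (hnα : ∀ s, n α = 0 ∨ V (s, α) = 0) (hrα : ∀ s, r α = 0 ∨ V (s, α) = 0)
    (hb : ∀ x, α < x → x ≤ R → 0 < b₁ x)
    (h : ∀ x, α < x → x ≤ R → ∀ σ, E ≤ b₂ x * (B * x + ξ + σ) ^ 2 - n' x - r' x * σ -
      (n x + r x * σ) ^ 2 / b₁ x) :
    E * (∫ z in univ ×ˢ Ioi α, ‖V z‖ ^ 2) ≤ ∫ z in univ ×ˢ Ioi α,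
      (b₁ z.2 * ‖pd2 V z‖ ^ 2 +
        b₂ z.2 * ‖-Complex.I * pd1 V z + ((B * z.2 : ℝ) : ℂ) * V z‖ ^ 2) := by
  have hVcont := hV.continuous
  have hpd1 := continuous_pd1 hV
  have hpd2 := continuous_pd2 hV
  have hpc1 := hasCompactSupport_pd1 hVc
  have hpc2 := hasCompactSupport_pd2 hVc
  have hnc : Continuous n := continuous_iff_continuousAt.mpr fun x => (hn x).continuousAt
  have hrc : Continuous r := continuous_iff_continuousAt.mpr fun x => (hr x).continuousAt
  have I1 := halfPlane_integral_by_parts (Ψ₀ := fun z => inner ℝ (V z) (V z))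
    (Ψ₁ := fun z => 2 * inner ℝ (pd2 V z) (V z)) (by fun_prop) (by fun_prop)
    (HasCompactSupport.inner_left hVc) (HasCompactSupport.inner_left hpc2).mul_left
    (hasDerivAt_line_mass hV hVc) (f := fun x => n x - ξ * r x) (f' := fun x => n' x - ξ * r' x)
    (fun x => (hn x).sub ((hr x).const_mul ξ)) (by fun_prop) (α := α)
    (fun s => by
      rcases hnα s with h1 | h1
      · rcases hrα s with h2 | h2 <;> simp [h1, h2]
      · simp [h1])
  have I2 := halfPlane_integral_by_parts (Ψ₀ := fun z => inner ℝ (V z) (-Complex.I * pd1 V z))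
    (Ψ₁ := fun z => 2 * inner ℝ (pd2 V z) (-Complex.I * pd1 V z)) (by fun_prop) (by fun_prop)
    (HasCompactSupport.inner_left hVc) (HasCompactSupport.inner_left hpc2).mul_left
    (hasDerivAt_line_momentum hV hVc) hr hr' (α := α)
    (fun s => by rcases hrα s with h1 | h1 <;> simp [h1])
  have int1 : Integrable (fun z : Plane => (n z.2 - ξ * r z.2) * (2 * inner ℝ (pd2 V z) (V z)) +
      (n' z.2 - ξ * r' z.2) * inner ℝ (V z) (V z)) :=
    Continuous.integrable_of_hasCompactSupport (by fun_prop)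
      ((HasCompactSupport.inner_left hpc2).mul_left.mul_left.add
        (HasCompactSupport.inner_left hVc).mul_left)
  have int2 : Integrable (fun z : Plane => r z.2 * (2 * inner ℝ (pd2 V z) (-Complex.I * pd1 V z)) +
      r' z.2 * inner ℝ (V z) (-Complex.I * pd1 V z)) :=
    Continuous.integrable_of_hasCompactSupport (by fun_prop)
      ((HasCompactSupport.inner_left hpc2).mul_left.mul_left.add
        (HasCompactSupport.inner_left hVc).mul_left)
  have intV : Integrable (fun z : Plane => ‖V z‖ ^ 2) :=
    Continuous.integrable_of_hasCompactSupport (by fun_prop)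
      (hVc.mono fun z hz hfz => hz (by simp [hfz]))
  have intQ : Integrable (fun z : Plane => b₁ z.2 * ‖pd2 V z‖ ^ 2 +
      b₂ z.2 * ‖-Complex.I * pd1 V z + ((B * z.2 : ℝ) : ℂ) * V z‖ ^ 2) := by
    refine Continuous.integrable_of_hasCompactSupport (by fun_prop) ?_
    refine HasCompactSupport.add (hpc2.mono fun z hz hfz => hz (by simp [hfz])) ?_
    refine (hpc1.mul_left (f := fun _ => -Complex.I)).add
      (hVc.mul_left (f := fun z => ((B * z.2 : ℝ) : ℂ))) |>.mono fun z hz hfz => hz ?_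
    simp only [Pi.add_apply] at hfz
    simp only [Pi.mul_apply] at hfz
    change _ * ‖_‖ ^ 2 = 0
    rw [hfz, norm_zero]; ring
  rw [← integral_const_mul]
  calc _ = ∫ z in univ ×ˢ Ioi α, (E * ‖V z‖ ^ 2 +
        (((n z.2 - ξ * r z.2) * (2 * inner ℝ (pd2 V z) (V z)) +
          (n' z.2 - ξ * r' z.2) * inner ℝ (V z) (V z)) +
        (r z.2 * (2 * inner ℝ (pd2 V z) (-Complex.I * pd1 V z)) +
          r' z.2 * inner ℝ (V z) (-Complex.I * pd1 V z)))) := by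
        rw [integral_add, integral_add, I1, I2, add_zero, add_zero]
        exacts [int1.integrableOn, int2.integrableOn, (intV.const_mul E).integrableOn,
          (int1.add int2).integrableOn]
    _ ≤ _ := by
      refine setIntegral_mono_on ((intV.const_mul E).add (int1.add int2)).integrableOn
        intQ.integrableOn (MeasurableSet.univ.prod measurableSet_Ioi) fun z hz => ?_
      by_cases hzR : z.2 ≤ R
      · have := weighted_pointwise (hb z.2 hz.2 hzR) (h z.2 hz.2 hzR) (V z)
          (-Complex.I * pd1 V z - ξ * V z) (pd2 V z)
        have e : -Complex.I * pd1 V z - ξ * V z + ((B * z.2 + ξ : ℝ) : ℂ) * V z =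
          -Complex.I * pd1 V z + ((B * z.2 : ℝ) : ℂ) * V z := by push_cast; ring
        rw [e] at this
        refine le_trans (le_of_eq ?_) this
        have e2 : ((ξ : ℂ) * V z) = ξ • V z := by rw [Complex.real_smul]
        rw [e2, inner_sub_right, inner_sub_right, real_inner_smul_right, real_inner_smul_right,
          real_inner_self_eq_norm_sq]
        ring
      · have hz0 : V =ᶠ[𝓝 z] fun _ => 0 := by
          filter_upwards [(isOpen_Ioi.preimage continuous_snd).mem_nhds
            (show z ∈ Prod.snd ⁻¹' Ioi R from not_le.mp hzR)] with y hy using hR y hy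
        have h1 : V z = 0 := hz0.eq_of_nhds
        have h2 : pd1 V z = 0 := by rw [pd1, hz0.fderiv_eq]; simp
        have h3 : pd2 V z = 0 := by rw [pd2, hz0.fderiv_eq]; simp
        simp [h1, h2, h3]

/-- Lower bound for the half-plane model with curvature weights. -/
lemma HalfLine.halfPlane_lower (D : HalfLine) (k : ℝ) {η : ℝ} (hη : 0 < η) :
    ∃ ε > 0, ∃ r > 0, ∃ b0 > 0, ∀ b > b0, ∀ V : Plane → ℂ, ContDiff ℝ 1 V → HasCompactSupport V →
      (∀ z : Plane, r < z.2 → V z = 0) →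
      (D.c ^ 2 * b ^ 2 - k * D.C1 * b - η * b) * (∫ z in univ ×ˢ Ioi 0, ‖V z‖ ^ 2) ≤
        ∫ z in univ ×ˢ Ioi 0, ((1 - 2 * (k + ε) * z.2) * ‖pd2 V z‖ ^ 2 +
          (1 + 2 * (k - ε) * z.2) *
            ‖-Complex.I * pd1 V z + ((b ^ 2 * z.2 : ℝ) : ℂ) * V z‖ ^ 2) := by
  obtain ⟨ε, hε, δ, hδ, r, hr, h0, hh0, H⟩ := D.symbol_lower k hη
  refine ⟨ε, hε, r, hr, 1 / h0, by positivity, fun b hb V hV hVc hVr => ?_⟩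
  have hb0 : 0 < b := lt_trans (by positivity) hb
  have hbh : 1 / b < h0 := (one_div_lt hh0 hb0).mp hb
  have cont : ∀ {f g : ℝ → ℝ}, (∀ x, HasDerivAt f (g x) x) → Continuous f := fun hf =>
    continuous_iff_continuousAt.mpr fun x => (hf x).continuousAt
  have cm := cont D.hasDerivAt_m
  have cm1 := cont D.hasDerivAt_m1
  have cn := cont D.hasDerivAt_n
  have cm2 : Continuous D.m2 := by
    rw [show D.m2 = fun x => 2 * (x - D.c) - 2 * D.m x * D.m1 x from funext D.m2_eq]; fun_prop
  have cn1 : Continuous D.n1 := by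
    rw [show D.n1 = fun x => 2 * x * (D.m1 x + D.c ^ 2) + D.C1 - 2 * D.m x * D.n x from
      funext D.n1_eq]; fun_prop
  have hlin : ∀ x, HasDerivAt (fun x => b * x) b x := fun x => by
    simpa using (hasDerivAt_id x).const_mul b
  have hθ : ∀ x, HasDerivAt (fun x => 1 - δ * x) (-δ) x := fun x => by
    simpa using ((hasDerivAt_id x).const_mul δ).const_sub 1
  refine weighted_energy hV hVc (α := 0) (R := r) (B := b ^ 2) (ξ := -(D.c * b)) hVr
    (n := fun x => b * ((1 - δ * x) * D.m (b * x)) + k * D.n (b * x))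
    (n' := fun x => b * (-δ * D.m (b * x) + (1 - δ * x) * (D.m1 (b * x) * b)) +
      k * (D.n1 (b * x) * b))
    (r := fun x => (1 - δ * x) * D.m1 (b * x))
    (r' := fun x => -δ * D.m1 (b * x) + (1 - δ * x) * (D.m2 (b * x) * b))
    (b₁ := fun x => 1 - 2 * (k + ε) * x) (b₂ := fun x => 1 + 2 * (k - ε) * x)
    (fun x => (((hθ x).mul ((D.hasDerivAt_m (b * x)).comp x (hlin x))).const_mul b).add
      (((D.hasDerivAt_n (b * x)).comp x (hlin x)).const_mul k))
    (fun x => (hθ x).mul ((D.hasDerivAt_m1 (b * x)).comp x (hlin x)))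
    (by fun_prop) (by fun_prop) (by fun_prop) (by fun_prop)
    (fun s => Or.inl (by simp [D.m_zero, D.n_zero]))
    (fun s => Or.inl (by simp [D.m1_eq, D.m_zero])) ?_ ?_
  · intro x hx hxr
    have := (H (1 / b) (b * x) 0 (by positivity) hbh (by positivity) (by field_simp; exact hxr)).1
    rwa [show 1 / b * (b * x) = x by field_simp] at this
  · intro x hx hxr σ
    obtain ⟨h1, h2⟩ := H (1 / b) (b * x) (σ / b) (by positivity) hbh (by positivity)
      (by field_simp; exact hxr)
    rw [show 1 / b * (b * x) = x by field_simp] at h1 h2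
    have h3 := mul_le_mul_of_nonneg_left h2 (sq_nonneg b)
    have e1 : b ^ 2 * (D.c ^ 2 - 1 / b * k * D.C1 - η * (1 / b)) =
      D.c ^ 2 * b ^ 2 - k * D.C1 * b - η * b := by field_simp
    rw [e1] at h3
    refine h3.trans (le_of_eq ?_)
    have h1' := h1.ne'
    field_simp
    ring

lemma pd1_gauge {v : Plane → ℂ} {φ : Plane → ℝ} {z : Plane} (B : ℝ)
    (hv : DifferentiableAt ℝ v z) (hφ : DifferentiableAt ℝ φ z) (w : Plane) :
    fderiv ℝ (fun z => Complex.exp (Complex.I * (B * φ z : ℝ)) * v z) z w =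
      Complex.exp (Complex.I * (B * φ z : ℝ)) *
        (fderiv ℝ v z w + Complex.I * (B * fderiv ℝ φ z w : ℝ) * v z) := by
  have h1 : HasFDerivAt (fun z => Complex.I * ((B * φ z : ℝ) : ℂ))
      (Complex.I • (Complex.ofRealCLM.comp (B • fderiv ℝ φ z))) z :=
    (Complex.ofRealCLM.hasFDerivAt.comp z (hφ.hasFDerivAt.const_mul B)).const_mul Complex.I
  have h2 := h1.cexp.fun_mul hv.hasFDerivAt
  rw [h2.fderiv]
  simp
  ring

lemma norm_exp_I_mul_ofReal' (t : ℝ) : ‖Complex.exp (Complex.I * (t : ℝ))‖ = 1 := by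
  rw [mul_comm, Complex.norm_exp_ofReal_mul_I]

lemma contDiff_gauge {v : Plane → ℂ} {φ : Plane → ℝ} (B : ℝ) {n : WithTop ℕ∞}
    (hv : ContDiff ℝ n v) (hφ : ContDiff ℝ n φ) :
    ContDiff ℝ n fun z => Complex.exp (Complex.I * (B * φ z : ℝ)) * v z :=
  (contDiff_const.mul (Complex.ofRealCLM.contDiff.comp (contDiff_const.mul hφ))).cexp.mul hv

/-- The magnetic energy density transforms by a gauge change of the potential. -/
lemma magSq_gauge {v : Plane → ℂ} {φ : Plane → ℝ} {z : Plane} (B : ℝ) (A : Plane → Plane)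
    (hv : DifferentiableAt ℝ v z) (hφ : DifferentiableAt ℝ φ z) :
    magSq B A v z = magSq B
      (fun y => A y + (fderiv ℝ φ y (1, 0), fderiv ℝ φ y (0, 1)))
      (fun z => Complex.exp (Complex.I * (B * φ z : ℝ)) * v z) z := by
  have key : ∀ (w : Plane) (a : ℝ),
      -Complex.I * fderiv ℝ (fun z => Complex.exp (Complex.I * (B * φ z : ℝ)) * v z) z w -
        ((B * (a + fderiv ℝ φ z w) : ℝ) : ℂ) * (Complex.exp (Complex.I * (B * φ z : ℝ)) * v z) =
      Complex.exp (Complex.I * (B * φ z : ℝ)) *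
        (-Complex.I * fderiv ℝ v z w - ((B * a : ℝ) : ℂ) * v z) := by
    intro w a
    rw [pd1_gauge B hv hφ]
    push_cast
    linear_combination (-Complex.exp (Complex.I * (B * φ z)) * (B * fderiv ℝ φ z w) * v z) *
      Complex.I_mul_I
  simp only [magSq, Prod.fst_add, Prod.snd_add, key, norm_mul, norm_exp_I_mul_ofReal', one_mul]

/-- The magnetic Dirichlet lower bound in the whole plane. -/
lemma plane_lower {v : Plane → ℂ} (hv : ContDiff ℝ 1 v) (hvc : HasCompactSupport v) (B : ℝ) :
    B * (∫ z, ‖v z‖ ^ 2) ≤ ∫ z, magSq B F0 v z := by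
  let φ : Plane → ℝ := fun z => -(z.1 * z.2 / 2)
  have hφ : ContDiff ℝ 1 φ := by fun_prop
  let V : Plane → ℂ := fun z => Complex.exp (Complex.I * (B * φ z : ℝ)) * v z
  have hV : ContDiff ℝ 1 V := contDiff_gauge B hv hφ
  have hVc : HasCompactSupport V := hvc.mul_left
  obtain ⟨R, hR⟩ := (hVc.isCompact.image continuous_snd).isBounded.subset_closedBall 0
  have hVR : ∀ z : Plane, R < |z.2| → V z = 0 := fun z hz => by
    by_contra h
    have := hR ⟨z, subset_tsupport _ h, rfl⟩
    rw [mem_closedBall_zero_iff, Real.norm_eq_abs] at this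
    linarith
  have hnorm : ∀ z, ‖V z‖ = ‖v z‖ := fun z => by
    simp only [V, norm_mul, norm_exp_I_mul_ofReal', one_mul]
  have hmag : ∀ z, magSq B F0 v z =
      ‖pd2 V z‖ ^ 2 + ‖-Complex.I * pd1 V z + ((B * z.2 : ℝ) : ℂ) * V z‖ ^ 2 := by
    intro z
    rw [magSq_gauge B F0 (hv.differentiable one_ne_zero z) (hφ.differentiable one_ne_zero z)]
    have hd : HasFDerivAt φ (-((1 / 2 : ℝ) • (z.1 • ContinuousLinearMap.snd ℝ ℝ ℝ +
        z.2 • ContinuousLinearMap.fst ℝ ℝ ℝ))) z := by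
      have := ((hasFDerivAt_fst (𝕜 := ℝ) (p := z)).mul (hasFDerivAt_snd (𝕜 := ℝ)
        (p := z))).const_mul
        (1 / 2 : ℝ) |>.neg
      refine this.congr_of_eventuallyEq (Eventually.of_forall fun y => ?_)
      simp only [φ, Pi.neg_apply, Pi.mul_apply]; ring
    simp only [magSq, hd.fderiv, F0]
    rw [add_comm]
    congr 2
    · simp [V, pd2]
      ring_nf
      simp
    · simp only [V, pd1]
      congr 1
      simp
      ring
  set α : ℝ := -(|R| + 1) with hα
  have hvol : ∀ f : Plane → ℝ, (∀ z : Plane, z.2 ≤ α → f z = 0) →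
      ∫ z in univ ×ˢ Ioi α, f z = ∫ z, f z := fun f hf => by
    refine setIntegral_eq_integral_of_forall_compl_eq_zero fun z hz => hf z ?_
    by_contra h
    exact hz ⟨trivial, not_le.mp h⟩
  have hzero : ∀ z : Plane, z.2 ≤ α → V =ᶠ[𝓝 z] fun _ => 0 := fun z hz => by
    filter_upwards [(isOpen_Iio.preimage continuous_snd).mem_nhds
      (show z ∈ Prod.snd ⁻¹' Iio (-|R|) by change z.2 < _; linarith)] with y hy
    refine hVR y ?_
    have h1 : y.2 < -|R| := hy
    linarith [le_abs_self R, neg_le_abs y.2]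
  have := weighted_energy hV hVc (α := α) (R := R) (B := B) (ξ := 0) (E := B)
    (n := fun x => -(B * x)) (n' := fun _ => -B) (r := fun _ => -1) (r' := fun _ => 0)
    (b₁ := fun _ => 1) (b₂ := fun _ => 1)
    (fun z hz => hVR z (hz.trans_le (le_abs_self _)))
    (fun x => by simpa using ((hasDerivAt_id x).const_mul B).fun_neg)
    (fun x => hasDerivAt_const x _)
    continuous_const continuous_const continuous_const continuous_const
    (fun s => Or.inr (hzero (s, α) le_rfl).eq_of_nhds)
    (fun s => Or.inr (hzero (s, α) le_rfl).eq_of_nhds)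
    (fun _ _ _ => one_pos) (fun x _ _ σ => le_of_eq (by ring))
  simp only [one_mul] at this
  rw [hvol _ fun z hz => by simp [(hzero z hz).eq_of_nhds], hvol _ fun z hz => by
    have h1 := (hzero z hz).eq_of_nhds
    have h2 : pd1 V z = 0 := by rw [pd1, (hzero z hz).fderiv_eq]; simp
    have h3 : pd2 V z = 0 := by rw [pd2, (hzero z hz).fderiv_eq]; simp
    simp [h1, h2, h3]] at this
  simpa only [hmag, hnorm] using this

section

lemma hasDerivAt_comp_fst {f : ℝ → Plane} {f' : Plane} {s : ℝ} (h : HasDerivAt f f' s) :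
    HasDerivAt (fun s => (f s).1) f'.1 s :=
  (ContinuousLinearMap.fst ℝ ℝ ℝ).hasFDerivAt.comp_hasDerivAt s h

lemma hasDerivAt_comp_snd {f : ℝ → Plane} {f' : Plane} {s : ℝ} (h : HasDerivAt f f' s) :
    HasDerivAt (fun s => (f s).2) f'.2 s :=
  (ContinuousLinearMap.snd ℝ ℝ ℝ).hasFDerivAt.comp_hasDerivAt s h

namespace BoundaryParam
variable {Ω : Set Plane} (P : BoundaryParam Ω)

lemma contDiff_deriv : ContDiff ℝ (⊤ : ℕ∞) (deriv P.γ) := (contDiff_infty_iff_deriv.mp P.smooth).2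

lemma hasDerivAt_γ (s : ℝ) : HasDerivAt P.γ (deriv P.γ s) s :=
  ((contDiff_infty_iff_deriv.mp P.smooth).1 s).hasDerivAt

lemma contDiff_nu : ContDiff ℝ (⊤ : ℕ∞) (nuVec P.γ) :=
  (contDiff_snd.comp P.contDiff_deriv).neg.prodMk (contDiff_fst.comp P.contDiff_deriv)

lemma contDiff_curv : ContDiff ℝ (⊤ : ℕ∞) (curvOf P.γ) := by
  have h1 := (contDiff_infty_iff_deriv.mp P.contDiff_deriv).2
  have h2 := P.contDiff_nu
  unfold curvOf dot2
  exact ((contDiff_fst.comp h1).mul (contDiff_fst.comp h2)).add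
    ((contDiff_snd.comp h1).mul (contDiff_snd.comp h2))

lemma tangent_sq (s : ℝ) : (deriv P.γ s).1 ^ 2 + (deriv P.γ s).2 ^ 2 = 1 := P.unit_speed s

lemma deriv_deriv_eq (s : ℝ) : deriv (deriv P.γ) s = curvOf P.γ s • nuVec P.γ s := by
  have h1 : HasDerivAt (deriv P.γ) (deriv (deriv P.γ) s) s :=
    ((contDiff_infty_iff_deriv.mp P.contDiff_deriv).1 s).hasDerivAt
  have h2 : HasDerivAt (fun s => (deriv P.γ s).1 ^ 2 + (deriv P.γ s).2 ^ 2)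
      (2 * (deriv P.γ s).1 * (deriv (deriv P.γ) s).1 +
        2 * (deriv P.γ s).2 * (deriv (deriv P.γ) s).2) s := by
    simpa using ((hasDerivAt_comp_fst h1).fun_pow 2).fun_add ((hasDerivAt_comp_snd h1).fun_pow 2)
  have h3 := h2.unique ((hasDerivAt_const s (1 : ℝ)).congr_of_eventuallyEq
    (Eventually.of_forall P.tangent_sq))
  have h4 := P.tangent_sq s
  ext
  · simp only [curvOf, dot2, nuVec, Prod.smul_fst, smul_eq_mul]
    linear_combination (-(deriv (deriv P.γ) s).1) * h4 + (deriv P.γ s).1 / 2 * h3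
  · simp only [curvOf, dot2, nuVec, Prod.smul_snd, smul_eq_mul]
    linear_combination (-(deriv (deriv P.γ) s).2) * h4 + (deriv P.γ s).2 / 2 * h3

lemma hasDerivAt_tangent (s : ℝ) :
    HasDerivAt (deriv P.γ) (curvOf P.γ s • nuVec P.γ s) s := by
  rw [← P.deriv_deriv_eq]
  exact ((contDiff_infty_iff_deriv.mp P.contDiff_deriv).1 s).hasDerivAt

lemma hasDerivAt_nu (s : ℝ) :
    HasDerivAt (nuVec P.γ) (-(curvOf P.γ s) • deriv P.γ s) s := by
  have h := P.hasDerivAt_tangent s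
  refine ((hasDerivAt_comp_snd h).fun_neg.prodMk (hasDerivAt_comp_fst h)).congr_deriv ?_
  ext <;> simp [nuVec]

lemma periodic_curv : Function.Periodic (curvOf P.γ) P.L := by
  have h1 : Function.Periodic (deriv P.γ) P.L := fun s => by
    rw [← deriv_comp_add_const, show (fun x => P.γ (x + P.L)) = P.γ from funext P.periodic]
  have h2 : Function.Periodic (deriv (deriv P.γ)) P.L := fun s => by
    rw [← deriv_comp_add_const, show (fun x => deriv P.γ (x + P.L)) = deriv P.γ from funext h1]
  intro s
  simp only [curvOf, nuVec, h1 s, h2 s]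

lemma exists_curv_bound : ∃ K > 0, ∀ s, |curvOf P.γ s| ≤ K := by
  obtain ⟨K, hK⟩ := (P.periodic_curv.isBounded_of_continuous P.L_pos.ne'
    P.contDiff_curv.continuous).subset_closedBall 0
  refine ⟨|K| + 1, by positivity, fun s => ?_⟩
  have := hK (mem_range_self s)
  rw [mem_closedBall_zero_iff, Real.norm_eq_abs] at this
  linarith [le_abs_self K]

/-- The Jacobian factor of the boundary normal coordinates. -/
def q (z : Plane) : ℝ := √(1 - 2 * curvOf P.γ z.1 * z.2)

/-- Distance to the boundary in area preserving boundary coordinates. -/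
def tau (z : Plane) : ℝ := 2 * z.2 / (1 + P.q z)

/-- Area preserving boundary coordinates. -/
def chart (z : Plane) : Plane := P.γ z.1 + P.tau z • nuVec P.γ z.1

/-- The domain on which the boundary coordinates are smooth. -/
def chartDom : Set Plane := {z | 0 < 1 - 2 * curvOf P.γ z.1 * z.2}

/-- The derivative of `tau` along the boundary. -/
def tauS (z : Plane) : ℝ := 2 * deriv (curvOf P.γ) z.1 * z.2 ^ 2 / (P.q z * (1 + P.q z) ^ 2)

lemma continuous_chartDom_fun : Continuous fun z : Plane => 1 - 2 * curvOf P.γ z.1 * z.2 := by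
  have := P.contDiff_curv.continuous
  fun_prop

lemma isOpen_chartDom : IsOpen P.chartDom := isOpen_lt continuous_const P.continuous_chartDom_fun

variable {P} in
lemma q_pos {z : Plane} (hz : z ∈ P.chartDom) : 0 < P.q z := Real.sqrt_pos.mpr hz

variable {P} in
lemma q_sq {z : Plane} (hz : z ∈ P.chartDom) : P.q z ^ 2 = 1 - 2 * curvOf P.γ z.1 * z.2 :=
  Real.sq_sqrt (le_of_lt hz)

lemma contDiffOn_q : ContDiffOn ℝ (⊤ : ℕ∞) P.q P.chartDom := by
  have h : ContDiff ℝ (⊤ : ℕ∞) fun z : Plane => 1 - 2 * curvOf P.γ z.1 * z.2 := by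
    have := P.contDiff_curv
    fun_prop
  exact h.contDiffOn.sqrt fun z hz => ne_of_gt hz

lemma contDiffOn_tau : ContDiffOn ℝ (⊤ : ℕ∞) P.tau P.chartDom := by
  refine ContDiffOn.div (by fun_prop) (contDiffOn_const.add P.contDiffOn_q) fun z hz => ?_
  have := q_pos hz
  positivity

lemma contDiffOn_chart : ContDiffOn ℝ (⊤ : ℕ∞) P.chart P.chartDom :=
  ((P.smooth.comp contDiff_fst).contDiffOn).add
    (P.contDiffOn_tau.smul (P.contDiff_nu.comp contDiff_fst).contDiffOn)

variable {P} in
lemma hasDerivAt_q_s {s x : ℝ} (hz : (s, x) ∈ P.chartDom) :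
    HasDerivAt (fun s => P.q (s, x)) (-(deriv (curvOf P.γ) s * x) / P.q (s, x)) s := by
  have hk : HasDerivAt (curvOf P.γ) (deriv (curvOf P.γ) s) s :=
    ((contDiff_infty_iff_deriv.mp P.contDiff_curv).1 s).hasDerivAt
  have := (((hk.const_mul 2).mul_const x).const_sub 1).sqrt (ne_of_gt hz)
  refine this.congr_deriv ?_
  have hq := (q_pos hz).ne'
  simp only [q] at hq ⊢
  field_simp

variable {P} in
lemma hasDerivAt_q_x {s x : ℝ} (hz : (s, x) ∈ P.chartDom) :
    HasDerivAt (fun x => P.q (s, x)) (-curvOf P.γ s / P.q (s, x)) x := by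
  have := (((hasDerivAt_id x).const_mul (2 * curvOf P.γ s)).const_sub 1).sqrt (ne_of_gt hz)
  refine this.congr_deriv ?_
  have hq := (q_pos hz).ne'
  simp only [q, id] at hq ⊢
  field_simp

variable {P} in
lemma hasDerivAt_tau_s {s x : ℝ} (hz : (s, x) ∈ P.chartDom) :
    HasDerivAt (fun s => P.tau (s, x)) (P.tauS (s, x)) s := by
  have hq := q_pos hz
  have h1 : (1 + P.q (s, x)) ≠ 0 := by positivity
  refine ((hasDerivAt_const s (2 * x)).div ((hasDerivAt_q_s hz).const_add 1) h1).congr_deriv ?_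
  have hq' := hq.ne'
  simp only [tauS]
  field_simp
  ring

variable {P} in
lemma hasDerivAt_tau_x {s x : ℝ} (hz : (s, x) ∈ P.chartDom) :
    HasDerivAt (fun x => P.tau (s, x)) (P.q (s, x))⁻¹ x := by
  have hq := q_pos hz
  have h1 : (1 + P.q (s, x)) ≠ 0 := by positivity
  refine (((hasDerivAt_id x).const_mul 2).div ((hasDerivAt_q_x hz).const_add 1) h1).congr_deriv ?_
  have hq' := hq.ne'
  have h2 := q_sq hz
  simp only [id] at h2 ⊢
  field_simp
  linear_combination h2

variable {P} in
lemma tau_curv {z : Plane} (hz : z ∈ P.chartDom) : 1 - curvOf P.γ z.1 * P.tau z = P.q z := by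
  have hq := q_pos hz
  have h2 := q_sq hz
  simp only [tau]
  field_simp
  linear_combination -h2

variable {P} in
lemma tau_sub {z : Plane} (hz : z ∈ P.chartDom) :
    P.tau z * (1 + P.q z) = 2 * z.2 := by
  have hq := q_pos hz
  simp only [tau]
  field_simp

variable {P} in
lemma differentiableAt_chart {z : Plane} (hz : z ∈ P.chartDom) : DifferentiableAt ℝ P.chart z :=
  ((P.contDiffOn_chart.contDiffAt (P.isOpen_chartDom.mem_nhds hz)).differentiableAt (by simp))

variable {P} in
lemma hasDerivAt_chart_s {s x : ℝ} (hz : (s, x) ∈ P.chartDom) :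
    HasDerivAt (fun s => P.chart (s, x))
      (P.q (s, x) • deriv P.γ s + P.tauS (s, x) • nuVec P.γ s) s := by
  refine ((P.hasDerivAt_γ s).fun_add ((hasDerivAt_tau_s hz).fun_smul
    (P.hasDerivAt_nu s))).congr_deriv ?_
  rw [← tau_curv hz]
  module

variable {P} in
lemma hasDerivAt_chart_x {s x : ℝ} (hz : (s, x) ∈ P.chartDom) :
    HasDerivAt (fun x => P.chart (s, x)) ((P.q (s, x))⁻¹ • nuVec P.γ s) x := by
  refine ((hasDerivAt_const x (P.γ s)).fun_add ((hasDerivAt_tau_x hz).smul_const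
    (nuVec P.γ s))).congr_deriv ?_
  simp

lemma fderiv_fst_dir {E : Type*} [NormedAddCommGroup E] [NormedSpace ℝ E]
    {f : Plane → E} {z : Plane} {a : E}
    (hf : DifferentiableAt ℝ f z) (h : HasDerivAt (fun s => f (s, z.2)) a z.1) :
    fderiv ℝ f z (1, 0) = a :=
  (hf.hasFDerivAt.comp_hasDerivAt (f := fun s : ℝ => (s, z.2)) z.1
    ((hasDerivAt_id z.1).prodMk (hasDerivAt_const z.1 z.2))).unique h

lemma fderiv_snd_dir {E : Type*} [NormedAddCommGroup E] [NormedSpace ℝ E]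
    {f : Plane → E} {z : Plane} {a : E}
    (hf : DifferentiableAt ℝ f z) (h : HasDerivAt (fun x => f (z.1, x)) a z.2) :
    fderiv ℝ f z (0, 1) = a :=
  (hf.hasFDerivAt.comp_hasDerivAt (f := fun x : ℝ => (z.1, x)) z.2
    ((hasDerivAt_const z.2 z.1).prodMk (hasDerivAt_id z.2))).unique h

variable {P} in
lemma fderiv_chart_s {z : Plane} (hz : z ∈ P.chartDom) : fderiv ℝ P.chart z (1, 0) =
    P.q z • deriv P.γ z.1 + P.tauS z • nuVec P.γ z.1 :=
  fderiv_fst_dir (differentiableAt_chart hz) (hasDerivAt_chart_s hz)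

variable {P} in
lemma fderiv_chart_x {z : Plane} (hz : z ∈ P.chartDom) : fderiv ℝ P.chart z (0, 1) =
    (P.q z)⁻¹ • nuVec P.γ z.1 :=
  fderiv_snd_dir (differentiableAt_chart hz) (hasDerivAt_chart_x hz)

lemma det_plane (A : Plane →L[ℝ] Plane) :
    A.det = (A (1, 0)).1 * (A (0, 1)).2 - (A (0, 1)).1 * (A (1, 0)).2 := by
  rw [ContinuousLinearMap.det, ← LinearMap.det_toMatrix (Module.Basis.finTwoProd ℝ),
    Matrix.det_fin_two]
  simp [LinearMap.toMatrix_apply]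

variable {P} in
lemma det_fderiv_chart {z : Plane} (hz : z ∈ P.chartDom) : (fderiv ℝ P.chart z).det = 1 := by
  rw [det_plane, fderiv_chart_s hz, fderiv_chart_x hz]
  have hq := (q_pos hz).ne'
  simp [nuVec]
  have h := P.tangent_sq z.1
  field_simp
  linear_combination P.q z * h

/-- The tangential component of `F₀` along the boundary. -/
def tangF (s : ℝ) : ℝ := dot2 (F0 (P.γ s)) (deriv P.γ s)

/-- The primitive of `tangF` along the boundary. -/
def primF (s : ℝ) : ℝ := ∫ t in (0 : ℝ)..s, P.tangF t

/-- The gauge function in boundary coordinates. -/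
def gauge (z : Plane) : ℝ := P.primF z.1 + P.tau z * dot2 (F0 (P.γ z.1)) (nuVec P.γ z.1)

lemma contDiff_tangF : ContDiff ℝ (⊤ : ℕ∞) P.tangF := by
  have h1 := P.smooth
  have h2 := P.contDiff_deriv
  unfold tangF dot2 F0
  fun_prop

lemma hasDerivAt_primF (s : ℝ) : HasDerivAt P.primF (P.tangF s) s :=
  intervalIntegral.integral_hasDerivAt_right (P.contDiff_tangF.continuous.intervalIntegrable _ _)
    (P.contDiff_tangF.continuous.stronglyMeasurableAtFilter _ _)
    P.contDiff_tangF.continuous.continuousAt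

lemma contDiff_primF : ContDiff ℝ (⊤ : ℕ∞) P.primF :=
  contDiff_infty_iff_deriv.mpr ⟨fun s => (P.hasDerivAt_primF s).differentiableAt, by
    rw [show deriv P.primF = P.tangF from funext fun s => (P.hasDerivAt_primF s).deriv]
    exact P.contDiff_tangF⟩

lemma contDiffOn_gauge : ContDiffOn ℝ (⊤ : ℕ∞) P.gauge P.chartDom := by
  have h1 := P.smooth
  have h2 := P.contDiff_nu
  have h3 : ContDiff ℝ (⊤ : ℕ∞) fun z : Plane => dot2 (F0 (P.γ z.1)) (nuVec P.γ z.1) := by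
    unfold dot2 F0; fun_prop
  exact (P.contDiff_primF.comp contDiff_fst).contDiffOn.add (P.contDiffOn_tau.mul h3.contDiffOn)

variable {P} in
lemma differentiableAt_gauge {z : Plane} (hz : z ∈ P.chartDom) : DifferentiableAt ℝ P.gauge z :=
  ((P.contDiffOn_gauge.contDiffAt (P.isOpen_chartDom.mem_nhds hz)).differentiableAt (by simp))

variable {P} in
lemma fderiv_gauge_x {z : Plane} (hz : z ∈ P.chartDom) :
    fderiv ℝ P.gauge z (0, 1) = dot2 (F0 (P.chart z)) ((P.q z)⁻¹ • nuVec P.γ z.1) := by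
  have h := (hasDerivAt_tau_x hz).mul_const (dot2 (F0 (P.γ z.1)) (nuVec P.γ z.1))
  rw [fderiv_snd_dir (differentiableAt_gauge hz) (h.const_add (P.primF z.1))]
  simp only [dot2, F0, chart, nuVec, Prod.fst_add, Prod.snd_add, Prod.smul_fst, Prod.smul_snd,
    smul_eq_mul]
  ring

variable {P} in
lemma fderiv_gauge_s {z : Plane} (hz : z ∈ P.chartDom) :
    fderiv ℝ P.gauge z (1, 0) = dot2 (F0 (P.chart z))
      (P.q z • deriv P.γ z.1 + P.tauS z • nuVec P.γ z.1) + z.2 := by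
  have hγ := P.hasDerivAt_γ z.1
  have hν := P.hasDerivAt_nu z.1
  have hg := (((hasDerivAt_comp_snd hγ).fun_neg.div_const 2).fun_mul
    (hasDerivAt_comp_fst hν)).fun_add
    (((hasDerivAt_comp_fst hγ).div_const 2).fun_mul (hasDerivAt_comp_snd hν))
  have h := (P.hasDerivAt_primF z.1).fun_add ((hasDerivAt_tau_s hz).fun_mul hg)
  rw [fderiv_fst_dir (differentiableAt_gauge hz) h]
  have h1 := tau_curv hz
  have h2 := tau_sub hz
  have h3 := P.tangent_sq z.1
  rw [← h1] at h2 ⊢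
  simp only [tangF, dot2, F0, chart, nuVec, Prod.fst_add, Prod.snd_add, Prod.smul_fst,
    Prod.smul_snd, Prod.smul_mk, smul_eq_mul]
  linear_combination h2 / 2 + (P.tau z - curvOf P.γ z.1 * P.tau z ^ 2 / 2) * h3

end BoundaryParam

end

section

namespace BoundaryParam
variable {Ω : Set Plane} (P : BoundaryParam Ω)

lemma chart_zero (s : ℝ) : P.chart (s, 0) = P.γ s := by simp [chart, tau]

lemma mem_chartDom_zero (s : ℝ) : (s, (0 : ℝ)) ∈ P.chartDom := by simp [chartDom]

lemma γ_mem_frontier (s : ℝ) : P.γ s ∈ frontier Ω := P.range_eq ▸ mem_range_self s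

lemma exists_int_of_γ_eq {t t' : ℝ} (h : P.γ t = P.γ t') : ∃ n : ℤ, t' = t + n * P.L := by
  have hmem : ∀ t : ℝ, t - ⌊t / P.L⌋ * P.L ∈ Ico 0 P.L := fun t =>
    ⟨Int.sub_floor_div_mul_nonneg t P.L_pos, Int.sub_floor_div_mul_lt t P.L_pos⟩
  have hγ : ∀ t : ℝ, P.γ (t - ⌊t / P.L⌋ * P.L) = P.γ t := fun t => by
    rw [← zsmul_eq_mul]; exact P.periodic.sub_zsmul_eq _
  have := P.injOn (hmem t) (hmem t') (by rw [hγ, hγ, h])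
  exact ⟨⌊t' / P.L⌋ - ⌊t / P.L⌋, by push_cast; linarith⟩

lemma eq_of_γ_eq {t t' : ℝ} (h : P.γ t = P.γ t') (hd : |t' - t| < P.L) : t = t' := by
  obtain ⟨n, hn⟩ := P.exists_int_of_γ_eq h
  have h1 : |(n : ℝ)| * P.L < P.L := by
    rw [show t' - t = n * P.L by linarith, abs_mul, abs_of_pos P.L_pos] at hd
    exact hd
  have h2 : |(n : ℝ)| < 1 := by
    by_contra! h2
    nlinarith [P.L_pos]
  have h3 : n = 0 := by
    rw [← Int.cast_abs] at h2
    exact Int.abs_lt_one_iff.mp (by exact_mod_cast h2)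
  rw [hn, h3]; simp

lemma exists_chart_homeo (s₀ : ℝ) : ∃ e : OpenPartialHomeomorph Plane Plane,
    (∀ z, e z = P.chart z) ∧ (s₀, (0 : ℝ)) ∈ e.source ∧ e.source ⊆ P.chartDom := by
  have hmem := P.mem_chartDom_zero s₀
  have hc : ContDiffAt ℝ 1 P.chart (s₀, 0) :=
    (P.contDiffOn_chart.contDiffAt (P.isOpen_chartDom.mem_nhds hmem)).of_le (by simp)
  have hdet : (fderiv ℝ P.chart (s₀, 0)).det ≠ 0 := by rw [det_fderiv_chart hmem]; simp
  have hf : HasFDerivAt P.chart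
      ((fderiv ℝ P.chart (s₀, 0)).toContinuousLinearEquivOfDetNeZero hdet : Plane →L[ℝ] Plane)
      (s₀, 0) := by
    rw [ContinuousLinearMap.coe_toContinuousLinearEquivOfDetNeZero]
    exact (differentiableAt_chart hmem).hasFDerivAt
  let e := hc.toOpenPartialHomeomorph P.chart hf one_ne_zero
  refine ⟨e.restrOpen P.chartDom P.isOpen_chartDom, fun z => rfl,
    ⟨hc.mem_toOpenPartialHomeomorph_source hf one_ne_zero, hmem⟩, fun z hz => hz.2⟩

lemma exists_chart_ball (s₀ : ℝ) {r : ℝ} (hr : 0 < r) : ∃ e : OpenPartialHomeomorph Plane Plane,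
    (∀ z, e z = P.chart z) ∧ ∃ ρ > 0, ρ ≤ r ∧ e.source = Metric.ball (s₀, (0 : ℝ)) ρ ∧
      e.source ⊆ P.chartDom ∧ ∀ z ∈ e.source, P.chart z ∈ frontier Ω → z.2 = 0 := by
  obtain ⟨e, he, hs, hdom⟩ := P.exists_chart_homeo s₀
  obtain ⟨ρ₁, hρ₁, hball⟩ := Metric.isOpen_iff.mp e.open_source _ hs
  let C : Set Plane := P.γ '' (Icc (s₀ - P.L / 2) (s₀ + P.L / 2) \ Ioo (s₀ - ρ₁) (s₀ + ρ₁))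
  have hC : IsClosed C :=
    ((isCompact_Icc.diff isOpen_Ioo).image P.smooth.continuous).isClosed
  have hsC : P.γ s₀ ∉ C := by
    rintro ⟨t, ⟨ht, ht'⟩, h⟩
    have := P.eq_of_γ_eq h (by rw [abs_lt]; constructor <;> linarith [ht.1, ht.2, P.L_pos])
    subst this
    exact ht' ⟨by linarith, by linarith⟩
  have hopen : IsOpen (e.source ∩ e ⁻¹' Cᶜ) := e.isOpen_inter_preimage hC.isOpen_compl
  obtain ⟨ρ₂, hρ₂, hball2⟩ := Metric.isOpen_iff.mp hopen (s₀, 0)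
    ⟨hs, by rw [mem_preimage, he, chart_zero]; exact hsC⟩
  have hsub : Metric.ball (s₀, (0 : ℝ)) (min ρ₂ r) ⊆ Metric.ball (s₀, (0 : ℝ)) ρ₂ :=
    Metric.ball_subset_ball (min_le_left _ _)
  have hsrc : (e.restrOpen _ (Metric.isOpen_ball (x := (s₀, (0 : ℝ))) (ε := min ρ₂ r))).source =
      Metric.ball (s₀, (0 : ℝ)) (min ρ₂ r) := by
    rw [OpenPartialHomeomorph.restrOpen_source, inter_eq_right]
    exact fun z hz => (hball2 (hsub hz)).1
  refine ⟨e.restrOpen _ (Metric.isOpen_ball (x := (s₀, (0 : ℝ))) (ε := min ρ₂ r)), he,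
    min ρ₂ r, lt_min hρ₂ hr, min_le_right _ _, hsrc, fun z hz => hdom hz.1, fun z hz hfr => ?_⟩
  rw [hsrc] at hz
  obtain ⟨hz1, hz2⟩ := hball2 (hsub hz)
  rw [mem_preimage, he] at hz2
  rw [← P.range_eq] at hfr
  obtain ⟨t, ht⟩ := hfr
  obtain ⟨t', ht', htt'⟩ := P.periodic.exists_mem_Ico P.L_pos t (s₀ - P.L / 2)
  rw [htt'] at ht
  by_cases hin : t' ∈ Ioo (s₀ - ρ₁) (s₀ + ρ₁)
  · have hmem : ((t', 0) : Plane) ∈ e.source := by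
      refine hball ?_
      rw [← ball_prod_same, Real.ball_eq_Ioo]
      exact ⟨hin, by simpa using hρ₁⟩
    have := e.injOn hmem hz1 (by rw [he, he, chart_zero, ht])
    rw [← this]
  · exact absurd ⟨t', ⟨⟨ht'.1, by linarith [ht'.2]⟩, hin⟩, ht⟩ hz2

lemma isPreconnected_dichotomy {S : Set Plane} (hS : IsPreconnected S)
    (hf : Disjoint S (frontier Ω)) : S ⊆ Ω ∨ Disjoint S Ω := by
  have hcov : S ⊆ interior Ω ∪ (closure Ω)ᶜ := fun x hx => by
    by_contra h
    rw [mem_union, mem_compl_iff, not_or, not_not] at h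
    exact disjoint_left.mp hf hx ⟨h.2, h.1⟩
  have hdisj : Disjoint (interior Ω) (closure Ω)ᶜ :=
    disjoint_compl_right.mono_left (interior_subset.trans subset_closure)
  rcases hS.subset_or_subset isOpen_interior isClosed_closure.isOpen_compl hdisj hcov with h | h
  · exact Or.inl (h.trans interior_subset)
  · exact Or.inr (disjoint_compl_left.mono h subset_closure)

/-- Boundary coordinates near a boundary point, with the two sides of the boundary. -/
lemma exists_chart_sides (s₀ : ℝ) {r : ℝ} (hr : 0 < r) : ∃ e : OpenPartialHomeomorph Plane Plane,
    (∀ z, e z = P.chart z) ∧ ∃ ρ > 0, ρ ≤ r ∧ e.source = Metric.ball (s₀, (0 : ℝ)) ρ ∧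
      e.source ⊆ P.chartDom ∧ (∀ z ∈ e.source, 0 < z.2 → P.chart z ∈ Ω) ∧
        ((∀ z ∈ e.source, z.2 < 0 → P.chart z ∈ Ω) ∨
          (∀ z ∈ e.source, z.2 < 0 → P.chart z ∉ Ω)) := by
  obtain ⟨e, he, ρ, hρ, hρr, hsrc, hdom, hfr⟩ := P.exists_chart_ball s₀ hr
  refine ⟨e, he, ρ, hρ, hρr, hsrc, hdom, ?_, ?_⟩
  · have hconv : IsPreconnected (P.chart '' (e.source ∩ {z | 0 < z.2})) := by
      refine IsPreconnected.image ?_ _ (P.contDiffOn_chart.continuousOn.mono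
        (inter_subset_left.trans hdom))
      rw [hsrc]
      exact ((convex_ball _ _).inter
        ((convex_Ioi (0 : ℝ)).linear_preimage (LinearMap.snd ℝ ℝ ℝ))).isPreconnected
    rcases isPreconnected_dichotomy (Ω := Ω) hconv (by
      rw [disjoint_left]
      rintro _ ⟨z, ⟨hz, hz2⟩, rfl⟩ hzf
      exact hz2.ne' (hfr z hz hzf)) with h | h
    · exact fun z hz hz2 => h ⟨z, ⟨hz, hz2⟩, rfl⟩
    · exfalso
      obtain ⟨ε, hε, hin⟩ := P.inward s₀
      have hlim : Tendsto (fun x : ℝ => P.tau (s₀, x)) (𝓝[>] 0) (𝓝 0) := by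
        have h1 := (hasDerivAt_tau_x (P.mem_chartDom_zero s₀)).continuousAt.tendsto
        simp only [show P.tau (s₀, 0) = 0 by simp [tau]] at h1
        exact h1.mono_left nhdsWithin_le_nhds
      obtain ⟨x, hx1, hx2, hx0⟩ := ((hlim.eventually_lt_const hε).and
        ((((continuous_const.prodMk continuous_id).tendsto' (0 : ℝ) (s₀, 0) rfl).mono_left
          nhdsWithin_le_nhds |>.eventually (Metric.ball_mem_nhds (s₀, (0 : ℝ)) hρ)).and
          self_mem_nhdsWithin)).exists
      have hx2' : (s₀, x) ∈ e.source := by rw [hsrc]; exact hx2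
      have hq := q_pos (hdom hx2')
      have hx0' : 0 < x := hx0
      refine disjoint_left.mp h ⟨(s₀, x), ⟨hx2', hx0⟩, rfl⟩
        (hin (P.tau (s₀, x)) ⟨?_, hx1⟩)
      simp only [tau]; positivity
  · have hconv : IsPreconnected (P.chart '' (e.source ∩ {z | z.2 < 0})) := by
      refine IsPreconnected.image ?_ _ (P.contDiffOn_chart.continuousOn.mono
        (inter_subset_left.trans hdom))
      rw [hsrc]
      exact ((convex_ball _ _).inter
        ((convex_Iio (0 : ℝ)).linear_preimage (LinearMap.snd ℝ ℝ ℝ))).isPreconnected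
    rcases isPreconnected_dichotomy (Ω := Ω) hconv (by
      rw [disjoint_left]
      rintro _ ⟨z, ⟨hz, hz2⟩, rfl⟩ hzf
      exact hz2.ne (hfr z hz hzf)) with h | h
    · exact Or.inl fun z hz hz2 => h ⟨z, ⟨hz, hz2⟩, rfl⟩
    · exact Or.inr fun z hz hz2 => disjoint_left.mp h ⟨z, ⟨hz, hz2⟩, rfl⟩

lemma γ_notMem_interior_closure (hbdd : Bornology.IsBounded Ω) (s : ℝ) :
    P.γ s ∉ interior (closure Ω) := by
  let S : Set ℝ := P.γ ⁻¹' interior (closure Ω)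
  have hSo : IsOpen S := isOpen_interior.preimage P.smooth.continuous
  have hSc : IsOpen Sᶜ := by
    rw [isOpen_iff_mem_nhds]
    intro s₀ hs₀
    obtain ⟨e, he, ρ, hρ, -, hsrc, hdom, hup, hlo⟩ := P.exists_chart_sides s₀ one_pos
    have h0 : ((s₀, 0) : Plane) ∈ e.source := by rw [hsrc]; exact Metric.mem_ball_self hρ
    rcases hlo with hlo | hlo
    · refine absurd (mem_interior.mpr ⟨e.target, ?_, e.open_target, ?_⟩) hs₀
      · rw [← e.image_source_eq_target]
        rintro _ ⟨z, hz, rfl⟩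
        rw [he]
        rcases lt_trichotomy z.2 0 with h | h | h
        · exact subset_closure (hlo z hz h)
        · rw [show z = (z.1, 0) from Prod.ext rfl h, chart_zero]
          exact frontier_subset_closure (P.γ_mem_frontier _)
        · exact subset_closure (hup z hz h)
      · rw [← P.chart_zero, ← he]
        exact e.map_source h0
    · filter_upwards [Metric.ball_mem_nhds s₀ hρ] with s hs hsS
      have hopen : IsOpen (e '' (e.source ∩ {z | z.2 < 0})) :=
        e.isOpen_image_of_subset_source (e.open_source.inter
          (isOpen_lt continuous_snd continuous_const)) inter_subset_left
      have hdisj : Disjoint (e '' (e.source ∩ {z | z.2 < 0})) (closure Ω) := by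
        refine Disjoint.closure_right ?_ hopen
        rw [disjoint_left]
        rintro _ ⟨z, ⟨hz, hz2⟩, rfl⟩
        rw [he]
        exact hlo z hz hz2
      have hs0 : ((s, 0) : Plane) ∈ e.source := by
        rw [hsrc, ← ball_prod_same]
        exact ⟨hs, Metric.mem_ball_self hρ⟩
      have hlim : Tendsto (fun x : ℝ => ((s, x) : Plane)) (𝓝[<] 0) (𝓝 (s, 0)) :=
        ((continuous_const.prodMk continuous_id).tendsto' (0 : ℝ) (s, 0) rfl).mono_left
          nhdsWithin_le_nhds
      have hlim2 : Tendsto (fun x : ℝ => e (s, x)) (𝓝[<] 0) (𝓝 (e (s, 0))) :=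
        (e.continuousAt hs0).tendsto.comp hlim
      rw [he (s, 0), chart_zero] at hlim2
      obtain ⟨x, h1, h2, h3⟩ := ((hlim.eventually (e.open_source.mem_nhds hs0)).and
        ((hlim2.eventually (isOpen_interior.mem_nhds hsS)).and self_mem_nhdsWithin)).exists
      exact disjoint_left.mp hdisj ⟨_, ⟨h1, h3⟩, rfl⟩ (interior_subset h2)
  intro hs
  rcases isClopen_iff.mp (⟨⟨hSc⟩, hSo⟩ : IsClopen S) with h | h
  · have : s ∈ S := hs
    rw [h] at this
    exact this
  · have hcl : IsClopen (closure Ω) := by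
      refine ⟨isClosed_closure, ?_⟩
      rw [← interior_eq_iff_isOpen]
      refine interior_subset.antisymm fun x hx => ?_
      by_cases hxΩ : x ∈ interior Ω
      · exact interior_mono subset_closure hxΩ
      · have : x ∈ frontier Ω := ⟨hx, hxΩ⟩
        rw [← P.range_eq] at this
        obtain ⟨t, rfl⟩ := this
        have : t ∈ S := h ▸ mem_univ t
        exact this
    rcases isClopen_iff.mp hcl with h | h
    · have := frontier_subset_closure (P.γ_mem_frontier s)
      rw [h] at this
      exact this
    · refine noncompact_univ Plane ?_
      rw [← h]
      exact hbdd.isCompact_closure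

/-- Boundary coordinates near a boundary point, in which `Ω` is a half-plane. -/
lemma exists_chart (hopen : IsOpen Ω) (hbdd : Bornology.IsBounded Ω) (s₀ : ℝ) {r : ℝ}
    (hr : 0 < r) : ∃ e : OpenPartialHomeomorph Plane Plane,
    (∀ z, e z = P.chart z) ∧ ∃ ρ > 0, ρ ≤ r ∧ e.source = Metric.ball (s₀, (0 : ℝ)) ρ ∧
      e.source ⊆ P.chartDom ∧ (∀ z ∈ e.source, P.chart z ∈ Ω ↔ 0 < z.2) := by
  obtain ⟨e, he, ρ, hρ, hρr, hsrc, hdom, hup, hlo⟩ := P.exists_chart_sides s₀ hr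
  have h0 : ((s₀, 0) : Plane) ∈ e.source := by rw [hsrc]; exact Metric.mem_ball_self hρ
  refine ⟨e, he, ρ, hρ, hρr, hsrc, hdom, fun z hz => ⟨fun hzΩ => ?_, hup z hz⟩⟩
  by_contra! hz2
  rcases hz2.lt_or_eq with h | h
  · rcases hlo with hlo | hlo
    · refine P.γ_notMem_interior_closure hbdd s₀
        (mem_interior.mpr ⟨e.target, ?_, e.open_target, ?_⟩)
      · rw [← e.image_source_eq_target]
        rintro _ ⟨z, hz, rfl⟩
        rw [he]
        rcases lt_trichotomy z.2 0 with h | h | h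
        · exact subset_closure (hlo z hz h)
        · rw [show z = (z.1, 0) from Prod.ext rfl h, chart_zero]
          exact frontier_subset_closure (P.γ_mem_frontier _)
        · exact subset_closure (hup z hz h)
      · rw [← P.chart_zero, ← he]
        exact e.map_source h0
    · exact hlo z hz h hzΩ
  · rw [show z = (z.1, 0) from Prod.ext rfl h, chart_zero] at hzΩ
    exact disjoint_left.mp (disjoint_frontier_iff_isOpen.mpr hopen) (P.γ_mem_frontier _) hzΩ

variable {P} in
lemma contDiffOn_chart_symm {e : OpenPartialHomeomorph Plane Plane} (he : ∀ z, e z = P.chart z)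
    (hdom : e.source ⊆ P.chartDom) : ContDiffOn ℝ (⊤ : ℕ∞) e.symm e.target := by
  have he' : (e : Plane → Plane) = P.chart := funext he
  intro y hy
  have hz := hdom (e.map_target hy)
  have hdet : (fderiv ℝ P.chart (e.symm y)).det ≠ 0 := by rw [det_fderiv_chart hz]; simp
  refine (e.contDiffAt_symm (f₀' := (fderiv ℝ P.chart (e.symm y)).toContinuousLinearEquivOfDetNeZero
    hdet) hy ?_ ?_).contDiffWithinAt
  · rw [ContinuousLinearMap.coe_toContinuousLinearEquivOfDetNeZero, he']
    exact (differentiableAt_chart hz).hasFDerivAt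
  · rw [he']
    exact P.contDiffOn_chart.contDiffAt (P.isOpen_chartDom.mem_nhds hz)

end BoundaryParam

end

section

lemma fderiv_plane_apply (A : Plane →L[ℝ] ℂ) (w : Plane) :
    A w = w.1 * A (1, 0) + w.2 * A (0, 1) := by
  conv_lhs => rw [show w = w.1 • ((1 : ℝ), (0 : ℝ)) + w.2 • ((0 : ℝ), (1 : ℝ)) by ext <;> simp]
  rw [map_add, map_smul, map_smul, Complex.real_smul, Complex.real_smul]

lemma norm_sq_rotate {a b : ℝ} (h : a ^ 2 + b ^ 2 = 1) (z w : ℂ) :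
    ‖z‖ ^ 2 + ‖w‖ ^ 2 = ‖a * z + b * w‖ ^ 2 + ‖-b * z + a * w‖ ^ 2 := by
  simp only [Complex.sq_norm, Complex.normSq_apply, Complex.add_re, Complex.add_im,
    Complex.mul_re, Complex.mul_im, Complex.ofReal_re, Complex.ofReal_im, Complex.neg_re,
    Complex.neg_im]
  linear_combination (-(z.re ^ 2 + z.im ^ 2 + w.re ^ 2 + w.im ^ 2)) * h

namespace BoundaryParam
variable {Ω : Set Plane} {P : BoundaryParam Ω}

/-- The magnetic energy density in boundary coordinates. -/
lemma magSq_chart {z : Plane} (hz : z ∈ P.chartDom) {B : ℝ} {v V : Plane → ℂ}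
    (hv : DifferentiableAt ℝ v (P.chart z)) (hV : DifferentiableAt ℝ V z)
    (h : (fun y => v (P.chart y)) =ᶠ[𝓝 z]
      fun y => Complex.exp (Complex.I * (B * P.gauge y : ℝ)) * V y) :
    magSq B F0 v (P.chart z) = P.q z ^ 2 * ‖pd2 V z‖ ^ 2 + (P.q z ^ 2)⁻¹ *
      ‖(-Complex.I * pd1 V z + ((B * z.2 : ℝ) : ℂ) * V z) +
        Complex.I * ((P.tauS z * P.q z : ℝ) * pd2 V z)‖ ^ 2 := by
  have hq := q_pos hz
  have hq' : (P.q z : ℂ) ≠ 0 := by exact_mod_cast hq.ne'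
  have hd : ∀ w, fderiv ℝ v (P.chart z) (fderiv ℝ P.chart z w) =
      Complex.exp (Complex.I * (B * P.gauge z : ℝ)) *
        (fderiv ℝ V z w + Complex.I * (B * fderiv ℝ P.gauge z w : ℝ) * V z) := by
    intro w
    rw [← pd1_gauge B hV (differentiableAt_gauge hz), ← h.fderiv_eq]
    have := hv.hasFDerivAt.comp z (differentiableAt_chart hz).hasFDerivAt
    rw [show fderiv ℝ (fun y => v (P.chart y)) z = _ from this.fderiv]
    rfl
  have hs := hd (1, 0)
  have hx := hd (0, 1)
  have h0 : v (P.chart z) = _ := h.eq_of_nhds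
  rw [fderiv_chart_s hz, fderiv_gauge_s hz] at hs
  rw [fderiv_chart_x hz, fderiv_gauge_x hz] at hx
  rw [fderiv_plane_apply] at hs hx
  obtain ⟨E, hE⟩ : ∃ E, E = Complex.exp (Complex.I * (B * P.gauge z : ℝ)) := ⟨_, rfl⟩
  have hEn : ‖E‖ = 1 := by rw [hE]; exact norm_exp_I_mul_ofReal' _
  rw [← hE] at hs hx h0
  rw [magSq, h0]
  obtain ⟨a, ha⟩ : ∃ a, a = fderiv ℝ v (P.chart z) (1, 0) := ⟨_, rfl⟩
  obtain ⟨b, hb⟩ : ∃ b, b = fderiv ℝ v (P.chart z) (0, 1) := ⟨_, rfl⟩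
  obtain ⟨V1, hV1⟩ : ∃ b, b = fderiv ℝ V z (1, 0) := ⟨_, rfl⟩
  obtain ⟨V2, hV2⟩ : ∃ b, b = fderiv ℝ V z (0, 1) := ⟨_, rfl⟩
  simp only [pd1, pd2]
  rw [← ha, ← hb, ← hV1] at hs
  rw [← ha, ← hb, ← hV2] at hx
  rw [← ha, ← hb, ← hV1, ← hV2, norm_sq_rotate (P.tangent_sq z.1)]
  simp only [nuVec, Prod.fst_add, Prod.snd_add, Prod.smul_fst, Prod.smul_snd, smul_eq_mul, dot2]
    at hs hx
  push_cast at hs hx ⊢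
  generalize (deriv P.γ z.1).1 = T1 at *
  generalize (deriv P.γ z.1).2 = T2 at *
  generalize (F0 (P.chart z)).1 = F1 at *
  generalize (F0 (P.chart z)).2 = F2 at *
  have hxN : -(T2 : ℂ) * (-Complex.I * a - B * F1 * (E * V z)) +
      T1 * (-Complex.I * b - B * F2 * (E * V z)) = E * (P.q z * (-Complex.I * V2)) := by
    field_simp at hx
    linear_combination (-Complex.I) * hx + (-B * (F1 * (-T2) + F2 * T1) * V z * E) *
      Complex.I_mul_I
  have hxT : (T1 : ℂ) * (-Complex.I * a - B * F1 * (E * V z)) +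
      T2 * (-Complex.I * b - B * F2 * (E * V z)) = E * ((P.q z : ℂ)⁻¹ *
        ((-Complex.I * V1 + B * z.2 * V z) + Complex.I * (P.tauS z * P.q z * V2))) := by
    have : (P.q z : ℂ) * ((T1 : ℂ) * (-Complex.I * a - B * F1 * (E * V z)) +
      T2 * (-Complex.I * b - B * F2 * (E * V z))) = E *
        ((-Complex.I * V1 + B * z.2 * V z) + Complex.I * (P.tauS z * P.q z * V2)) := by
      linear_combination (-Complex.I) * hs - P.tauS z * hxN +
        (-B * (F1 * (P.q z * T1 + P.tauS z * (-T2)) + F2 * (P.q z * T2 + P.tauS z * T1) + z.2) *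
          V z * E) * Complex.I_mul_I
    rw [← mul_right_inj' hq', this]
    field_simp
  rw [hxN, hxT]
  simp only [norm_mul, hEn, one_mul, mul_pow, norm_inv, Complex.norm_real, Real.norm_eq_abs,
    sq_abs, inv_pow, norm_neg, Complex.norm_I]
  ring

end BoundaryParam

lemma norm_add_sq_ge {x : ℝ} (hx : 0 < x) (p y : ℂ) :
    (1 - x) * ‖p‖ ^ 2 - x⁻¹ * ‖y‖ ^ 2 ≤ ‖p + y‖ ^ 2 := by
  have h1 : ‖p‖ - ‖y‖ ≤ ‖p + y‖ := by
    have := norm_sub_norm_le p (-y)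
    rwa [norm_neg, sub_neg_eq_add] at this
  have h2 := sq_abs (‖p‖ - ‖y‖)
  have h3 : (‖p‖ - ‖y‖) ^ 2 ≤ ‖p + y‖ ^ 2 := by
    refine sq_le_sq.mpr ?_
    rw [abs_of_nonneg (norm_nonneg (p + y))]
    have := abs_norm_sub_norm_le p (-y)
    rwa [norm_neg, sub_neg_eq_add] at this
  have h4 : 0 ≤ x⁻¹ * (x * ‖p‖ - ‖y‖) ^ 2 := by positivity
  have h5 : x⁻¹ * (x * ‖p‖ - ‖y‖) ^ 2 = x * ‖p‖ ^ 2 - 2 * ‖p‖ * ‖y‖ + x⁻¹ * ‖y‖ ^ 2 := by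
    field_simp; ring
  nlinarith [sq_nonneg ‖y‖]

lemma norm_add_sq_le {x : ℝ} (hx : 0 < x) (p y : ℂ) :
    ‖p + y‖ ^ 2 ≤ (1 + x) * ‖p‖ ^ 2 + (1 + x⁻¹) * ‖y‖ ^ 2 := by
  have h3 : ‖p + y‖ ^ 2 ≤ (‖p‖ + ‖y‖) ^ 2 := by gcongr; exact norm_add_le p y
  have h4 : 0 ≤ x⁻¹ * (x * ‖p‖ - ‖y‖) ^ 2 := by positivity
  have h5 : x⁻¹ * (x * ‖p‖ - ‖y‖) ^ 2 = x * ‖p‖ ^ 2 - 2 * ‖p‖ * ‖y‖ + x⁻¹ * ‖y‖ ^ 2 := by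
    field_simp; ring
  linarith

lemma weights_lower {x k k₀ ε K K₁ t : ℝ} (hx : 0 < x) (hk : |k - k₀| ≤ ε / 2)
    (hK : |k| ≤ K) (ht : |t| ≤ 2 * K₁ * x ^ 2) (h1 : 4 * K * x ≤ 1) (h2 : 16 * K₁ ^ 2 * x ≤ ε)
    (h3 : 4 * x ≤ ε) (hx1 : x ≤ 1) (a p : ℂ) :
    (1 - 2 * (k₀ + ε) * x) * ‖a‖ ^ 2 + (1 + 2 * (k₀ - ε) * x) * ‖p‖ ^ 2 ≤
      (1 - 2 * k * x) * ‖a‖ ^ 2 + (1 - 2 * k * x)⁻¹ * ‖p + Complex.I * ((t : ℝ) * a)‖ ^ 2 := by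
  rw [abs_le] at hk hK
  have hkx : |2 * k * x| ≤ 1 / 2 := by
    rw [abs_le]; constructor <;> nlinarith only [h1, mul_le_mul_of_nonneg_right hK.1 hx.le,
      mul_le_mul_of_nonneg_right hK.2 hx.le]
  obtain ⟨y, hy⟩ : ∃ y, y = 2 * k * x := ⟨_, rfl⟩
  rw [← hy] at hkx ⊢
  rw [abs_le] at hkx
  have hQ : 0 < 1 - y := by linarith
  have hinv : 1 + y ≤ (1 - y)⁻¹ := by
    rw [← one_div, le_div_iff₀ hQ]; nlinarith only [sq_nonneg y]
  have hinv2 : (1 - y)⁻¹ ≤ 2 := by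
    rw [inv_le_comm₀ hQ two_pos]; linarith
  have hinv0 : 0 < (1 - y)⁻¹ := inv_pos.mpr hQ
  have hn := norm_add_sq_ge (x := x ^ 2) (by positivity) p (Complex.I * ((t : ℝ) * a))
  have hny : ‖Complex.I * ((t : ℝ) * a)‖ ^ 2 ≤ 4 * K₁ ^ 2 * (x ^ 2) ^ 2 * ‖a‖ ^ 2 := by
    rw [norm_mul, norm_mul, Complex.norm_I, one_mul, mul_pow, Complex.norm_real, Real.norm_eq_abs]
    have : |t| ^ 2 ≤ (2 * K₁ * x ^ 2) ^ 2 := by gcongr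
    calc |t| ^ 2 * ‖a‖ ^ 2 ≤ (2 * K₁ * x ^ 2) ^ 2 * ‖a‖ ^ 2 := by gcongr
      _ = _ := by ring
  have hn2 : (1 - x ^ 2) * ‖p‖ ^ 2 - 4 * K₁ ^ 2 * x ^ 2 * ‖a‖ ^ 2 ≤
      ‖p + Complex.I * ((t : ℝ) * a)‖ ^ 2 := by
    refine le_trans ?_ hn
    have : (x ^ 2)⁻¹ * ‖Complex.I * ((t : ℝ) * a)‖ ^ 2 ≤
        (x ^ 2)⁻¹ * (4 * K₁ ^ 2 * (x ^ 2) ^ 2 * ‖a‖ ^ 2) := by gcongr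
    have e : (x ^ 2)⁻¹ * (4 * K₁ ^ 2 * (x ^ 2) ^ 2 * ‖a‖ ^ 2) = 4 * K₁ ^ 2 * x ^ 2 * ‖a‖ ^ 2 := by
      field_simp
    linarith only [this, e]
  have hn3 := mul_le_mul_of_nonneg_left hn2 hinv0.le
  have hA : 1 - 2 * (k₀ + ε) * x + (1 - y)⁻¹ * (4 * K₁ ^ 2 * x ^ 2) ≤ 1 - y := by
    have e1 : (1 - y)⁻¹ * (4 * K₁ ^ 2 * x ^ 2) ≤ 2 * (4 * K₁ ^ 2 * x ^ 2) := by gcongr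
    have e2 : 16 * K₁ ^ 2 * x * x ≤ ε * x := by gcongr
    have e3 : k * x ≤ (k₀ + ε / 2) * x := by gcongr; linarith
    have e4 : 0 ≤ 8 * K₁ ^ 2 * x ^ 2 := by positivity
    linarith only [e1, e2, e3, e4, hy]
  have hB : 1 + 2 * (k₀ - ε) * x ≤ (1 - y)⁻¹ * (1 - x ^ 2) := by
    have hx2 : 0 ≤ 1 - x ^ 2 := by nlinarith only [hx, hx1]
    have e1 : (1 + y) * (1 - x ^ 2) ≤ (1 - y)⁻¹ * (1 - x ^ 2) := by gcongr
    have e2 : 4 * x * x ≤ ε * x := by gcongr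
    have e3 : (k₀ - ε / 2) * x ≤ k * x := by gcongr; linarith
    have e4 : y * x ^ 2 ≤ 1 * x ^ 2 := by gcongr; linarith
    nlinarith only [e1, e2, e3, e4, hy, sq_nonneg x]
  have f1 := mul_le_mul_of_nonneg_right hA (sq_nonneg ‖a‖)
  have f2 := mul_le_mul_of_nonneg_right hB (sq_nonneg ‖p‖)
  linarith only [f1, f2, hn3]

lemma weights_upper {x k k₀ ε K K₁ t : ℝ} (hx : 0 < x) (hk : |k - k₀| ≤ ε / 2)
    (hK : |k| ≤ K) (ht : |t| ≤ 2 * K₁ * x ^ 2) (h1 : 4 * K * x ≤ 1) (h2 : 16 * K₁ ^ 2 * x ≤ ε)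
    (h3 : (8 * K ^ 2 + 4) * x ≤ ε) (hx1 : x ≤ 1) (a p : ℂ) :
    (1 - 2 * k * x) * ‖a‖ ^ 2 + (1 - 2 * k * x)⁻¹ * ‖p + Complex.I * ((t : ℝ) * a)‖ ^ 2 ≤
      (1 - 2 * (k₀ - ε) * x) * ‖a‖ ^ 2 + (1 + 2 * (k₀ + ε) * x) * ‖p‖ ^ 2 := by
  rw [abs_le] at hk
  have hKx : |2 * k * x| ≤ 2 * K * x := by
    rw [abs_mul, abs_mul, abs_of_pos hx, abs_two]; gcongr
  obtain ⟨y, hy⟩ : ∃ y, y = 2 * k * x := ⟨_, rfl⟩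
  rw [← hy] at hKx ⊢
  have hy2 : y ^ 2 ≤ 4 * K ^ 2 * x ^ 2 := by
    calc y ^ 2 = |y| ^ 2 := (sq_abs y).symm
      _ ≤ (2 * K * x) ^ 2 := by gcongr
      _ = _ := by ring
  have hkx : |y| ≤ 1 / 2 := hKx.trans (by linarith)
  rw [abs_le] at hkx
  have hQ : 0 < 1 - y := by linarith
  have hinv : (1 - y)⁻¹ ≤ 1 + y + 2 * y ^ 2 := by
    rw [← one_div, div_le_iff₀ hQ]
    nlinarith only [sq_nonneg y, mul_nonneg (sq_nonneg y) (show 0 ≤ 1 - 2 * y by linarith)]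
  have hinv2 : (1 - y)⁻¹ ≤ 2 := by
    rw [inv_le_comm₀ hQ two_pos]; linarith
  have hinv0 : 0 < (1 - y)⁻¹ := inv_pos.mpr hQ
  have hx2 : x ^ 2 ≤ 1 := by nlinarith only [hx, hx1]
  have hn := norm_add_sq_le (x := x ^ 2) (by positivity) p (Complex.I * ((t : ℝ) * a))
  have hny : ‖Complex.I * ((t : ℝ) * a)‖ ^ 2 ≤ 4 * K₁ ^ 2 * (x ^ 2) ^ 2 * ‖a‖ ^ 2 := by
    rw [norm_mul, norm_mul, Complex.norm_I, one_mul, mul_pow, Complex.norm_real, Real.norm_eq_abs]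
    have : |t| ^ 2 ≤ (2 * K₁ * x ^ 2) ^ 2 := by gcongr
    calc |t| ^ 2 * ‖a‖ ^ 2 ≤ (2 * K₁ * x ^ 2) ^ 2 * ‖a‖ ^ 2 := by gcongr
      _ = _ := by ring
  have hn2 : ‖p + Complex.I * ((t : ℝ) * a)‖ ^ 2 ≤
      (1 + x ^ 2) * ‖p‖ ^ 2 + 8 * K₁ ^ 2 * x ^ 2 * ‖a‖ ^ 2 := by
    refine hn.trans ?_
    have : (1 + (x ^ 2)⁻¹) * ‖Complex.I * ((t : ℝ) * a)‖ ^ 2 ≤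
        (1 + (x ^ 2)⁻¹) * (4 * K₁ ^ 2 * (x ^ 2) ^ 2 * ‖a‖ ^ 2) := by gcongr
    have e : (1 + (x ^ 2)⁻¹) * (4 * K₁ ^ 2 * (x ^ 2) ^ 2 * ‖a‖ ^ 2) =
        4 * K₁ ^ 2 * x ^ 2 * ‖a‖ ^ 2 * (1 + x ^ 2) := by
      field_simp; ring
    have e2 : 4 * K₁ ^ 2 * x ^ 2 * ‖a‖ ^ 2 * (1 + x ^ 2) ≤
        4 * K₁ ^ 2 * x ^ 2 * ‖a‖ ^ 2 * (1 + 1) := by gcongr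
    linarith only [this, e, e2]
  have hn3 := mul_le_mul_of_nonneg_left hn2 hinv0.le
  have hA : 1 - y + (1 - y)⁻¹ * (8 * K₁ ^ 2 * x ^ 2) ≤ 1 - 2 * (k₀ - ε) * x := by
    have e1 : (1 - y)⁻¹ * (8 * K₁ ^ 2 * x ^ 2) ≤ 2 * (8 * K₁ ^ 2 * x ^ 2) := by gcongr
    have e2 : 16 * K₁ ^ 2 * x * x ≤ ε * x := by gcongr
    have e3 : (k₀ - ε / 2) * x ≤ k * x := by gcongr; linarith
    linarith only [e1, e2, e3, hy]
  have hB : (1 - y)⁻¹ * (1 + x ^ 2) ≤ 1 + 2 * (k₀ + ε) * x := by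
    have e1 : (1 - y)⁻¹ * (1 + x ^ 2) ≤ (1 + y + 2 * y ^ 2) * (1 + x ^ 2) := by gcongr
    have e2 : (8 * K ^ 2 + 4) * x * x ≤ ε * x := by gcongr
    have e3 : k * x ≤ (k₀ + ε / 2) * x := by gcongr; linarith
    have e4 : (y + 2 * y ^ 2) * x ^ 2 ≤ 1 * x ^ 2 := by gcongr; nlinarith only [hkx.1, hkx.2]
    nlinarith only [e1, e2, e3, e4, hy, hy2, sq_nonneg x]
  have f1 := mul_le_mul_of_nonneg_right hA (sq_nonneg ‖a‖)
  have f2 := mul_le_mul_of_nonneg_right hB (sq_nonneg ‖p‖)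
  linarith only [f1, f2, hn3]

lemma BoundaryParam.exists_chart_compare {Ω : Set Plane} (P : BoundaryParam Ω) (s₀ : ℝ) {ε : ℝ}
    (hε : 0 < ε) : ∃ r > 0, ∀ z ∈ Metric.ball (s₀, (0 : ℝ)) r, 0 < z.2 → z ∈ P.chartDom →
      ∀ a p : ℂ,
        (1 - 2 * (curvOf P.γ s₀ + ε) * z.2) * ‖a‖ ^ 2 +
            (1 + 2 * (curvOf P.γ s₀ - ε) * z.2) * ‖p‖ ^ 2 ≤
          P.q z ^ 2 * ‖a‖ ^ 2 + (P.q z ^ 2)⁻¹ *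
            ‖p + Complex.I * ((P.tauS z * P.q z : ℝ) * a)‖ ^ 2 ∧
        P.q z ^ 2 * ‖a‖ ^ 2 + (P.q z ^ 2)⁻¹ *
            ‖p + Complex.I * ((P.tauS z * P.q z : ℝ) * a)‖ ^ 2 ≤
          (1 - 2 * (curvOf P.γ s₀ - ε) * z.2) * ‖a‖ ^ 2 +
            (1 + 2 * (curvOf P.γ s₀ + ε) * z.2) * ‖p‖ ^ 2 := by
  obtain ⟨K, hK, hKb⟩ := P.exists_curv_bound
  have hkc := P.contDiff_curv.continuous.continuousAt (x := s₀)
  have hk1 : Continuous (deriv (curvOf P.γ)) :=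
    (contDiff_infty_iff_deriv.mp P.contDiff_curv).2.continuous
  obtain ⟨r₁, hr₁, h1⟩ := Metric.continuousAt_iff.mp hkc (ε / 2) (by positivity)
  obtain ⟨r₂, hr₂, h2⟩ := Metric.continuousAt_iff.mp (hk1.continuousAt (x := s₀)) 1 one_pos
  obtain ⟨K₁, hK₁⟩ : ∃ K₁, K₁ = |deriv (curvOf P.γ) s₀| + 1 := ⟨_, rfl⟩
  have hK₁pos : 0 < K₁ := by rw [hK₁]; positivity
  refine ⟨min (min r₁ r₂) (min (min (1 / (4 * K)) (ε / (16 * K₁ ^ 2)))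
    (min (ε / (8 * K ^ 2 + 4)) 1)), by positivity, fun z hz hz2 hdom a p => ?_⟩
  rw [← ball_prod_same] at hz
  obtain ⟨hs, hx⟩ := hz
  rw [Metric.mem_ball, Real.dist_eq, sub_zero, abs_of_pos hz2] at hx
  simp only [Metric.mem_ball, lt_min_iff] at hs hx
  have e1 : |curvOf P.γ z.1 - curvOf P.γ s₀| ≤ ε / 2 := (h1 hs.1.1).le
  have e2 : |deriv (curvOf P.γ) z.1| ≤ K₁ := by
    have : |deriv (curvOf P.γ) z.1 - deriv (curvOf P.γ) s₀| < 1 := h2 hs.1.2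
    rw [hK₁]
    linarith [abs_sub_abs_le_abs_sub (deriv (curvOf P.γ) z.1) (deriv (curvOf P.γ) s₀)]
  have hq := q_pos hdom
  have et : |P.tauS z * P.q z| ≤ 2 * K₁ * z.2 ^ 2 := by
    have e : P.tauS z * P.q z = 2 * deriv (curvOf P.γ) z.1 * z.2 ^ 2 / (1 + P.q z) ^ 2 := by
      simp only [tauS]; field_simp
    rw [e, abs_div, abs_mul, abs_mul, abs_two, abs_of_pos (show 0 < (1 + P.q z) ^ 2 by positivity),
      abs_of_pos (show 0 < z.2 ^ 2 by positivity)]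
    calc 2 * |deriv (curvOf P.γ) z.1| * z.2 ^ 2 / (1 + P.q z) ^ 2
        ≤ 2 * |deriv (curvOf P.γ) z.1| * z.2 ^ 2 / 1 := by
          gcongr
          nlinarith
      _ ≤ _ := by rw [div_one]; gcongr
  have c1 : 4 * K * z.2 ≤ 1 := by
    have := hx.2.1.1
    rw [lt_div_iff₀ (by positivity)] at this; linarith
  have c2 : 16 * K₁ ^ 2 * z.2 ≤ ε := by
    have := hx.2.1.2
    rw [lt_div_iff₀ (by positivity)] at this; linarith
  have c3 : (8 * K ^ 2 + 4) * z.2 ≤ ε := by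
    have := hx.2.2.1
    rw [lt_div_iff₀ (by positivity)] at this; linarith
  have c4 : 4 * z.2 ≤ ε := by
    have : 0 ≤ 8 * K ^ 2 * z.2 := by positivity
    linarith
  rw [q_sq hdom]
  exact ⟨weights_lower hz2 e1 (hKb _) et c1 c2 c4 hx.2.2.2.le a p,
    weights_upper hz2 e1 (hKb _) et c1 c2 c3 hx.2.2.2.le a p⟩

end

lemma trial_pointwise {h t a a1 m n c k ε Λ C K C1 : ℝ} (hh : 0 < h) (hh1 : h ≤ 1) (ht : 0 ≤ t)
    (hht : h * t ≤ 1) (ha0 : 0 ≤ a) (ha : a ≤ 1) (ha1 : |a1| ≤ C * h ^ 2 * t) (ha1' : |a1| ≤ C)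
    (hm : |m| ≤ 1 + t) (hc : |t - c| ≤ 1 + t) (hn : |n| ≤ K) (hε : 0 < ε) (hε1 : ε ≤ 1)
    (hΛ : 0 ≤ Λ) :
    (1 - 2 * (k - ε) * (h * t)) * (a1 + a * m) ^ 2 +
        (1 + 2 * (k + ε) * (h * t)) * (((t - c) ^ 2 + Λ * h ^ 2) * a ^ 2) ≤
      (c ^ 2 - k * C1 * h) * a ^ 2 +
        (2 * a * a1 * (m + k * h * n) + a ^ 2 * (2 * m ^ 2 + ((t - c) ^ 2 - c ^ 2 - m ^ 2) +
          k * h * (2 * t * (((t - c) ^ 2 - c ^ 2 - m ^ 2) + c ^ 2) + C1))) +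
        (((3 + 2 * |k|) * C ^ 2 + 2 * (3 + 2 * |k|) * C + 2 * C * (1 + |k| * K) +
          (3 + 2 * |k|) * Λ) * h ^ 2 + 4 * ε * h) * (1 + t) ^ 3 := by
  have hC : 0 ≤ C := (abs_nonneg _).trans ha1'
  have hK : 0 ≤ K := (abs_nonneg _).trans hn
  have ht0 : 0 ≤ h * t := by positivity
  have hk0 := abs_nonneg k
  obtain ⟨W, hW⟩ : ∃ W, W = 3 + 2 * |k| := ⟨_, rfl⟩
  have hW0 : 0 ≤ W := by rw [hW]; positivity
  have hw1 : 1 - 2 * (k - ε) * (h * t) ≤ W := by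
    have e1 : -k * (h * t) ≤ |k| * (h * t) := by gcongr; exact neg_le_abs k
    have e2 : |k| * (h * t) ≤ |k| * 1 := by gcongr
    have e3 : ε * (h * t) ≤ 1 * 1 := by gcongr
    linarith only [e1, e2, e3, hW]
  have hw1' : -W ≤ 1 - 2 * (k - ε) * (h * t) := by
    have e1 : k * (h * t) ≤ |k| * (h * t) := by gcongr; exact le_abs_self k
    have e2 : |k| * (h * t) ≤ |k| * 1 := by gcongr
    have e3 : 0 ≤ ε * (h * t) := by positivity
    linarith only [e1, e2, e3, hW]
  have hw1a : |1 - 2 * (k - ε) * (h * t)| ≤ W := abs_le.mpr ⟨hw1', hw1⟩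
  have hw2 : 1 + 2 * (k + ε) * (h * t) ≤ W := by
    have e1 : k * (h * t) ≤ |k| * (h * t) := by gcongr; exact le_abs_self k
    have e2 : |k| * (h * t) ≤ |k| * 1 := by gcongr
    have e3 : ε * (h * t) ≤ 1 * 1 := by gcongr
    linarith only [e1, e2, e3, hW]
  rw [← hW]
  have g1 : t ≤ (1 + t) ^ 3 := by nlinarith only [ht, pow_nonneg ht 2, pow_nonneg ht 3]
  have g2 : t * (1 + t) ≤ (1 + t) ^ 3 := by nlinarith only [ht, pow_nonneg ht 2, pow_nonneg ht 3]
  have g3 : 1 ≤ (1 + t) ^ 3 := by nlinarith only [ht, pow_nonneg ht 2, pow_nonneg ht 3]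
  have g4 : t * (1 + t) ^ 2 ≤ (1 + t) ^ 3 := by
    nlinarith only [ht, pow_nonneg ht 2, pow_nonneg ht 3]
  have ham : |a| ≤ 1 := by rwa [abs_of_nonneg ha0]
  have T1 : (1 - 2 * (k - ε) * (h * t)) * a1 ^ 2 ≤ W * C ^ 2 * h ^ 2 * (1 + t) ^ 3 :=
    calc _ ≤ W * a1 ^ 2 := by gcongr
      _ = W * (|a1| * |a1|) := by rw [← sq_abs]; ring
      _ ≤ W * (C * (C * h ^ 2 * t)) := by gcongr
      _ = W * C ^ 2 * h ^ 2 * t := by ring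
      _ ≤ _ := by gcongr
  have T2 : (1 - 2 * (k - ε) * (h * t)) * (2 * a * a1 * m) ≤ 2 * W * C * h ^ 2 * (1 + t) ^ 3 :=
    calc _ ≤ |(1 - 2 * (k - ε) * (h * t)) * (2 * a * a1 * m)| := le_abs_self _
      _ = |1 - 2 * (k - ε) * (h * t)| * (2 * |a| * |a1| * |m|) := by
        simp only [abs_mul, abs_two]
      _ ≤ W * (2 * 1 * (C * h ^ 2 * t) * (1 + t)) := by gcongr
      _ = 2 * W * C * h ^ 2 * (t * (1 + t)) := by ring
      _ ≤ _ := by gcongr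
  have T3 : -(2 * a * a1 * (m + k * h * n)) ≤ 2 * C * (1 + |k| * K) * h ^ 2 * (1 + t) ^ 3 := by
    have e : |m + k * h * n| ≤ (1 + |k| * K) * (1 + t) :=
      calc |m + k * h * n| ≤ |m| + |k| * |h| * |n| := by
            refine (abs_add_le _ _).trans ?_; rw [abs_mul, abs_mul]
        _ ≤ (1 + t) + |k| * 1 * K := by gcongr; rwa [abs_of_pos hh]
        _ ≤ _ := by nlinarith only [mul_nonneg (mul_nonneg hk0 hK) ht]
    calc _ ≤ |2 * a * a1 * (m + k * h * n)| := neg_le_abs _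
      _ = 2 * |a| * |a1| * |m + k * h * n| := by simp only [abs_mul, abs_two]
      _ ≤ 2 * 1 * (C * h ^ 2 * t) * ((1 + |k| * K) * (1 + t)) := by gcongr
      _ = 2 * C * (1 + |k| * K) * h ^ 2 * (t * (1 + t)) := by ring
      _ ≤ _ := by gcongr
  have T4 : (1 + 2 * (k + ε) * (h * t)) * (Λ * h ^ 2 * a ^ 2) ≤ W * Λ * h ^ 2 * (1 + t) ^ 3 :=
    calc _ ≤ W * (Λ * h ^ 2 * a ^ 2) := by gcongr
      _ ≤ W * (Λ * h ^ 2 * 1 ^ 2) := by gcongr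
      _ = W * Λ * h ^ 2 * 1 := by ring
      _ ≤ _ := by gcongr
  have T5 : 2 * ε * (h * t) * (m ^ 2 + (t - c) ^ 2) * a ^ 2 ≤ 4 * ε * h * (1 + t) ^ 3 :=
    calc _ = 2 * ε * (h * t) * (|m| ^ 2 + |t - c| ^ 2) * a ^ 2 := by simp only [sq_abs]
      _ ≤ 2 * ε * (h * t) * ((1 + t) ^ 2 + (1 + t) ^ 2) * 1 ^ 2 := by gcongr
      _ = 4 * ε * h * (t * (1 + t) ^ 2) := by ring
      _ ≤ _ := by gcongr
  linarith only [T1, T2, T3, T4, T5]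

lemma HalfLine.integrableOn_weight (D : HalfLine) :
    IntegrableOn (fun t => (1 + t) ^ 3 * D.u t ^ 2) (Ioi 0) := by
  have hu : Continuous D.u :=
    continuous_iff_continuousAt.mpr fun x => (D.hasDerivAt_u x).continuousAt
  have h1 := (integrableOn_rpow_exp_half (q := 1) one_pos).add
    (integrableOn_rpow_exp_half (q := 4) four_pos)
  refine Integrable.mono' (h1.const_mul (4 * D.K ^ 2 * Real.exp (D.c ^ 2)))
    (by fun_prop : Continuous fun t => (1 + t) ^ 3 * D.u t ^ 2).aestronglyMeasurable ?_
  filter_upwards [ae_restrict_mem measurableSet_Ioi] with t ht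
  have ht0 : (0 : ℝ) < t := ht
  have hK := D.K_pos
  have e1 : D.u t ^ 2 ≤ D.K ^ 2 * (Real.exp (D.c ^ 2) * Real.exp (-(1 / 2) * t ^ 2)) := by
    calc D.u t ^ 2 ≤ (D.K * Real.exp (-(t - D.c) ^ 2 / 2)) ^ 2 := by
          have := (D.u_pos t).le
          gcongr
          exact D.u_decay t ht0.le
      _ = D.K ^ 2 * Real.exp (-(t - D.c) ^ 2) := by
          rw [mul_pow, ← Real.exp_nat_mul]; congr 2; push_cast; ring
      _ ≤ _ := by
          rw [← Real.exp_add]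
          gcongr
          nlinarith only [sq_nonneg (t - 2 * D.c)]
  have e2 : (1 + t) ^ 3 ≤ 4 * (1 + t ^ 3) := by
    nlinarith only [mul_nonneg (by positivity : 0 ≤ 1 + t) (sq_nonneg (t - 1))]
  rw [Real.norm_of_nonneg (by positivity)]
  have e3 : t ^ ((4 : ℝ) - 1) = t ^ 3 := by
    rw [show (4 : ℝ) - 1 = ((3 : ℕ) : ℝ) by norm_num, Real.rpow_natCast]
  have e4 : t ^ ((1 : ℝ) - 1) = 1 := by rw [sub_self, Real.rpow_zero]
  rw [Pi.add_apply, e3, e4]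
  calc (1 + t) ^ 3 * D.u t ^ 2 ≤ (4 * (1 + t ^ 3)) *
        (D.K ^ 2 * (Real.exp (D.c ^ 2) * Real.exp (-(1 / 2) * t ^ 2))) := by gcongr
    _ = _ := by ring

/-- Compactly supported trial functions for the weighted half-line operator. -/
lemma HalfLine.exists_trial (D : HalfLine) (k : ℝ) {η : ℝ} (hη : 0 < η) : ∃ ε > 0, ∀ r > 0,
    r ≤ 1 → ∀ Λ ≥ 0, ∃ b0 > 0, ∀ b > b0, ∃ g : ℝ → ℝ, ContDiff ℝ 1 g ∧
      tsupport g ⊆ Metric.ball 0 r ∧ 0 < (∫ x in Ioi 0, g x ^ 2) ∧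
      ∫ x in Ioi 0, ((1 - 2 * (k - ε) * x) * deriv g x ^ 2 +
          (1 + 2 * (k + ε) * x) * (((b ^ 2 * x - D.c * b) ^ 2 + Λ) * g x ^ 2)) ≤
        (D.c ^ 2 * b ^ 2 - k * D.C1 * b + η * b) * ∫ x in Ioi 0, g x ^ 2 := by
  have hu : Continuous D.u :=
    continuous_iff_continuousAt.mpr fun x => (D.hasDerivAt_u x).continuousAt
  have hm : Continuous D.m :=
    continuous_iff_continuousAt.mpr fun x => (D.hasDerivAt_m x).continuousAt
  have hm1 : Continuous D.m1 :=
    continuous_iff_continuousAt.mpr fun x => (D.hasDerivAt_m1 x).continuousAt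
  have hn : Continuous D.n :=
    continuous_iff_continuousAt.mpr fun x => (D.hasDerivAt_n x).continuousAt
  obtain ⟨M, hM⟩ : ∃ M, M = ∫ t in Ioi 0, (1 + t) ^ 3 * D.u t ^ 2 := ⟨_, rfl⟩
  obtain ⟨m0, hm0⟩ : ∃ m0, m0 = ∫ t in Ioc 0 1, D.u t ^ 2 := ⟨_, rfl⟩
  have hI1 : IntegrableOn (fun t => D.u t ^ 2) (Ioc 0 1) :=
    (by fun_prop : Continuous fun t => D.u t ^ 2).integrableOn_Ioc
  have hm0pos : 0 < m0 := by
    rw [hm0, ← intervalIntegral.integral_of_le zero_le_one]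
    exact intervalIntegral.intervalIntegral_pos_of_pos
      ((by fun_prop : Continuous fun t => D.u t ^ 2).intervalIntegrable _ _)
      (fun t => by have := D.u_pos t; positivity) one_pos
  have hMpos : 0 < M := by
    refine hm0pos.trans_le ?_
    rw [hm0, hM]
    calc ∫ t in Ioc 0 1, D.u t ^ 2 ≤ ∫ t in Ioc 0 1, (1 + t) ^ 3 * D.u t ^ 2 := by
          refine setIntegral_mono_on hI1 (D.integrableOn_weight.mono_set Ioc_subset_Ioi_self)
            measurableSet_Ioc fun t ht => ?_
          exact le_mul_of_one_le_left (sq_nonneg _) (one_le_pow₀ (by linarith [ht.1]))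
      _ ≤ _ := by
          refine setIntegral_mono_set D.integrableOn_weight ?_
            (Ioc_subset_Ioi_self).eventuallyLE
          filter_upwards [ae_restrict_mem measurableSet_Ioi] with t ht
          have : (0 : ℝ) < t := ht
          positivity
  refine ⟨min 1 (η * m0 / (8 * M)), by positivity, fun r hr hr1 Λ hΛ => ?_⟩
  obtain ⟨ε, hεdef⟩ : ∃ ε, ε = min 1 (η * m0 / (8 * M)) := ⟨_, rfl⟩
  rw [← hεdef]
  have hε : 0 < ε := by rw [hεdef]; positivity
  have hε1 : ε ≤ 1 := hεdef ▸ min_le_left _ _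
  have hεM : 8 * ε * M ≤ η * m0 := by
    have : ε ≤ η * m0 / (8 * M) := hεdef ▸ min_le_right _ _
    rw [le_div_iff₀ (by positivity)] at this; linarith
  let χ : ContDiffBump (0 : ℝ) := ⟨r / 4, r / 2, by positivity, by linarith⟩
  have hχ1 : ContDiff ℝ 1 χ := χ.contDiff
  have hχd : Continuous (deriv χ) := hχ1.continuous_deriv le_rfl
  obtain ⟨C, hC⟩ := (χ.hasCompactSupport.deriv).exists_bound_of_continuous hχd
  have hC0 : 0 ≤ C := (norm_nonneg _).trans (hC 0)
  obtain ⟨C', hC'⟩ : ∃ C', C' = C + 4 * C / r := ⟨_, rfl⟩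
  have hC'0 : 0 ≤ C' := by rw [hC']; positivity
  obtain ⟨E, hE⟩ : ∃ E, E = ((3 + 2 * |k|) * C' ^ 2 + 2 * (3 + 2 * |k|) * C' +
    2 * C' * (1 + |k| * D.K) + (3 + 2 * |k|) * Λ) := ⟨_, rfl⟩
  have hE0 : 0 ≤ E := by have := D.K_pos; rw [hE]; positivity
  refine ⟨max (max 1 (4 / r)) (2 * E * M / (η * m0)), by positivity, fun b hb => ?_⟩
  simp only [gt_iff_lt, max_lt_iff] at hb
  obtain ⟨⟨hb1, hb2⟩, hb3⟩ := hb
  have hb0 : 0 < b := by linarith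
  obtain ⟨h, hh⟩ : ∃ h, h = b⁻¹ := ⟨_, rfl⟩
  have hh0 : 0 < h := by rw [hh]; positivity
  have hhb : h * b = 1 := by rw [hh]; field_simp
  have hh1 : h ≤ 1 := by rw [hh]; exact inv_le_one_of_one_le₀ hb1.le
  have hhr : h ≤ r / 4 := by
    rw [div_lt_iff₀ hr] at hb2
    nlinarith only [hb2, hhb, hh0]
  have hhE : 2 * E * M * h ≤ η * m0 := by
    rw [div_lt_iff₀ (by positivity)] at hb3
    have := mul_le_mul_of_nonneg_right hb3.le hh0.le
    have e : b * (η * m0) * h = η * m0 * (h * b) := by ring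
    rw [e, hhb] at this
    linarith
  let a : ℝ → ℝ := fun t => χ (h * t)
  let a1 : ℝ → ℝ := fun t => deriv χ (h * t) * h
  have ha : ∀ t, HasDerivAt a (a1 t) t := fun t => by
    have := ((hχ1.differentiable one_ne_zero (h * t)).hasDerivAt).comp t
      ((hasDerivAt_id t).const_mul h)
    simpa [a1, a, Function.comp_def] using this
  have hac : Continuous a := by fun_prop
  have ha1c : Continuous a1 := by fun_prop
  have hsupp : ∀ t, r / 2 < |h * t| → a t = 0 := fun t ht => χ.zero_of_le_dist (by
    rw [Real.dist_eq, sub_zero]; exact ht.le)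
  have hsupp1 : ∀ t, r / 2 < |h * t| → a1 t = 0 := fun t ht => by
    have : deriv χ (h * t) = 0 := by
      refine image_eq_zero_of_notMem_tsupport (fun hmem => ?_)
      have := tsupport_deriv_subset hmem
      rw [χ.tsupport_eq, mem_closedBall_zero_iff, Real.norm_eq_abs] at this
      exact absurd this (not_le.mpr ht)
    simp [a1, this]
  have ha1z : ∀ t, |h * t| < r / 4 → a1 t = 0 := fun t ht => by
    have : deriv χ (h * t) = 0 := by
      have : ⇑χ =ᶠ[𝓝 (h * t)] fun _ => 1 := by
        filter_upwards [Metric.isOpen_ball.mem_nhds (show h * t ∈ Metric.ball (0 : ℝ) (r / 4) by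
          rwa [mem_ball_zero_iff])] with y hy
        exact χ.one_of_mem_closedBall (Metric.ball_subset_closedBall hy)
      rw [this.deriv_eq]; simp
    simp [a1, this]
  have ha1b : ∀ t, |a1 t| ≤ C * h := fun t => by
    simp only [a1, abs_mul, abs_of_pos hh0]
    gcongr
    exact hC _
  have ha1' : ∀ t, 0 ≤ t → |a1 t| ≤ C' * h ^ 2 * t := fun t ht => by
    rcases lt_or_ge |h * t| (r / 4) with hlt | hge
    · rw [ha1z t hlt, abs_zero]; positivity
    · rw [abs_of_nonneg (by positivity)] at hge
      calc |a1 t| ≤ C * h * 1 := by rw [mul_one]; exact ha1b t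
        _ ≤ C * h * (4 / r * (h * t)) := by
            gcongr
            rw [div_mul_eq_mul_div, le_div_iff₀ hr]; linarith
        _ = (4 * C / r) * h ^ 2 * t := by ring
        _ ≤ _ := by gcongr; rw [hC']; linarith
  have ha1'' : ∀ t, |a1 t| ≤ C' := fun t => (ha1b t).trans (by
    rw [hC']
    have : C * h ≤ C * 1 := by gcongr
    have : 0 ≤ 4 * C / r := by positivity
    linarith)
  let f : ℝ → ℝ := fun t => a t * D.u t
  let f1 : ℝ → ℝ := fun t => (a1 t + a t * D.m t) * D.u t
  have hf : ∀ t, HasDerivAt f (f1 t) t := fun t =>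
    ((ha t).fun_mul (D.hasDerivAt_u t)).congr_deriv (by simp only [f1]; ring)
  have hfc : Continuous f := by fun_prop
  have hf1c : Continuous f1 := by fun_prop
  have hcs : ∀ F : ℝ → ℝ, (∀ t, a t = 0 → a1 t = 0 → F t = 0) → HasCompactSupport F :=
    fun F hF => HasCompactSupport.of_support_subset_isCompact
      (isCompact_closedBall (0 : ℝ) (r / 2 * b)) (fun t ht => by
        rw [mem_closedBall_zero_iff, Real.norm_eq_abs]
        by_contra! hlt
        have : r / 2 < |h * t| := by
          rw [abs_mul, abs_of_pos hh0]
          calc r / 2 = h * (r / 2 * b) := by linear_combination (-(r / 2)) * hhb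
            _ < h * |t| := by gcongr
        exact ht (hF t (hsupp t this) (hsupp1 t this)))
  let G : ℝ → ℝ := fun t => a t ^ 2 * (D.u t ^ 2 * (D.m t + k * h * D.n t))
  let G1 : ℝ → ℝ := fun t => D.u t ^ 2 * (2 * a t * a1 t * (D.m t + k * h * D.n t) +
    a t ^ 2 * (2 * D.m t ^ 2 + D.m1 t + k * h * (2 * t * (D.m1 t + D.c ^ 2) + D.C1)))
  have hG : ∀ t, HasDerivAt G (G1 t) t := fun t => by
    have := ((ha t).fun_pow 2).fun_mul (((D.hasDerivAt_u t).fun_pow 2).fun_mul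
      ((D.hasDerivAt_m t).fun_add ((D.hasDerivAt_n t).const_mul (k * h))))
    refine this.congr_deriv ?_
    rw [D.n1_eq]
    simp only [G1]
    push_cast
    ring
  have hG1c : Continuous G1 := by fun_prop
  have hGc : Continuous G := by fun_prop
  have hGi : ∫ t in Ioi 0, G1 t = 0 := by
    have hG1 : deriv G = G1 := funext fun t => (hG t).deriv
    have hcd : ContDiff ℝ 1 G := contDiff_one_iff_deriv.mpr
      ⟨fun t => (hG t).differentiableAt, by rw [hG1]; exact hG1c⟩
    rw [← hG1, HasCompactSupport.integral_Ioi_deriv_eq hcd (hcs G (fun t h1 _ => by simp [G, h1]))]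
    simp [G, D.m_zero, D.n_zero]
  let I : ℝ → ℝ := fun t => (1 - 2 * (k - ε) * (h * t)) * f1 t ^ 2 +
    (1 + 2 * (k + ε) * (h * t)) * (((t - D.c) ^ 2 + Λ * h ^ 2) * f t ^ 2)
  have hIc : Continuous I := by fun_prop
  have hIi : Integrable I := hIc.integrable_of_hasCompactSupport
    (hcs I fun t h1 h2 => by simp [I, f, f1, h1, h2])
  have hfi : Integrable fun t => f t ^ 2 :=
    (by fun_prop : Continuous fun t => f t ^ 2).integrable_of_hasCompactSupport
      (hcs _ fun t h1 h2 => by simp [f, h1])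
  have hG1i : Integrable G1 := hG1c.integrable_of_hasCompactSupport
    (hcs G1 fun t h1 h2 => by simp [G1, h1, h2])
  have hpt : ∀ t ∈ Ioi (0 : ℝ), I t ≤ (D.c ^ 2 - k * D.C1 * h) * f t ^ 2 + G1 t +
      (E * h ^ 2 + 4 * ε * h) * ((1 + t) ^ 3 * D.u t ^ 2) := by
    intro t ht
    have ht0 : 0 ≤ t := le_of_lt ht
    rcases lt_or_ge (r / 2) |h * t| with hlt | hge
    · have h1 := hsupp t hlt
      have h2 := hsupp1 t hlt
      simp only [I, f1, f, G1, h1, h2]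
      have : 0 ≤ (E * h ^ 2 + 4 * ε * h) * ((1 + t) ^ 3 * D.u t ^ 2) := by positivity
      simpa using this
    · rw [abs_of_nonneg (by positivity)] at hge
      have hcl := D.c_lt
      have hcp := D.c_pos
      have := trial_pointwise (k := k) (C1 := D.C1) (m := D.m t) hh0 hh1 ht0 (by linarith)
          (χ.nonneg : 0 ≤ a t)
        (χ.le_one : a t ≤ 1) (ha1' t ht0) (ha1'' t)
        (abs_le.mpr ⟨by linarith [D.m_lower t ht0], by linarith [D.m_upper t ht0]⟩)
        (abs_le.mpr ⟨by linarith, by linarith⟩ : |t - D.c| ≤ 1 + t) (D.n_bound t ht0) hε hε1 hΛ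
      rw [← hE, ← D.m1_eq] at this
      have h3 := mul_le_mul_of_nonneg_right this (sq_nonneg (D.u t))
      refine le_of_eq_of_le ?_ (h3.trans_eq ?_)
      · simp only [I, f1, f]; ring
      · simp only [G1, f]; ring
  have hmass : m0 ≤ ∫ t in Ioi 0, f t ^ 2 := by
    rw [hm0]
    calc ∫ t in Ioc 0 1, D.u t ^ 2 = ∫ t in Ioc 0 1, f t ^ 2 := by
          refine setIntegral_congr_fun measurableSet_Ioc fun t ht => ?_
          have : a t = 1 := χ.one_of_mem_closedBall (by
            rw [mem_closedBall_zero_iff, Real.norm_eq_abs,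
              abs_of_nonneg (mul_nonneg hh0.le ht.1.le)]
            show h * t ≤ r / 4
            nlinarith only [ht.2, hh0, hhr])
          simp [f, this]
      _ ≤ _ := setIntegral_mono_set hfi.integrableOn (ae_of_all _ fun t => sq_nonneg _)
          (Ioc_subset_Ioi_self).eventuallyLE
  have hmain : ∫ t in Ioi 0, I t ≤ (D.c ^ 2 - k * D.C1 * h + η * h) * ∫ t in Ioi 0, f t ^ 2 := by
    have i1 : IntegrableOn (fun t => (D.c ^ 2 - k * D.C1 * h) * f t ^ 2) (Ioi 0) :=
      hfi.integrableOn.const_mul _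
    have i2 : IntegrableOn (fun t => (D.c ^ 2 - k * D.C1 * h) * f t ^ 2 + G1 t) (Ioi 0) :=
      i1.add hG1i.integrableOn
    have i3 : IntegrableOn (fun t => (E * h ^ 2 + 4 * ε * h) * ((1 + t) ^ 3 * D.u t ^ 2)) (Ioi 0) :=
      D.integrableOn_weight.const_mul _
    have h1 := setIntegral_mono_on hIi.integrableOn (i2.add i3) measurableSet_Ioi hpt
    rw [integral_add' i2 i3, integral_add i1 hG1i.integrableOn,
      integral_const_mul, integral_const_mul, hGi, ← hM] at h1
    have h2 : (E * h ^ 2 + 4 * ε * h) * M ≤ η * h * m0 := by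
      nlinarith only [mul_le_mul_of_nonneg_right hhE hh0.le, mul_le_mul_of_nonneg_right hεM hh0.le]
    have h3 : η * h * m0 ≤ η * h * ∫ t in Ioi 0, f t ^ 2 := by gcongr
    linarith only [h1, h2, h3]
  let g : ℝ → ℝ := fun x => f (b * x)
  have hg : ∀ x, HasDerivAt g (b * f1 (b * x)) x := fun x => by
    have := (hf (b * x)).comp x ((hasDerivAt_id x).const_mul b)
    simpa [g, Function.comp_def, mul_comm] using this
  have hgd : deriv g = fun x => b * f1 (b * x) := funext fun x => (hg x).deriv
  have hscale : ∀ F : ℝ → ℝ, ∫ x in Ioi 0, F (b * x) = h * ∫ t in Ioi 0, F t := fun F => by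
    rw [integral_comp_mul_left_Ioi _ _ hb0, mul_zero, smul_eq_mul, hh]
  have hgm : ∫ x in Ioi 0, g x ^ 2 = h * ∫ t in Ioi 0, f t ^ 2 := hscale fun t => f t ^ 2
  refine ⟨g, contDiff_one_iff_deriv.mpr ⟨fun x => (hg x).differentiableAt, by
    rw [hgd]; fun_prop⟩, ?_, ?_, ?_⟩
  · refine (closure_minimal (fun x hx => ?_) Metric.isClosed_closedBall : _ ⊆
      Metric.closedBall (0 : ℝ) (r / 2)).trans (Metric.closedBall_subset_ball (by linarith))
    rw [mem_closedBall_zero_iff, Real.norm_eq_abs]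
    by_contra! hlt
    refine hx ?_
    have : a (b * x) = 0 := hsupp _ (by rwa [← mul_assoc, hhb, one_mul])
    simp [g, f, this]
  · rw [hgm]; exact mul_pos hh0 (hm0pos.trans_le hmass)
  · have e : ∫ x in Ioi 0, ((1 - 2 * (k - ε) * x) * deriv g x ^ 2 +
          (1 + 2 * (k + ε) * x) * (((b ^ 2 * x - D.c * b) ^ 2 + Λ) * g x ^ 2)) =
        h * (b ^ 2 * ∫ t in Ioi 0, I t) := by
      rw [← integral_const_mul, ← hscale]
      refine setIntegral_congr_fun measurableSet_Ioi fun x _ => ?_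
      have e1 : h * (b * x) = x := by rw [← mul_assoc, hhb, one_mul]
      have e2 : b ^ 2 * h ^ 2 = 1 := by rw [← mul_pow, mul_comm, hhb, one_pow]
      simp only [I, hgd, e1, g]
      linear_combination (-(1 + 2 * (k + ε) * x) * Λ * f (b * x) ^ 2) * e2
    rw [e, hgm]
    have h4 := mul_le_mul_of_nonneg_left hmain (by positivity : 0 ≤ h * b ^ 2)
    refine le_trans (le_of_eq (by ring)) (h4.trans_eq ?_)
    linear_combination (h * b * (-k * D.C1 + η) * ∫ t in Ioi 0, f t ^ 2) * hhb

section

lemma contDiff_of_contDiffOn_of_eq_zero {E : Type*} [NormedAddCommGroup E] [NormedSpace ℝ E]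
    {f : Plane → E} {K S : Set Plane} {n : WithTop ℕ∞} (hK : IsClosed K) (hS : IsOpen S)
    (hKS : K ⊆ S) (hf : ContDiffOn ℝ n f S) (h0 : ∀ z ∉ K, f z = 0) : ContDiff ℝ n f := by
  rw [contDiff_iff_contDiffAt]
  intro z
  by_cases hz : z ∈ S
  · exact hf.contDiffAt (hS.mem_nhds hz)
  · have : f =ᶠ[𝓝 z] fun _ => 0 := by
      filter_upwards [hK.isOpen_compl.mem_nhds fun h => hz (hKS h)] with y hy
      exact h0 y hy
    exact contDiffAt_const.congr_of_eventuallyEq this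

lemma fderiv_eq_zero_of_notMem {f : Plane → ℂ} {K : Set Plane} (hK : IsClosed K)
    (h0 : ∀ z ∉ K, f z = 0) {z : Plane} (hz : z ∉ K) : fderiv ℝ f z = 0 := by
  have : f =ᶠ[𝓝 z] fun _ => 0 := by
    filter_upwards [hK.isOpen_compl.mem_nhds hz] with y hy
    exact h0 y hy
  rw [this.fderiv_eq]; simp

lemma magSq_eq_zero_of_notMem {f : Plane → ℂ} {K : Set Plane} (hK : IsClosed K)
    (h0 : ∀ z ∉ K, f z = 0) {z : Plane} (hz : z ∉ K) (B : ℝ) (A : Plane → Plane) :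
    magSq B A f z = 0 := by
  simp [magSq, fderiv_eq_zero_of_notMem hK h0 hz, h0 z hz]

lemma magSq_nonneg (B : ℝ) (A : Plane → Plane) (f : Plane → ℂ) (z : Plane) :
    0 ≤ magSq B A f z := by unfold magSq; positivity

lemma continuous_F0 : Continuous F0 := by unfold F0; fun_prop

lemma continuous_magSq {f : Plane → ℂ} (hf : ContDiff ℝ 1 f) (B : ℝ) {A : Plane → Plane}
    (hA : Continuous A) : Continuous (magSq B A f) := by
  have h := hf.continuous
  have h1 := continuous_pd1 hf
  have h2 := continuous_pd2 hf
  change Continuous fun x => ‖(-Complex.I) * pd1 f x - ((B * (A x).1 : ℝ) : ℂ) * f x‖ ^ 2 +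
    ‖(-Complex.I) * pd2 f x - ((B * (A x).2 : ℝ) : ℂ) * f x‖ ^ 2
  fun_prop

lemma integrable_magSq {f : Plane → ℂ} (hf : ContDiff ℝ 1 f) (hc : HasCompactSupport f) (B : ℝ)
    {A : Plane → Plane} (hA : Continuous A) : Integrable (magSq B A f) := by
  refine (continuous_magSq hf B hA).integrable_of_hasCompactSupport (hc.mono' fun z hz => ?_)
  by_contra h
  exact hz (magSq_eq_zero_of_notMem (isClosed_tsupport f)
    (fun z hz => image_eq_zero_of_notMem_tsupport hz) h B A)

/-- The weighted energy density in the half-plane. -/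
def halfDensity (w1 w2 b : ℝ) (V : Plane → ℂ) (z : Plane) : ℝ :=
  (1 + 2 * w1 * z.2) * ‖pd2 V z‖ ^ 2 +
    (1 + 2 * w2 * z.2) * ‖-Complex.I * pd1 V z + ((b ^ 2 * z.2 : ℝ) : ℂ) * V z‖ ^ 2

lemma integrable_halfDensity {V : Plane → ℂ} (hf : ContDiff ℝ 1 V) (hc : HasCompactSupport V)
    (w1 w2 b : ℝ) : Integrable (halfDensity w1 w2 b V) := by
  have h := hf.continuous
  have h1 := continuous_pd1 hf
  have h2 := continuous_pd2 hf
  unfold halfDensity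
  refine Continuous.integrable_of_hasCompactSupport (by fun_prop) (hc.mono' fun z hz => ?_)
  by_contra h
  refine hz ?_
  simp [pd1, pd2, fderiv_eq_zero_of_notMem (isClosed_tsupport V)
    (fun z hz => image_eq_zero_of_notMem_tsupport hz) h, image_eq_zero_of_notMem_tsupport h]

namespace BoundaryParam
variable {Ω : Set Plane} {P : BoundaryParam Ω} {e : OpenPartialHomeomorph Plane Plane}

lemma image_chart_pos (he : ∀ z, e z = P.chart z)
    (hside : ∀ z ∈ e.source, (P.chart z ∈ Ω ↔ 0 < z.2)) :
    P.chart '' (e.source ∩ {z | 0 < z.2}) = Ω ∩ e.target := by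
  ext x
  constructor
  · rintro ⟨z, ⟨hz, hz2⟩, rfl⟩
    exact ⟨(hside z hz).mpr hz2, he z ▸ e.map_source hz⟩
  · rintro ⟨hx, hxt⟩
    have h1 : P.chart (e.symm x) = x := by rw [← he, e.right_inv hxt]
    exact ⟨e.symm x, ⟨e.map_target hxt, (hside _ (e.map_target hxt)).mp (by rwa [h1])⟩, h1⟩

lemma measurableSet_chart_pos : MeasurableSet (e.source ∩ {z : Plane | 0 < z.2}) :=
  (e.open_source.inter (isOpen_lt continuous_const continuous_snd)).measurableSet

lemma hasFDerivWithinAt_chart (hdom : e.source ⊆ P.chartDom) :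
    ∀ z ∈ e.source ∩ {z : Plane | 0 < z.2},
      HasFDerivWithinAt P.chart (fderiv ℝ P.chart z) (e.source ∩ {z : Plane | 0 < z.2}) z :=
  fun _ hz => (differentiableAt_chart (hdom hz.1)).hasFDerivAt.hasFDerivWithinAt

lemma injOn_chart (he : ∀ z, e z = P.chart z) :
    InjOn P.chart (e.source ∩ {z : Plane | 0 < z.2}) := fun x hx y hy h =>
  e.injOn hx.1 hy.1 (by rwa [he, he])

lemma integral_chart (he : ∀ z, e z = P.chart z) (hdom : e.source ⊆ P.chartDom)
    (hside : ∀ z ∈ e.source, (P.chart z ∈ Ω ↔ 0 < z.2)) (hopen : IsOpen Ω)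
    {g : Plane → ℝ} (hg : ∀ x ∉ e.target, g x = 0) :
    ∫ x in Ω, g x = ∫ z in e.source ∩ {z : Plane | 0 < z.2}, g (P.chart z) := by
  have h1 : ∫ x in Ω, g x = ∫ x in Ω ∩ e.target, g x :=
    setIntegral_eq_of_subset_of_forall_sdiff_eq_zero hopen.measurableSet inter_subset_left
      fun x hx => hg x fun hxt => hx.2 ⟨hx.1, hxt⟩
  rw [h1, ← image_chart_pos he hside, integral_image_eq_integral_abs_det_fderiv_smul volume
    measurableSet_chart_pos (hasFDerivWithinAt_chart hdom) (injOn_chart he)]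
  refine setIntegral_congr_fun measurableSet_chart_pos fun z hz => ?_
  rw [det_fderiv_chart (hdom hz.1), abs_one, one_smul]

lemma integrableOn_chart (he : ∀ z, e z = P.chart z) (hdom : e.source ⊆ P.chartDom)
    (hside : ∀ z ∈ e.source, (P.chart z ∈ Ω ↔ 0 < z.2))
    {g : Plane → ℝ} (hg : IntegrableOn g Ω) :
    IntegrableOn (fun z => g (P.chart z)) (e.source ∩ {z : Plane | 0 < z.2}) := by
  have h1 := hg.mono_set (inter_subset_left (t := e.target))
  rw [← image_chart_pos he hside, integrableOn_image_iff_integrableOn_abs_det_fderiv_smul volume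
    measurableSet_chart_pos (hasFDerivWithinAt_chart hdom) (injOn_chart he)] at h1
  refine h1.congr_fun (fun z hz => ?_) measurableSet_chart_pos
  simp only
  rw [det_fderiv_chart (hdom hz.1), abs_one, one_smul]

lemma integral_chart_half {G : Plane → ℝ} (hG : ∀ z ∉ e.source, G z = 0) :
    ∫ z in univ ×ˢ Ioi 0, G z = ∫ z in e.source ∩ {z : Plane | 0 < z.2}, G z :=
  setIntegral_eq_of_subset_of_forall_sdiff_eq_zero
    (MeasurableSet.univ.prod measurableSet_Ioi) (fun _ hz => ⟨mem_univ _, hz.2⟩)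
    fun z hz => hG z fun hs => hz.2 ⟨hs, hz.1.2⟩

/-- Local lower bound for the magnetic energy near a boundary point. -/
lemma local_lower (D : HalfLine) (P : BoundaryParam Ω) (hopen : IsOpen Ω)
    (hbdd : Bornology.IsBounded Ω) (s₀ : ℝ) {η : ℝ} (hη : 0 < η) : ∃ ρ > 0, ∃ b0 > 0, ∀ b > b0,
      ∀ v : Plane → ℂ, ContDiff ℝ 1 v → tsupport v ⊆ Metric.ball (P.γ s₀) ρ →
        (D.c ^ 2 * b ^ 2 - curvOf P.γ s₀ * D.C1 * b - η * b) * ∫ x in Ω, ‖v x‖ ^ 2 ≤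
          ∫ x in Ω, magSq (b ^ 2) F0 v x := by
  obtain ⟨ε, hε, r₁, hr₁, b0, hb0, hhalf⟩ := D.halfPlane_lower (curvOf P.γ s₀) hη
  obtain ⟨r₂, hr₂, hcmp⟩ := P.exists_chart_compare s₀ hε
  obtain ⟨e, he, ρ₀, hρ₀, hρr, hsrc, hdom, hside⟩ :=
    P.exists_chart hopen hbdd s₀ (lt_min hr₁ hr₂)
  have htgt : P.γ s₀ ∈ e.target := by
    rw [← chart_zero, ← he]
    exact e.map_source (by rw [hsrc]; exact Metric.mem_ball_self hρ₀)
  obtain ⟨ρ, hρ, hball⟩ := Metric.isOpen_iff.mp e.open_target _ htgt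
  refine ⟨ρ, hρ, b0, hb0, fun b hb v hv hvs => ?_⟩
  have hvt : tsupport v ⊆ e.target := hvs.trans hball
  have hvc : HasCompactSupport v :=
    Metric.isCompact_of_isClosed_isBounded (isClosed_tsupport v) (Metric.isBounded_ball.subset hvs)
  let V : Plane → ℂ := e.source.indicator
    fun z => Complex.exp (Complex.I * ((-(b ^ 2)) * P.gauge z : ℝ)) * v (P.chart z)
  let K : Set Plane := e.symm '' tsupport v
  have hK : IsCompact K := hvc.isCompact.image_of_continuousOn (e.continuousOn_symm.mono hvt)
  have hKS : K ⊆ e.source := by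
    rintro _ ⟨x, hx, rfl⟩; exact e.map_target (hvt hx)
  have hV0 : ∀ z ∉ K, V z = 0 := fun z hz => by
    by_cases hzs : z ∈ e.source
    · have : v (P.chart z) = 0 := by
        by_contra h
        exact hz ⟨P.chart z, subset_tsupport _ h, by rw [← he, e.left_inv hzs]⟩
      simp [V, this]
    · simp [V, hzs]
  have hVc : HasCompactSupport V :=
    HasCompactSupport.of_support_subset_isCompact hK fun z hz => by
      by_contra h; exact hz (hV0 z h)
  have hV : ContDiff ℝ 1 V := by
    refine contDiff_of_contDiffOn_of_eq_zero hK.isClosed e.open_source hKS ?_ hV0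
    refine ContDiffOn.congr (f := fun z =>
      Complex.exp (Complex.I * ((-(b ^ 2)) * P.gauge z : ℝ)) * v (P.chart z)) ?_
      (fun z hz => by simp [V, hz])
    have h1 : ContDiffOn ℝ 1 P.gauge e.source := (P.contDiffOn_gauge.of_le (by simp)).mono hdom
    have h2 : ContDiffOn ℝ 1 P.chart e.source := (P.contDiffOn_chart.of_le (by simp)).mono hdom
    have h3 : ContDiffOn ℝ 1 (fun z => v (P.chart z)) e.source := hv.comp_contDiffOn h2
    have h4 : ContDiffOn ℝ 1 (fun z => (((-(b ^ 2)) * P.gauge z : ℝ) : ℂ)) e.source :=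
      Complex.ofRealCLM.contDiff.comp_contDiffOn (contDiffOn_const.mul h1)
    exact ((contDiffOn_const.mul h4).cexp).mul h3
  have hh := hhalf b hb V hV hVc (fun z hz => by
    refine hV0 z fun hzK => ?_
    have := hKS hzK
    rw [hsrc, ← ball_prod_same] at this
    have h2 := this.2
    rw [mem_ball_zero_iff, Real.norm_eq_abs] at h2
    linarith [le_abs_self z.2, min_le_left r₁ r₂])
  have hmass : ∫ x in Ω, ‖v x‖ ^ 2 = ∫ z in univ ×ˢ Ioi 0, ‖V z‖ ^ 2 := by
    rw [integral_chart he hdom hside hopen (g := fun x => ‖v x‖ ^ 2) (fun x hx => by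
      rw [image_eq_zero_of_notMem_tsupport fun h => hx (hvt h)]; simp),
      integral_chart_half (e := e) (G := fun z => ‖V z‖ ^ 2) (fun z hz => by simp [V, hz])]
    refine setIntegral_congr_fun measurableSet_chart_pos fun z hz => ?_
    simp only [V, indicator_of_mem hz.1, norm_mul, norm_exp_I_mul_ofReal', one_mul]
  rw [hmass]
  refine hh.trans ?_
  have hmag := integrable_magSq hv hvc (b ^ 2) continuous_F0
  rw [integral_chart he hdom hside hopen (g := magSq (b ^ 2) F0 v) (fun x hx =>
    magSq_eq_zero_of_notMem (isClosed_tsupport v) (fun z hz => image_eq_zero_of_notMem_tsupport hz)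
      (fun h => hx (hvt h)) _ _)]
  have hhd := integrable_halfDensity hV hVc (-(curvOf P.γ s₀ + ε)) (curvOf P.γ s₀ - ε) b
  have hdz : ∀ z ∉ e.source,
      halfDensity (-(curvOf P.γ s₀ + ε)) (curvOf P.γ s₀ - ε) b V z = 0 := fun z hz => by
    have hzK : z ∉ K := fun h => hz (hKS h)
    simp [halfDensity, pd1, pd2, fderiv_eq_zero_of_notMem hK.isClosed hV0 hzK, hV0 z hzK]
  calc _ = ∫ z in univ ×ˢ Ioi 0,
        halfDensity (-(curvOf P.γ s₀ + ε)) (curvOf P.γ s₀ - ε) b V z := by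
        congr 1; ext z; simp only [halfDensity]; ring
    _ = ∫ z in e.source ∩ {z : Plane | 0 < z.2},
        halfDensity (-(curvOf P.γ s₀ + ε)) (curvOf P.γ s₀ - ε) b V z := integral_chart_half hdz
    _ ≤ _ := by
        refine setIntegral_mono_on hhd.integrableOn
          (integrableOn_chart he hdom hside hmag.integrableOn) measurableSet_chart_pos
          fun z hz => ?_
        have heq : (fun y => v (P.chart y)) =ᶠ[𝓝 z]
            fun y => Complex.exp (Complex.I * (b ^ 2 * P.gauge y : ℝ)) * V y := by
          filter_upwards [e.open_source.mem_nhds hz.1] with y hy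
          simp only [V, indicator_of_mem hy]
          rw [← mul_assoc, ← Complex.exp_add, ← mul_add, ← Complex.ofReal_add]
          simp
        rw [magSq_chart (hdom hz.1) (hv.differentiable one_ne_zero _)
          (hV.differentiable one_ne_zero _) heq]
        have hzb : z ∈ Metric.ball (s₀, (0 : ℝ)) r₂ :=
          Metric.ball_subset_ball (hρr.trans (min_le_right _ _)) (hsrc ▸ hz.1)
        refine le_trans (le_of_eq ?_) (hcmp z hzb hz.2 (hdom hz.1) _ _).1
        simp only [halfDensity]; ring

end BoundaryParam

end

section

lemma hasDerivAt_planeWave (χ g : ℝ → ℝ) (hχ : Differentiable ℝ χ) (hg : Differentiable ℝ g)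
    (a : ℝ) (z : Plane) :
    HasDerivAt (fun t => ((χ t * g z.2 : ℝ) : ℂ) * Complex.exp (-Complex.I * ((a * t : ℝ) : ℂ)))
      ((((deriv χ z.1 : ℝ) : ℂ) - Complex.I * ((a * χ z.1 : ℝ) : ℂ)) * (g z.2 : ℂ) *
        Complex.exp (-Complex.I * ((a * z.1 : ℝ) : ℂ))) z.1 ∧
    HasDerivAt (fun t => ((χ z.1 * g t : ℝ) : ℂ) *
        Complex.exp (-Complex.I * ((a * z.1 : ℝ) : ℂ)))
      (((χ z.1 * deriv g z.2 : ℝ) : ℂ) * Complex.exp (-Complex.I * ((a * z.1 : ℝ) : ℂ))) z.2 := by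
  have h1 := ((hχ z.1).hasDerivAt.mul_const (g z.2)).ofReal_comp
  have h2 : HasDerivAt (fun t : ℝ => Complex.exp (-Complex.I * ((a * t : ℝ) : ℂ)))
      (Complex.exp (-Complex.I * ((a * z.1 : ℝ) : ℂ)) * (-Complex.I * ((a * 1 : ℝ) : ℂ))) z.1 :=
    (((hasDerivAt_id' z.1).const_mul a).ofReal_comp.const_mul _).cexp
  have h3 := ((hg z.2).hasDerivAt.const_mul (χ z.1)).ofReal_comp
  refine ⟨(h1.fun_mul h2).congr_deriv ?_, h3.mul_const _⟩
  push_cast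
  ring

/-- Modulated product functions on the half-plane. -/
def planeWave (χ g : ℝ → ℝ) (a : ℝ) (z : Plane) : ℂ :=
  ((χ z.1 * g z.2 : ℝ) : ℂ) * Complex.exp (-Complex.I * ((a * z.1 : ℝ) : ℂ))

lemma norm_exp_neg_I_mul_ofReal (t : ℝ) : ‖Complex.exp (-Complex.I * (t : ℂ))‖ = 1 := by
  have := norm_exp_I_mul_ofReal' (-t)
  rwa [show Complex.I * ((-t : ℝ) : ℂ) = -Complex.I * (t : ℂ) by push_cast; ring] at this

lemma norm_sq_planeWave (χ g : ℝ → ℝ) (a : ℝ) (z : Plane) :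
    ‖planeWave χ g a z‖ ^ 2 = χ z.1 ^ 2 * g z.2 ^ 2 := by
  rw [planeWave, norm_mul, norm_exp_neg_I_mul_ofReal, mul_one, Complex.norm_real,
    Real.norm_eq_abs, sq_abs, mul_pow]

lemma contDiff_planeWave {χ g : ℝ → ℝ} (hχ : ContDiff ℝ 1 χ) (hg : ContDiff ℝ 1 g) (a : ℝ) :
    ContDiff ℝ 1 (planeWave χ g a) := by
  have h1 : ContDiff ℝ 1 fun z : Plane => ((χ z.1 * g z.2 : ℝ) : ℂ) :=
    Complex.ofRealCLM.contDiff.comp ((hχ.comp contDiff_fst).mul (hg.comp contDiff_snd))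
  have h2 : ContDiff ℝ 1 fun z : Plane => ((a * z.1 : ℝ) : ℂ) :=
    Complex.ofRealCLM.contDiff.comp (contDiff_const.mul contDiff_fst)
  exact h1.mul (contDiff_const.mul h2).cexp

lemma halfDensity_planeWave {χ g : ℝ → ℝ} (hχ : ContDiff ℝ 1 χ) (hg : ContDiff ℝ 1 g)
    (a w1 w2 b : ℝ) (z : Plane) :
    halfDensity w1 w2 b (planeWave χ g a) z =
      χ z.1 ^ 2 * ((1 + 2 * w1 * z.2) * deriv g z.2 ^ 2 +
        (1 + 2 * w2 * z.2) * ((b ^ 2 * z.2 - a) ^ 2 * g z.2 ^ 2)) +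
      deriv χ z.1 ^ 2 * ((1 + 2 * w2 * z.2) * g z.2 ^ 2) := by
  obtain ⟨h1, h2⟩ := hasDerivAt_planeWave χ g (hχ.differentiable one_ne_zero)
    (hg.differentiable one_ne_zero) a z
  have hd : DifferentiableAt ℝ (planeWave χ g a) (z.1, z.2) :=
    (contDiff_planeWave hχ hg a).differentiable one_ne_zero _
  have e1 := (hasDerivAt_pd1 hd).unique h1
  have e2 := (hasDerivAt_pd2 hd).unique h2
  have n2 : ‖pd2 (planeWave χ g a) z‖ ^ 2 = χ z.1 ^ 2 * deriv g z.2 ^ 2 := by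
    rw [e2, norm_mul, norm_exp_neg_I_mul_ofReal, mul_one, Complex.norm_real, Real.norm_eq_abs,
      sq_abs, mul_pow]
  have n1 : ‖-Complex.I * pd1 (planeWave χ g a) z + ((b ^ 2 * z.2 : ℝ) : ℂ) * planeWave χ g a z‖ ^ 2
      = (deriv χ z.1 * g z.2) ^ 2 + ((b ^ 2 * z.2 - a) * (χ z.1 * g z.2)) ^ 2 := by
    have : -Complex.I * pd1 (planeWave χ g a) z + ((b ^ 2 * z.2 : ℝ) : ℂ) * planeWave χ g a z =
        ((((b ^ 2 * z.2 - a) * (χ z.1 * g z.2) : ℝ) : ℂ) +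
          ((-(deriv χ z.1 * g z.2) : ℝ) : ℂ) * Complex.I) *
          Complex.exp (-Complex.I * ((a * z.1 : ℝ) : ℂ)) := by
      rw [e1, planeWave]
      push_cast
      linear_combination (a * χ z.1 * g z.2 * Complex.exp (-Complex.I * (a * z.1)) : ℂ) *
        Complex.I_sq
    rw [this, norm_mul, norm_exp_neg_I_mul_ofReal, mul_one, Complex.sq_norm,
      Complex.normSq_add_mul_I]
    ring
  rw [halfDensity, n1, n2]
  ring

lemma integral_halfDensity_planeWave {χ g : ℝ → ℝ} (hχ : ContDiff ℝ 1 χ) (hg : ContDiff ℝ 1 g)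
    (hχc : HasCompactSupport χ) (hgc : HasCompactSupport g) (a w1 w2 b : ℝ) {Λ : ℝ}
    (hΛ : ∫ s, deriv χ s ^ 2 = Λ * ∫ s, χ s ^ 2) :
    ∫ z in univ ×ˢ Ioi 0, halfDensity w1 w2 b (planeWave χ g a) z =
      (∫ s, χ s ^ 2) * ∫ x in Ioi 0, ((1 + 2 * w1 * x) * deriv g x ^ 2 +
        (1 + 2 * w2 * x) * (((b ^ 2 * x - a) ^ 2 + Λ) * g x ^ 2)) := by
  have hχ' := hχ.continuous_deriv le_rfl
  have hg' := hg.continuous_deriv le_rfl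
  have hχ0 := hχ.continuous
  have hg0 := hg.continuous
  have i1 : Integrable fun s => χ s ^ 2 :=
    (by fun_prop : Continuous fun s => χ s ^ 2).integrable_of_hasCompactSupport
      (hχc.mono fun s hs => by contrapose! hs; simp [Function.notMem_support.mp hs])
  have i2 : Integrable fun s => deriv χ s ^ 2 :=
    (by fun_prop : Continuous fun s => deriv χ s ^ 2).integrable_of_hasCompactSupport
      (hχc.deriv.mono fun s hs => by contrapose! hs; simp [Function.notMem_support.mp hs])
  have hs0 : ∀ x ∉ tsupport g, g x = 0 := fun x hx => image_eq_zero_of_notMem_tsupport hx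
  have hs1 : ∀ x ∉ tsupport g, deriv g x = 0 := fun x hx => by
    by_contra h; exact hx (support_deriv_subset h)
  have i3 : Integrable fun x => (1 + 2 * w1 * x) * deriv g x ^ 2 +
      (1 + 2 * w2 * x) * ((b ^ 2 * x - a) ^ 2 * g x ^ 2) :=
    Continuous.integrable_of_hasCompactSupport (by fun_prop)
      (hgc.mono' fun x hx => by by_contra h; simp [hs0 x h, hs1 x h] at hx)
  have i4 : Integrable fun x => (1 + 2 * w2 * x) * g x ^ 2 :=
    Continuous.integrable_of_hasCompactSupport (by fun_prop)
      (hgc.mono' fun x hx => by by_contra h; simp [hs0 x h] at hx)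
  have hprod : (volume : Measure Plane) = (volume : Measure ℝ).prod volume := rfl
  rw [setIntegral_congr_fun (MeasurableSet.univ.prod measurableSet_Ioi)
    fun z _ => halfDensity_planeWave hχ hg a w1 w2 b z, hprod,
    integral_add (i1.mul_prod i3).integrableOn (i2.mul_prod i4).integrableOn,
    setIntegral_prod_mul (fun s => χ s ^ 2) (fun x => (1 + 2 * w1 * x) * deriv g x ^ 2 +
      (1 + 2 * w2 * x) * ((b ^ 2 * x - a) ^ 2 * g x ^ 2)),
    setIntegral_prod_mul (fun s => deriv χ s ^ 2) (fun x => (1 + 2 * w2 * x) * g x ^ 2)]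
  simp only [setIntegral_univ]
  rw [hΛ, mul_comm Λ, mul_assoc, ← mul_add, ← integral_const_mul,
    ← integral_add i3.integrableOn (i4.const_mul Λ).integrableOn]
  congr 2
  ext x
  ring

namespace BoundaryParam
variable {Ω : Set Plane} {P : BoundaryParam Ω} {e : OpenPartialHomeomorph Plane Plane}

lemma exists_trial_upper (D : HalfLine) (P : BoundaryParam Ω) (hopen : IsOpen Ω)
    (hbdd : Bornology.IsBounded Ω) (s₀ : ℝ) {η : ℝ} (hη : 0 < η) : ∃ b0 > 0, ∀ b > b0,
      ∃ v : Plane → ℂ, ContDiff ℝ 1 v ∧ HasCompactSupport v ∧ 0 < ∫ x in Ω, ‖v x‖ ^ 2 ∧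
        ∫ x in Ω, magSq (b ^ 2) F0 v x ≤
        (D.c ^ 2 * b ^ 2 - curvOf P.γ s₀ * D.C1 * b + η * b) * ∫ x in Ω, ‖v x‖ ^ 2 := by
  obtain ⟨ε, hε, htrial⟩ := D.exists_trial (curvOf P.γ s₀) hη
  obtain ⟨r₂, hr₂, hcmp⟩ := P.exists_chart_compare s₀ hε
  obtain ⟨e, he, ρ₀, hρ₀, hρr, hsrc, hdom, hside⟩ := P.exists_chart hopen hbdd s₀ hr₂
  let χb : ContDiffBump s₀ := ⟨ρ₀ / 4, ρ₀ / 2, by linarith, by linarith⟩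
  let χ : ℝ → ℝ := χb
  have hχ : ContDiff ℝ 1 χ := χb.contDiff
  have hχc : HasCompactSupport χ := χb.hasCompactSupport
  have hχpos : 0 < ∫ s, χ s ^ 2 := by
    have hc : Continuous fun s => χ s ^ 2 := by have := hχ.continuous; fun_prop
    have hcs : HasCompactSupport fun s => χ s ^ 2 :=
      hχc.mono fun s hs => by contrapose! hs; simp [Function.notMem_support.mp hs]
    refine hc.integral_pos_of_hasCompactSupport_nonneg_nonzero hcs (fun s => sq_nonneg _)
      (x := s₀) ?_
    have : χ s₀ = 1 := χb.one_of_mem_closedBall (by simp; positivity)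
    simp [this]
  obtain ⟨b0, hb0, htr⟩ := htrial (min ρ₀ 1) (by positivity) (min_le_right _ _)
    ((∫ s, deriv χ s ^ 2) / ∫ s, χ s ^ 2)
    (div_nonneg (integral_nonneg fun s => sq_nonneg _) hχpos.le)
  refine ⟨b0, hb0, fun b hb => ?_⟩
  obtain ⟨g, hg, hgs, hgpos, hgle⟩ := htr b hb
  have hgc : HasCompactSupport g :=
    Metric.isCompact_of_isClosed_isBounded (isClosed_tsupport g) (Metric.isBounded_ball.subset hgs)
  let V : Plane → ℂ := planeWave χ g (D.c * b)
  have hV : ContDiff ℝ 1 V := contDiff_planeWave hχ hg _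
  let K : Set Plane := tsupport χ ×ˢ tsupport g
  have hK : IsCompact K := hχc.isCompact.prod hgc.isCompact
  have hKS : K ⊆ e.source := by
    rintro ⟨s, x⟩ ⟨h1, h2⟩
    rw [hsrc, ← ball_prod_same]
    refine ⟨?_, Metric.ball_subset_ball (min_le_left _ _) (hgs h2)⟩
    have h3 : s ∈ Metric.closedBall s₀ (ρ₀ / 2) := by rw [← χb.tsupport_eq]; exact h1
    exact Metric.closedBall_subset_ball (by linarith) h3
  have hV0 : ∀ z ∉ K, V z = 0 := fun z hz => by
    by_cases h1 : z.1 ∈ tsupport χ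
    · have h2 : z.2 ∉ tsupport g := fun h2 => hz ⟨h1, h2⟩
      simp [V, planeWave, image_eq_zero_of_notMem_tsupport h2]
    · simp [V, planeWave, image_eq_zero_of_notMem_tsupport h1]
  have hVc : HasCompactSupport V :=
    HasCompactSupport.of_support_subset_isCompact hK fun z hz => by
      by_contra h; exact hz (hV0 z h)
  let v : Plane → ℂ := e.target.indicator
    fun x => Complex.exp (Complex.I * (b ^ 2 * P.gauge (e.symm x) : ℝ)) * V (e.symm x)
  let K' : Set Plane := e '' K
  have hK' : IsCompact K' := hK.image_of_continuousOn (e.continuousOn.mono hKS)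
  have hKT : K' ⊆ e.target := by
    rintro _ ⟨x, hx, rfl⟩; exact e.map_source (hKS hx)
  have hv0 : ∀ x ∉ K', v x = 0 := fun x hx => by
    by_cases hxt : x ∈ e.target
    · have : V (e.symm x) = 0 := by
        by_contra h
        exact hx ⟨e.symm x, by by_contra hk; exact h (hV0 _ hk), e.right_inv hxt⟩
      simp [v, this]
    · simp [v, hxt]
  have hvc : HasCompactSupport v :=
    HasCompactSupport.of_support_subset_isCompact hK' fun z hz => by
      by_contra h; exact hz (hv0 z h)
  have hsm : ContDiffOn ℝ 1 e.symm e.target := (contDiffOn_chart_symm he hdom).of_le (by simp)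
  have hv : ContDiff ℝ 1 v := by
    refine contDiff_of_contDiffOn_of_eq_zero hK'.isClosed e.open_target hKT ?_ hv0
    refine ContDiffOn.congr (f := fun x =>
      Complex.exp (Complex.I * (b ^ 2 * P.gauge (e.symm x) : ℝ)) * V (e.symm x)) ?_
      (fun z hz => by simp [v, hz])
    have h1 : ContDiffOn ℝ 1 (fun x => P.gauge (e.symm x)) e.target :=
      ((P.contDiffOn_gauge.of_le (by simp)).mono hdom).comp hsm e.mapsTo_symm
    have h4 : ContDiffOn ℝ 1 (fun x => ((b ^ 2 * P.gauge (e.symm x) : ℝ) : ℂ)) e.target :=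
      Complex.ofRealCLM.contDiff.comp_contDiffOn (contDiffOn_const.mul h1)
    exact ((contDiffOn_const.mul h4).cexp).mul (hV.comp_contDiffOn hsm)
  have hvch : ∀ z ∈ e.source, v (P.chart z) =
      Complex.exp (Complex.I * (b ^ 2 * P.gauge z : ℝ)) * V z := fun z hz => by
    simp only [v, ← he z, indicator_of_mem (e.map_source hz), e.left_inv hz]
  have hmass : ∫ x in Ω, ‖v x‖ ^ 2 = (∫ s, χ s ^ 2) * ∫ x in Ioi 0, g x ^ 2 := by
    rw [integral_chart he hdom hside hopen (g := fun x => ‖v x‖ ^ 2) (fun x hx => by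
      rw [hv0 x fun h => hx (hKT h)]; simp)]
    have h1 : ∫ z in e.source ∩ {z : Plane | 0 < z.2}, ‖v (P.chart z)‖ ^ 2 =
        ∫ z in e.source ∩ {z : Plane | 0 < z.2}, ‖V z‖ ^ 2 :=
      setIntegral_congr_fun measurableSet_chart_pos fun z hz => by
        simp only [hvch z hz.1, norm_mul, norm_exp_I_mul_ofReal', one_mul]
    rw [h1, ← integral_chart_half (e := e) (G := fun z => ‖V z‖ ^ 2)
      (fun z hz => by simp [hV0 z fun h => hz (hKS h)])]
    simp only [V, norm_sq_planeWave]
    have := setIntegral_prod_mul (μ := (volume : Measure ℝ)) (ν := (volume : Measure ℝ))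
      (fun s => χ s ^ 2) (fun x => g x ^ 2) univ (Ioi 0)
    rw [setIntegral_univ] at this
    exact this
  refine ⟨v, hv, hvc, by rw [hmass]; positivity, ?_⟩
  have hmag := integrable_magSq hv hvc (b ^ 2) continuous_F0
  rw [integral_chart he hdom hside hopen (g := magSq (b ^ 2) F0 v) (fun x hx =>
    magSq_eq_zero_of_notMem hK'.isClosed hv0 (fun h => hx (hKT h)) _ _), hmass]
  have hhd := integrable_halfDensity hV hVc (-(curvOf P.γ s₀ - ε)) (curvOf P.γ s₀ + ε) b
  have hdz : ∀ z ∉ e.source,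
      halfDensity (-(curvOf P.γ s₀ - ε)) (curvOf P.γ s₀ + ε) b V z = 0 := fun z hz => by
    have hzK : z ∉ K := fun h => hz (hKS h)
    simp [halfDensity, pd1, pd2, fderiv_eq_zero_of_notMem hK.isClosed hV0 hzK, hV0 z hzK]
  calc _ ≤ ∫ z in e.source ∩ {z : Plane | 0 < z.2},
        halfDensity (-(curvOf P.γ s₀ - ε)) (curvOf P.γ s₀ + ε) b V z := by
        refine setIntegral_mono_on (integrableOn_chart he hdom hside hmag.integrableOn)
          hhd.integrableOn measurableSet_chart_pos fun z hz => ?_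
        have heq : (fun y => v (P.chart y)) =ᶠ[𝓝 z]
            fun y => Complex.exp (Complex.I * (b ^ 2 * P.gauge y : ℝ)) * V y := by
          filter_upwards [e.open_source.mem_nhds hz.1] with y hy using hvch y hy
        rw [magSq_chart (hdom hz.1) (hv.differentiable one_ne_zero _)
          (hV.differentiable one_ne_zero _) heq]
        have hzb : z ∈ Metric.ball (s₀, (0 : ℝ)) r₂ :=
          Metric.ball_subset_ball hρr (hsrc ▸ hz.1)
        refine (hcmp z hzb hz.2 (hdom hz.1) _ _).2.trans (le_of_eq ?_)
        simp only [halfDensity]; ring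
    _ = ∫ z in univ ×ˢ Ioi 0,
        halfDensity (-(curvOf P.γ s₀ - ε)) (curvOf P.γ s₀ + ε) b V z :=
        (integral_chart_half hdz).symm
    _ = _ := integral_halfDensity_planeWave hχ hg hχc hgc _ _ _ _
        (div_mul_cancel₀ _ hχpos.ne').symm
    _ ≤ _ := by
        rw [mul_left_comm]
        refine mul_le_mul_of_nonneg_left (le_trans (le_of_eq ?_) hgle) hχpos.le
        congr 1; ext x; ring

end BoundaryParam

end

section

open scoped Manifold

lemma exists_cutoff {K U : Set Plane} (hK : IsClosed K) (hU : IsOpen U) (hKU : K ⊆ U) :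
    ∃ χ : Plane → ℝ, ContDiff ℝ (⊤ : ℕ∞) χ ∧ (∀ x ∈ K, χ x = 1) ∧ tsupport χ ⊆ U ∧
      ∀ x, χ x ∈ Icc 0 1 := by
  obtain ⟨f, h0, h1, hf⟩ := exists_contMDiffMap_zero_one_nhds_of_isClosed 𝓘(ℝ, Plane)
    (s := Uᶜ) (t := K) (n := ⊤) hU.isClosed_compl hK
    (disjoint_left.mpr fun x hx hxK => hx (hKU hxK))
  refine ⟨f, f.contMDiff.contDiff, fun x hx => h1.self_of_nhdsSet x hx, fun x hx => ?_, hf⟩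
  by_contra hxU
  have h2 : ∀ᶠ y in 𝓝 x, f y = 0 := h0.filter_mono (nhds_le_nhdsSet hxU)
  exact (notMem_tsupport_iff_eventuallyEq.mpr h2) hx

/-- The squared Euclidean length of the gradient. -/
def gradSq (χ : Plane → ℝ) (x : Plane) : ℝ :=
  fderiv ℝ χ x (1, 0) ^ 2 + fderiv ℝ χ x (0, 1) ^ 2

lemma gradSq_nonneg (χ : Plane → ℝ) (x : Plane) : 0 ≤ gradSq χ x := by
  unfold gradSq; positivity

lemma continuous_gradSq {χ : Plane → ℝ} (hχ : ContDiff ℝ 1 χ) : Continuous (gradSq χ) := by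
  have h := hχ.continuous_fderiv one_ne_zero
  unfold gradSq
  fun_prop

lemma fderiv_ofReal_mul {f : Plane → ℝ} {u : Plane → ℂ} {x : Plane}
    (hf : DifferentiableAt ℝ f x) (hu : DifferentiableAt ℝ u x) (w : Plane) :
    fderiv ℝ (fun y => (f y : ℂ) * u y) x w =
      (f x : ℂ) * fderiv ℝ u x w + (fderiv ℝ f x w : ℂ) * u x := by
  have h1 : HasFDerivAt (fun y => (f y : ℂ)) (Complex.ofRealCLM.comp (fderiv ℝ f x)) x :=
    Complex.ofRealCLM.hasFDerivAt.comp x hf.hasFDerivAt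
  rw [(h1.fun_mul hu.hasFDerivAt).fderiv]
  simp
  ring

lemma magSq_ofReal_mul {f : Plane → ℝ} {u : Plane → ℂ} {x : Plane}
    (hf : DifferentiableAt ℝ f x) (hu : DifferentiableAt ℝ u x) (B : ℝ) (A : Plane → Plane) :
    magSq B A (fun y => (f y : ℂ) * u y) x =
      ‖(f x : ℂ) * (-Complex.I * fderiv ℝ u x (1, 0) - ((B * (A x).1 : ℝ) : ℂ) * u x) -
        Complex.I * (fderiv ℝ f x (1, 0) : ℂ) * u x‖ ^ 2 +
      ‖(f x : ℂ) * (-Complex.I * fderiv ℝ u x (0, 1) - ((B * (A x).2 : ℝ) : ℂ) * u x) -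
        Complex.I * (fderiv ℝ f x (0, 1) : ℂ) * u x‖ ^ 2 := by
  rw [magSq, fderiv_ofReal_mul hf hu, fderiv_ofReal_mul hf hu]
  congr 3 <;> ring

lemma localization_scalar (a z : ℂ) (t d τ : ℝ) :
    ‖((1 - τ * t ^ 2 : ℝ) : ℂ) * a - Complex.I * ((-(τ * (2 * t * d)) : ℝ) : ℂ) * z‖ ^ 2 ≤
      ‖a‖ ^ 2 - 2 * τ * (‖(t : ℂ) * a - Complex.I * (d : ℂ) * z‖ ^ 2 - d ^ 2 * ‖z‖ ^ 2) +
        τ ^ 2 * (2 * t ^ 4 * ‖a‖ ^ 2 + 8 * t ^ 2 * d ^ 2 * ‖z‖ ^ 2) := by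
  have h := mul_nonneg (sq_nonneg τ) (add_nonneg (sq_nonneg (t ^ 2 * a.re - 2 * t * d * z.im))
    (sq_nonneg (t ^ 2 * a.im + 2 * t * d * z.re)))
  simp only [Complex.sq_norm, Complex.normSq_apply, Complex.sub_re, Complex.sub_im,
    Complex.mul_re, Complex.mul_im, Complex.ofReal_re, Complex.ofReal_im, Complex.I_re,
    Complex.I_im]
  linarith only [h]

lemma localization_pointwise {χ : Plane → ℝ} {u : Plane → ℂ} {x : Plane}
    (hχ : DifferentiableAt ℝ χ x) (hu : DifferentiableAt ℝ u x) (B τ : ℝ) (A : Plane → Plane) :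
    magSq B A (fun y => ((1 - τ * χ y ^ 2 : ℝ) : ℂ) * u y) x ≤
      magSq B A u x - 2 * τ * (magSq B A (fun y => (χ y : ℂ) * u y) x - gradSq χ x * ‖u x‖ ^ 2) +
        τ ^ 2 * (2 * χ x ^ 4 * magSq B A u x + 8 * χ x ^ 2 * gradSq χ x * ‖u x‖ ^ 2) := by
  have hf : HasFDerivAt (fun y => 1 - τ * χ y ^ 2) (-(τ • ((2 * χ x) • fderiv ℝ χ x))) x := by
    have := ((hχ.hasFDerivAt.pow 2).const_mul τ).const_sub 1
    refine this.congr_fderiv ?_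
    ext <;> simp
  rw [magSq_ofReal_mul hf.differentiableAt hu, magSq_ofReal_mul hχ hu, hf.fderiv, magSq, gradSq]
  have h1 := localization_scalar (-Complex.I * fderiv ℝ u x (1, 0) - ((B * (A x).1 : ℝ) : ℂ) * u x)
    (u x) (χ x) (fderiv ℝ χ x (1, 0)) τ
  have h2 := localization_scalar (-Complex.I * fderiv ℝ u x (0, 1) - ((B * (A x).2 : ℝ) : ℂ) * u x)
    (u x) (χ x) (fderiv ℝ χ x (0, 1)) τ
  simp only [_root_.neg_apply, _root_.smul_apply, smul_eq_mul]
  linarith only [h1, h2]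

/-- The squared `L²` norm over `Ω`. -/
def mass (Ω : Set Plane) (u : Plane → ℂ) : ℝ := ∫ x in Ω, ‖u x‖ ^ 2

/-- The magnetic energy over `Ω`, with potential `F₀`. -/
def energy (Ω : Set Plane) (B : ℝ) (u : Plane → ℂ) : ℝ := ∫ x in Ω, magSq B F0 u x

lemma integrableOn_of_continuous {Ω : Set Plane} (hbdd : Bornology.IsBounded Ω) {f : Plane → ℝ}
    (hf : Continuous f) : IntegrableOn f Ω :=
  (hf.continuousOn.integrableOn_compact hbdd.isCompact_closure).mono_set subset_closure

variable {Ω : Set Plane}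

lemma sum_integral_nonneg (hopen : IsOpen Ω) {n : ℕ} (a : Fin n → ℝ) (f : Fin n → Plane → ℝ)
    (hf : ∀ i, IntegrableOn (f i) Ω) (h : ∀ x ∈ Ω, 0 ≤ ∑ i, a i * f i x) :
    0 ≤ ∑ i, a i * ∫ x in Ω, f i x := by
  simp only [← integral_const_mul]
  rw [← integral_finsetSum _ fun i _ => (hf i).const_mul (a i)]
  exact setIntegral_nonneg hopen.measurableSet h

lemma mass_nonneg (u : Plane → ℂ) : 0 ≤ mass Ω u := integral_nonneg fun _ => sq_nonneg _

lemma energy_nonneg (B : ℝ) (u : Plane → ℂ) : 0 ≤ energy Ω B u :=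
  integral_nonneg fun _ => magSq_nonneg _ _ _ _

lemma lam1_nonneg (B : ℝ) : 0 ≤ lam1 Ω B := by
  refine Real.sInf_nonneg ?_
  rintro _ ⟨u, -, -, rfl⟩
  exact div_nonneg (energy_nonneg B u) (mass_nonneg u)

lemma cNearCl_of_contDiff {u : Plane → ℂ} (hu : ContDiff ℝ 1 u) : CNearCl 1 Ω u :=
  ⟨univ, isOpen_univ, subset_univ _, by exact_mod_cast hu.contDiffOn⟩

lemma lam1_mul_mass_le {u : Plane → ℂ} (hu : ContDiff ℝ 1 u) (B : ℝ) :
    lam1 Ω B * mass Ω u ≤ energy Ω B u := by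
  rcases (mass_nonneg (Ω := Ω) u).eq_or_lt with h | h
  · rw [← h, mul_zero]; exact energy_nonneg B u
  · rw [← le_div_iff₀ h]
    refine csInf_le ⟨0, ?_⟩ ⟨u, cNearCl_of_contDiff hu, h.ne', rfl⟩
    rintro _ ⟨u, -, -, rfl⟩
    exact div_nonneg (energy_nonneg B u) (mass_nonneg u)

lemma mass_const_mul (c : ℝ) (u : Plane → ℂ) :
    mass Ω (fun x => (c : ℂ) * u x) = c ^ 2 * mass Ω u := by
  simp only [mass, norm_mul, mul_pow, Complex.norm_real, Real.norm_eq_abs, sq_abs,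
    integral_const_mul]

lemma energy_const_mul (B c : ℝ) {u : Plane → ℂ} (hu : ContDiff ℝ 1 u) :
    energy Ω B (fun x => (c : ℂ) * u x) = c ^ 2 * energy Ω B u := by
  simp only [energy]
  rw [← integral_const_mul]
  congr 1
  ext x
  rw [magSq_ofReal_mul (f := fun _ => c) (differentiableAt_const c)
    (hu.differentiable one_ne_zero x)]
  simp only [fderiv_fun_const, Pi.zero_apply, _root_.zero_apply, Complex.ofReal_zero,
    mul_zero, zero_mul, sub_zero, norm_mul, mul_pow, Complex.norm_real, Real.norm_eq_abs, sq_abs,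
    magSq]
  ring

lemma exists_quasi_min (hopen : IsOpen Ω) (hbdd : Bornology.IsBounded Ω) (hne : Ω.Nonempty)
    (B : ℝ) {δ : ℝ} (hδ : 0 < δ) : ∃ u : Plane → ℂ, ContDiff ℝ 1 u ∧ mass Ω u = 1 ∧
      energy Ω B u ≤ lam1 Ω B + δ := by
  have hvol : 0 < volume.real Ω :=
    ENNReal.toReal_pos (hopen.measure_pos volume hne).ne' hbdd.measure_lt_top.ne
  obtain ⟨r, ⟨u, ⟨U, hU, hΩU, hu⟩, hm, rfl⟩, hr⟩ := exists_lt_of_csInf_lt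
    (s := { r : ℝ | ∃ u : Plane → ℂ, CNearCl 1 Ω u ∧ (∫ x in Ω, ‖u x‖ ^ 2) ≠ 0 ∧
      r = (∫ x in Ω, magSq B F0 u x) / (∫ x in Ω, ‖u x‖ ^ 2) })
    ⟨_, fun _ => 1, cNearCl_of_contDiff contDiff_const, by simp [hvol.ne'], rfl⟩
    (lt_add_of_pos_right (lam1 Ω B) hδ)
  obtain ⟨χ, hχ, h1, hs, -⟩ := exists_cutoff isClosed_closure hU hΩU
  let w : Plane → ℂ := fun x => (χ x : ℂ) * u x
  have hw : ContDiff ℝ 1 w := by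
    refine contDiff_of_contDiffOn_of_eq_zero (isClosed_tsupport χ) hU hs ?_ fun z hz => by
      simp [w, image_eq_zero_of_notMem_tsupport hz]
    exact (Complex.ofRealCLM.contDiff.comp (hχ.of_le (by norm_cast))).contDiffOn.mul
      (by exact_mod_cast hu)
  have hwe : ∀ x ∈ Ω, w =ᶠ[𝓝 x] u := fun x hx => by
    filter_upwards [hopen.mem_nhds hx] with y hy
    simp [w, h1 y (subset_closure hy)]
  have hwm : mass Ω w = mass Ω u :=
    setIntegral_congr_fun hopen.measurableSet fun x hx => by simp only [(hwe x hx).self_of_nhds]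
  have hwen : energy Ω B w = energy Ω B u :=
    setIntegral_congr_fun hopen.measurableSet fun x hx => by
      simp only [magSq, (hwe x hx).self_of_nhds, (hwe x hx).fderiv_eq]
  have hpos : 0 < mass Ω u := lt_of_le_of_ne (mass_nonneg u) (Ne.symm hm)
  have hsq : (Real.sqrt (mass Ω u))⁻¹ ^ 2 = (mass Ω u)⁻¹ := by
    rw [inv_pow, Real.sq_sqrt hpos.le]
  refine ⟨fun x => (((Real.sqrt (mass Ω u))⁻¹ : ℝ) : ℂ) * w x, contDiff_const.mul hw, ?_, ?_⟩
  · rw [mass_const_mul, hwm, hsq, inv_mul_cancel₀ hpos.ne']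
  · rw [energy_const_mul B _ hw, hwen, hsq, inv_mul_eq_div]
    exact hr.le

lemma localization_integral (hbdd : Bornology.IsBounded Ω) (hopen : IsOpen Ω) {χ : Plane → ℝ}
    {u : Plane → ℂ} (hχ : ContDiff ℝ 1 χ) (hu : ContDiff ℝ 1 u) (B τ : ℝ) {M : ℝ} 
    (hM : ∀ x ∈ Ω, 2 * χ x ^ 4 ≤ M ∧ 8 * χ x ^ 2 * gradSq χ x ≤ M) :
    2 * τ * (energy Ω B (fun y => (χ y : ℂ) * u y) - lam1 Ω B * mass Ω (fun y => (χ y : ℂ) * u y) -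
      ∫ x in Ω, gradSq χ x * ‖u x‖ ^ 2) ≤
    energy Ω B u - lam1 Ω B * mass Ω u + τ ^ 2 * M * (energy Ω B u + mass Ω u) := by
  have hf : ContDiff ℝ 1 fun y => 1 - τ * χ y ^ 2 := by fun_prop
  have hcu := hu.continuous
  have hcχ := hχ.continuous
  have hχu : ContDiff ℝ 1 fun y => (χ y : ℂ) * u y := (Complex.ofRealCLM.contDiff.comp hχ).mul hu
  have hfu : ContDiff ℝ 1 fun y => ((1 - τ * χ y ^ 2 : ℝ) : ℂ) * u y :=
    (Complex.ofRealCLM.contDiff.comp hf).mul hu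
  have c1 := continuous_magSq hu B continuous_F0
  have c2 := continuous_magSq hχu B continuous_F0
  have c3 := continuous_magSq hfu B continuous_F0
  have c4 := continuous_gradSq hχ
  have h0 := lam1_mul_mass_le (Ω := Ω) hfu B
  have key : energy Ω B (fun y => ((1 - τ * χ y ^ 2 : ℝ) : ℂ) * u y) -
      lam1 Ω B * mass Ω (fun y => ((1 - τ * χ y ^ 2 : ℝ) : ℂ) * u y) ≤
      energy Ω B u - lam1 Ω B * mass Ω u - 2 * τ * (energy Ω B (fun y => (χ y : ℂ) * u y) -
        lam1 Ω B * mass Ω (fun y => (χ y : ℂ) * u y) - ∫ x in Ω, gradSq χ x * ‖u x‖ ^ 2) +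
        τ ^ 2 * M * (energy Ω B u + mass Ω u) := by
    have I := fun {f : Plane → ℝ} (hf : Continuous f) => integrableOn_of_continuous hbdd hf
    have i1 := I c1
    have i2 := I c2
    have i3 := I c3
    have i4 : IntegrableOn (fun x => gradSq χ x * ‖u x‖ ^ 2) Ω := I (by fun_prop)
    have i5 : IntegrableOn (fun x => ‖u x‖ ^ 2) Ω := I (by fun_prop)
    have i6 : IntegrableOn (fun x => ‖(χ x : ℂ) * u x‖ ^ 2) Ω := I (by fun_prop)
    have i7 : IntegrableOn (fun x => ‖((1 - τ * χ x ^ 2 : ℝ) : ℂ) * u x‖ ^ 2) Ω := I (by fun_prop)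
    have hsum := sum_integral_nonneg hopen
      ![1 + τ ^ 2 * M, -(lam1 Ω B) + τ ^ 2 * M, -2 * τ, 2 * τ * lam1 Ω B, 2 * τ, -1, lam1 Ω B]
      ![magSq B F0 u, fun x => ‖u x‖ ^ 2, magSq B F0 fun y => (χ y : ℂ) * u y,
        fun x => ‖(χ x : ℂ) * u x‖ ^ 2, fun x => gradSq χ x * ‖u x‖ ^ 2,
        magSq B F0 fun y => ((1 - τ * χ y ^ 2 : ℝ) : ℂ) * u y,
        fun x => ‖((1 - τ * χ x ^ 2 : ℝ) : ℂ) * u x‖ ^ 2]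
      (fun i => by fin_cases i <;> assumption) (fun x hx => ?_)
    · simp only [Fin.sum_univ_succ, Fin.sum_univ_zero, Matrix.cons_val_zero,
        Matrix.cons_val_succ] at hsum
      simp only [energy, mass]
      linarith only [hsum]
    have hp := localization_pointwise (hχ.differentiable one_ne_zero x)
      (hu.differentiable one_ne_zero x) B τ F0
    obtain ⟨m1, m2⟩ := hM x hx
    have q1 := mul_le_mul_of_nonneg_left (mul_le_mul_of_nonneg_right m1 (magSq_nonneg B F0 u x))
      (sq_nonneg τ)
    have q2 := mul_le_mul_of_nonneg_left (mul_le_mul_of_nonneg_right m2 (sq_nonneg ‖u x‖))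
      (sq_nonneg τ)
    have q3 := mul_nonneg (lam1_nonneg (Ω := Ω) B) (mul_nonneg (sq_nonneg (τ * χ x ^ 2))
      (sq_nonneg ‖u x‖))
    simp only [Fin.sum_univ_succ, Fin.sum_univ_zero, Matrix.cons_val_zero, Matrix.cons_val_succ,
      norm_mul, mul_pow, Complex.norm_real, Real.norm_eq_abs, sq_abs]
    linarith only [hp, q1, q2, q3]
  linarith only [h0, key]

/-- Approximate Euler-Lagrange identity: multiplying a quasi-minimizer by a cutoff function. -/
lemma quasi_min_localization (hbdd : Bornology.IsBounded Ω) (hopen : IsOpen Ω) {χ : Plane → ℝ}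
    (hχ : ContDiff ℝ 1 χ) (B : ℝ) {ω : ℝ} (hω : 0 < ω) : ∃ δ₀ > 0, ∀ u : Plane → ℂ,
      ContDiff ℝ 1 u → mass Ω u = 1 → energy Ω B u ≤ lam1 Ω B + δ₀ →
      energy Ω B (fun y => (χ y : ℂ) * u y) ≤ lam1 Ω B * mass Ω (fun y => (χ y : ℂ) * u y) +
        (∫ x in Ω, gradSq χ x * ‖u x‖ ^ 2) + ω := by
  have c0 := hχ.continuous
  have c1 := continuous_gradSq hχ
  obtain ⟨M, hM⟩ := hbdd.isCompact_closure.exists_bound_of_continuousOn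
    (f := fun x => 2 * χ x ^ 4 + 8 * χ x ^ 2 * gradSq χ x)
    (by fun_prop : Continuous fun x => 2 * χ x ^ 4 + 8 * χ x ^ 2 * gradSq χ x).continuousOn
  have hl := lam1_nonneg (Ω := Ω) B
  let S := (|M| + 1) * (lam1 Ω B + 2)
  have hS : 0 < S := by positivity
  refine ⟨min 1 (ω ^ 2 / S), by positivity, fun u hu hm he => ?_⟩
  have h := localization_integral hbdd hopen hχ hu B (ω / S) (M := |M| + 1) fun x hx => by
    have h1 := (le_abs_self _).trans ((hM x (subset_closure hx)).trans (le_abs_self M))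
    have h2 : 0 ≤ 8 * χ x ^ 2 * gradSq χ x := mul_nonneg (by positivity) (gradSq_nonneg _ _)
    have h3 : 0 ≤ 2 * χ x ^ 4 := by positivity
    constructor <;> linarith
  rw [hm] at h
  have h1 : energy Ω B u - lam1 Ω B * 1 ≤ ω ^ 2 / S := by linarith [min_le_right 1 (ω ^ 2 / S)]
  have h2 : (ω / S) ^ 2 * (|M| + 1) * (energy Ω B u + 1) ≤ ω ^ 2 / S := by
    have : energy Ω B u + 1 ≤ lam1 Ω B + 2 := by linarith [min_le_left 1 (ω ^ 2 / S)]
    calc _ ≤ (ω / S) ^ 2 * (|M| + 1) * (lam1 Ω B + 2) := by gcongr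
      _ = (ω / S) ^ 2 * S := by simp only [S]; ring
      _ = ω ^ 2 / S := by field_simp
  have h3 := h.trans (add_le_add h1 h2)
  have h4 : 0 < 2 * (ω / S) := by positivity
  have h5 : ω ^ 2 / S + ω ^ 2 / S = 2 * (ω / S) * ω := by ring
  rw [h5] at h3
  linarith [le_of_mul_le_mul_left h3 h4]

end

section

variable {Ω : Set Plane}

lemma magSq_shift (B B' : ℝ) (u : Plane → ℂ) (x : Plane) {τ : ℝ} (hτ : 0 < τ) :
    magSq B' F0 u x ≤ (1 + τ) * magSq B F0 u x +
      (1 + τ⁻¹) * (B' - B) ^ 2 * (esq (F0 x) * ‖u x‖ ^ 2) := by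
  have key : ∀ (a : ℂ) (f : ℝ), ‖-Complex.I * a - ((B' * f : ℝ) : ℂ) * u x‖ ^ 2 ≤
      (1 + τ) * ‖-Complex.I * a - ((B * f : ℝ) : ℂ) * u x‖ ^ 2 +
        (1 + τ⁻¹) * ((B' - B) ^ 2 * (f ^ 2 * ‖u x‖ ^ 2)) := fun a f => by
    have h := norm_add_sq_le hτ (-Complex.I * a - ((B * f : ℝ) : ℂ) * u x)
      (-(((B' - B) * f : ℝ) : ℂ) * u x)
    have e1 : -Complex.I * a - ((B * f : ℝ) : ℂ) * u x + -(((B' - B) * f : ℝ) : ℂ) * u x =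
        -Complex.I * a - ((B' * f : ℝ) : ℂ) * u x := by push_cast; ring
    rw [e1] at h
    simpa only [norm_mul, norm_neg, mul_pow, Complex.norm_real, Real.norm_eq_abs, sq_abs,
      mul_assoc] using h
  have h1 := key (fderiv ℝ u x (1, 0)) (F0 x).1
  have h2 := key (fderiv ℝ u x (0, 1)) (F0 x).2
  rw [magSq, magSq, esq]
  linarith only [h1, h2]

lemma exists_esq_F0_bound (hbdd : Bornology.IsBounded Ω) : ∃ C > 0, ∀ x ∈ Ω, esq (F0 x) ≤ C := by
  have hc : Continuous fun x => esq (F0 x) := by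
    have := continuous_F0
    unfold esq
    fun_prop
  obtain ⟨C, hC⟩ := hbdd.isCompact_closure.exists_bound_of_continuousOn hc.continuousOn
  exact ⟨|C| + 1, by positivity, fun x hx => by
    have := (le_abs_self _).trans ((hC x (subset_closure hx)).trans (le_abs_self C))
    linarith⟩

lemma lam1_shift (hopen : IsOpen Ω) (hbdd : Bornology.IsBounded Ω) (hne : Ω.Nonempty) {C : ℝ}
    (hC : ∀ x ∈ Ω, esq (F0 x) ≤ C) (B B' : ℝ) {τ : ℝ} (hτ : 0 < τ) :
    lam1 Ω B' ≤ (1 + τ) * lam1 Ω B + (1 + τ⁻¹) * (B' - B) ^ 2 * C := by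
  refine le_of_forall_pos_le_add fun δ hδ => ?_
  obtain ⟨u, hu, hm, he⟩ := exists_quasi_min hopen hbdd hne B (δ := δ / (1 + τ)) (by positivity)
  have h1 := lam1_mul_mass_le (Ω := Ω) hu B'
  rw [hm, mul_one] at h1
  have hcu := hu.continuous
  have hsum := sum_integral_nonneg hopen ![1 + τ, (1 + τ⁻¹) * (B' - B) ^ 2 * C, -1]
    ![magSq B F0 u, fun x => ‖u x‖ ^ 2, magSq B' F0 u] (fun i => by
      fin_cases i
      · exact integrableOn_of_continuous hbdd (continuous_magSq hu B continuous_F0)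
      · exact integrableOn_of_continuous hbdd (by fun_prop : Continuous fun x => ‖u x‖ ^ 2)
      · exact integrableOn_of_continuous hbdd (continuous_magSq hu B' continuous_F0))
    (fun x hx => by
      have q1 := magSq_shift B B' u x hτ
      have q2 : (1 + τ⁻¹) * (B' - B) ^ 2 * (esq (F0 x) * ‖u x‖ ^ 2) ≤
          (1 + τ⁻¹) * (B' - B) ^ 2 * (C * ‖u x‖ ^ 2) := by
        gcongr
        exact hC x hx
      simp only [Fin.sum_univ_succ, Fin.sum_univ_zero, Matrix.cons_val_zero, Matrix.cons_val_succ]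
      linarith only [q1, q2])
  simp only [Fin.sum_univ_succ, Fin.sum_univ_zero, Matrix.cons_val_zero, Matrix.cons_val_succ]
    at hsum
  have h2 : ∫ x in Ω, ‖u x‖ ^ 2 = 1 := hm
  rw [h2] at hsum
  have h3 : (1 + τ) * energy Ω B u ≤ (1 + τ) * lam1 Ω B + δ := by
    have : (1 + τ) * (δ / (1 + τ)) = δ := by field_simp
    have := mul_le_mul_of_nonneg_left he (by positivity : 0 ≤ 1 + τ)
    linarith
  simp only [energy] at h1 h3
  linarith

lemma lam1_le_sq (hopen : IsOpen Ω) (hbdd : Bornology.IsBounded Ω) (hne : Ω.Nonempty) {C : ℝ}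
    (hC : ∀ x ∈ Ω, esq (F0 x) ≤ C) (B : ℝ) : lam1 Ω B ≤ C * B ^ 2 := by
  have hvol : 0 < volume.real Ω :=
    ENNReal.toReal_pos (hopen.measure_pos volume hne).ne' hbdd.measure_lt_top.ne
  have hm : mass Ω (fun _ => 1) = volume.real Ω := by simp [mass]
  have h1 := lam1_mul_mass_le (Ω := Ω) (u := fun _ => 1) contDiff_const B
  have h2 : energy Ω B (fun _ => 1) ≤ C * B ^ 2 * volume.real Ω := by
    have h3 : ∀ x, magSq B F0 (fun _ => 1) x = B ^ 2 * esq (F0 x) := fun x => by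
      simp only [magSq, fderiv_fun_const, Pi.zero_apply, _root_.zero_apply, mul_zero, zero_sub,
        norm_neg, mul_one, Complex.norm_real, Real.norm_eq_abs, sq_abs, esq]
      ring
    have h4 : energy Ω B (fun _ => 1) ≤ ∫ _ in Ω, C * B ^ 2 :=
      setIntegral_mono_on
        (integrableOn_of_continuous hbdd (continuous_magSq contDiff_const B continuous_F0))
        (integrableOn_const hbdd.measure_lt_top.ne) hopen.measurableSet fun x hx => by
          rw [h3, mul_comm]; gcongr; exact hC x hx
    rwa [setIntegral_const, smul_eq_mul, mul_comm] at h4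
  rw [hm] at h1
  exact le_of_mul_le_mul_right (h1.trans h2) hvol

lemma continuous_lam1 (hopen : IsOpen Ω) (hbdd : Bornology.IsBounded Ω) (hne : Ω.Nonempty) :
    Continuous (lam1 Ω) := by
  obtain ⟨C, hC0, hC⟩ := exists_esq_F0_bound hbdd
  rw [continuous_iff_continuousAt]
  intro B
  rw [ContinuousAt, tendsto_iff_norm_sub_tendsto_zero]
  have hlim : Tendsto (fun B' => |B' - B| * (C * B' ^ 2 + C * B ^ 2) +
      (|B' - B| ^ 2 + |B' - B|) * C)
      (𝓝 B) (𝓝 0) := by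
    have : Continuous fun B' => |B' - B| * (C * B' ^ 2 + C * B ^ 2) +
        (|B' - B| ^ 2 + |B' - B|) * C := by fun_prop
    simpa using this.tendsto B
  refine squeeze_zero (fun _ => norm_nonneg _) (fun B' => ?_) hlim
  rcases eq_or_ne B' B with rfl | hBB
  · simp
  have hτ : 0 < |B' - B| := abs_pos.mpr (sub_ne_zero.mpr hBB)
  have hb : (1 + |B' - B|⁻¹) * (B' - B) ^ 2 * C = (|B' - B| ^ 2 + |B' - B|) * C := by
    rw [← sq_abs (B' - B)]; field_simp
  have h1 := lam1_shift hopen hbdd hne hC B B' hτ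
  have h2 := lam1_shift hopen hbdd hne hC B' B hτ
  rw [show (B - B') ^ 2 = (B' - B) ^ 2 by ring] at h2
  rw [hb] at h1 h2
  have h3 := mul_le_mul_of_nonneg_left (lam1_le_sq hopen hbdd hne hC B) hτ.le
  have h4 := mul_le_mul_of_nonneg_left (lam1_le_sq hopen hbdd hne hC B') hτ.le
  have h5 : 0 ≤ |B' - B| * (C * B ^ 2) := by positivity
  have h6 : 0 ≤ |B' - B| * (C * B' ^ 2) := by positivity
  rw [Real.norm_eq_abs, abs_le]
  constructor <;> linarith

lemma exists_quasi_min_localized (hopen : IsOpen Ω) (hbdd : Bornology.IsBounded Ω)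
    (hne : Ω.Nonempty) {ι : Type*} (t : Finset ι) (χ : ι → Plane → ℝ)
    (hχ : ∀ i ∈ t, ContDiff ℝ 1 (χ i)) (B : ℝ) {δ w : ℝ} (hδ : 0 < δ) (hw : 0 < w) :
    ∃ u : Plane → ℂ, ContDiff ℝ 1 u ∧ mass Ω u = 1 ∧ energy Ω B u ≤ lam1 Ω B + δ ∧ ∀ i ∈ t,
      energy Ω B (fun y => (χ i y : ℂ) * u y) ≤ lam1 Ω B * mass Ω (fun y => (χ i y : ℂ) * u y) +
        (∫ x in Ω, gradSq (χ i) x * ‖u x‖ ^ 2) + w := by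
  classical
  have key : ∃ δ₀ > 0, ∀ u : Plane → ℂ, ContDiff ℝ 1 u → mass Ω u = 1 →
      energy Ω B u ≤ lam1 Ω B + δ₀ → ∀ i ∈ t, energy Ω B (fun y => (χ i y : ℂ) * u y) ≤
        lam1 Ω B * mass Ω (fun y => (χ i y : ℂ) * u y) +
        (∫ x in Ω, gradSq (χ i) x * ‖u x‖ ^ 2) + w := by
    induction t using Finset.induction_on with
    | empty => exact ⟨1, one_pos, by simp⟩
    | insert a s _ ih =>
      obtain ⟨δ₁, hδ₁, h1⟩ := ih fun i hi => hχ i (Finset.mem_insert_of_mem hi)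
      obtain ⟨δ₂, hδ₂, h2⟩ := quasi_min_localization hbdd hopen
        (hχ a (Finset.mem_insert_self a s)) B hw
      refine ⟨min δ₁ δ₂, by positivity, fun u hu hm he i hi => ?_⟩
      rcases Finset.mem_insert.mp hi with rfl | hi
      · exact h2 u hu hm (he.trans (by gcongr; exact min_le_right _ _))
      · exact h1 u hu hm (he.trans (by gcongr; exact min_le_left _ _)) i hi
  obtain ⟨δ₀, hδ₀, h⟩ := key
  obtain ⟨u, hu, hm, he⟩ := exists_quasi_min hopen hbdd hne B (δ := min δ δ₀) (by positivity)
  exact ⟨u, hu, hm, he.trans (by gcongr; exact min_le_left _ _),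
    h u hu hm (he.trans (by gcongr; exact min_le_right _ _))⟩

lemma interior_lower (hopen : IsOpen Ω) {v : Plane → ℂ} {K : Set Plane} (hK : IsCompact K)
    (hKΩ : K ⊆ Ω) (hv : ContDiffOn ℝ 1 v Ω) (h0 : ∀ x ∈ Ω, x ∉ K → v x = 0) (B : ℝ) :
    B * mass Ω v ≤ energy Ω B v := by
  let V : Plane → ℂ := Ω.indicator v
  have hV0 : ∀ x ∉ K, V x = 0 := fun x hx => by
    by_cases hxΩ : x ∈ Ω
    · simp [V, hxΩ, h0 x hxΩ hx]
    · simp [V, hxΩ]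
  have hV : ContDiff ℝ 1 V := contDiff_of_contDiffOn_of_eq_zero hK.isClosed hopen hKΩ
    (hv.congr fun x hx => by simp [V, hx]) hV0
  have hVc : HasCompactSupport V := HasCompactSupport.of_support_subset_isCompact hK fun z hz => by
    by_contra h; exact hz (hV0 z h)
  have h1 : mass Ω v = ∫ x, ‖V x‖ ^ 2 := by
    rw [← setIntegral_eq_integral_of_forall_compl_eq_zero (s := Ω)
      (fun x hx => by simp [V, hx])]
    exact setIntegral_congr_fun hopen.measurableSet fun x hx => by simp [V, hx]
  have h2 : energy Ω B v = ∫ x, magSq B F0 V x := by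
    rw [← setIntegral_eq_integral_of_forall_compl_eq_zero (s := Ω)
      (fun x hx => magSq_eq_zero_of_notMem hK.isClosed hV0 (fun h => hx (hKΩ h)) _ _)]
    refine setIntegral_congr_fun hopen.measurableSet fun x hx => ?_
    have : V =ᶠ[𝓝 x] v := by
      filter_upwards [hopen.mem_nhds hx] with y hy
      simp [V, hy]
    simp only [magSq, this.self_of_nhds, this.fderiv_eq]
  rw [h1, h2]
  exact plane_lower hV hVc B

lemma mass_ofReal_mul_le {χ : Plane → ℝ} {u : Plane → ℂ} (hopen : IsOpen Ω)
    (hbdd : Bornology.IsBounded Ω) (hχ : Continuous χ) (hu : Continuous u) {g : Plane → ℝ}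
    (hg : Continuous g) {G : ℝ} (h : ∀ x ∈ Ω, g x ≤ G * χ x ^ 2) :
    ∫ x in Ω, g x * ‖u x‖ ^ 2 ≤ G * mass Ω (fun y => (χ y : ℂ) * u y) := by
  rw [mass, ← integral_const_mul]
  refine setIntegral_mono_on (integrableOn_of_continuous hbdd (by fun_prop))
    (integrableOn_of_continuous hbdd (by fun_prop)) hopen.measurableSet fun x hx => ?_
  simp only [norm_mul, mul_pow, Complex.norm_real, Real.norm_eq_abs, sq_abs]
  rw [← mul_assoc]
  exact mul_le_mul_of_nonneg_right (h x hx) (sq_nonneg _)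

lemma exists_gradSq_bound (hbdd : Bornology.IsBounded Ω) {χ : Plane → ℝ} (hχ : ContDiff ℝ 1 χ) :
    ∃ G > 0, ∀ x ∈ Ω, gradSq χ x ≤ G := by
  obtain ⟨C, hC⟩ := hbdd.isCompact_closure.exists_bound_of_continuousOn
    (continuous_gradSq hχ).continuousOn
  exact ⟨|C| + 1, by positivity, fun x hx => by
    have := (le_abs_self _).trans ((hC x (subset_closure hx)).trans (le_abs_self C))
    linarith⟩

namespace BoundaryParam

lemma lam1_lower (D : HalfLine) (P : BoundaryParam Ω) (hopen : IsOpen Ω)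
    (hbdd : Bornology.IsBounded Ω) (hne : Ω.Nonempty) : ∃ C > 0, ∃ b0 > 0, ∀ b > b0,
      D.c ^ 2 * b ^ 2 - C * b ≤ lam1 Ω (b ^ 2) := by
  classical
  obtain ⟨k₀, hk₀, hk⟩ := P.exists_curv_bound
  choose ρ hρ b₁ hb₁ hloc using fun s => local_lower D P hopen hbdd s (η := 1) one_pos
  have hcpt : IsCompact (frontier Ω) :=
    hbdd.isCompact_closure.of_isClosed_subset isClosed_frontier frontier_subset_closure
  obtain ⟨t, ht⟩ := hcpt.elim_finite_subcover (fun s => Metric.ball (P.γ s) (ρ s / 2))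
    (fun s => Metric.isOpen_ball) (fun x hx => by
      rw [← P.range_eq] at hx
      obtain ⟨s, rfl⟩ := hx
      exact mem_iUnion.mpr ⟨s, Metric.mem_ball_self (half_pos (hρ s))⟩)
  let K0 : Set Plane := closure Ω \ ⋃ s ∈ t, Metric.ball (P.γ s) (ρ s / 2)
  have hK0 : IsCompact K0 := hbdd.isCompact_closure.diff
    (isOpen_biUnion fun s _ => Metric.isOpen_ball)
  have hK0Ω : K0 ⊆ Ω := fun x hx => by
    by_contra hxΩ
    exact hx.2 (ht ⟨hx.1, by rwa [hopen.interior_eq]⟩)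
  obtain ⟨χ0, hχ0, h0one, h0s, -⟩ := exists_cutoff hK0.isClosed hopen hK0Ω
  choose χ1 hχ1 h1one h1s _ using fun s => exists_cutoff
    (K := Metric.closedBall (P.γ s) (ρ s / 2)) Metric.isClosed_closedBall
    (Metric.isOpen_ball (x := P.γ s) (ε := ρ s))
    (Metric.closedBall_subset_ball (half_lt_self (hρ s)))
  let χ : Option ℝ → Plane → ℝ := fun o => o.elim χ0 χ1
  have hχ : ∀ i, ContDiff ℝ 1 (χ i) := fun i => by
    cases i with
    | none => exact hχ0.of_le (by norm_cast)
    | some s => exact (hχ1 s).of_le (by norm_cast)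
  choose G hG hGb using fun i => exists_gradSq_bound hbdd (hχ i)
  let T : Finset (Option ℝ) := Finset.insertNone t
  let C := k₀ * D.C1 + 1
  have hC : 0 < C := by have := D.C1_pos; positivity
  have hlow : ∀ᶠ b in atTop, ∀ i ∈ T, ∀ u : Plane → ℂ, ContDiff ℝ 1 u →
      (D.c ^ 2 * b ^ 2 - C * b) * mass Ω (fun y => (χ i y : ℂ) * u y) ≤
        energy Ω (b ^ 2) (fun y => (χ i y : ℂ) * u y) := by
    rw [Filter.eventually_all_finset]
    intro i _
    cases i with
    | none =>
      filter_upwards [eventually_gt_atTop 0] with b hb u hu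
      have h1 := interior_lower hopen (v := fun y => (χ0 y : ℂ) * u y)
        (K := tsupport χ0 ∩ closure Ω)
        (hbdd.isCompact_closure.inter_left (isClosed_tsupport χ0)) (inter_subset_left.trans h0s)
        ((Complex.ofRealCLM.contDiff.comp (hχ none)).mul hu).contDiffOn (fun x hx hxK => by
          rw [image_eq_zero_of_notMem_tsupport fun h => hxK ⟨h, subset_closure hx⟩]; simp)
        (b ^ 2)
      refine le_trans (mul_le_mul_of_nonneg_right ?_ (mass_nonneg _)) h1
      have := mul_pos hC hb
      have h2 : D.c ^ 2 ≤ 1 := pow_le_one₀ D.c_pos.le D.c_lt.le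
      nlinarith [sq_nonneg b]
    | some s =>
      filter_upwards [eventually_gt_atTop (b₁ s)] with b hb u hu
      have h1 := hloc s b hb (fun y => (χ1 s y : ℂ) * u y)
        ((Complex.ofRealCLM.contDiff.comp (hχ (some s))).mul hu)
        ((closure_mono fun x hx => by
          contrapose! hx
          simp [Function.notMem_support.mp hx]).trans (h1s s))
      refine le_trans (mul_le_mul_of_nonneg_right ?_ (mass_nonneg _)) h1
      have hb' : 0 < b := (hb₁ s).trans hb
      have h2 : curvOf P.γ s * D.C1 * b ≤ k₀ * D.C1 * b := by
        have := D.C1_pos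
        gcongr
        exact (abs_le.mp (hk s)).2
      simp only [C]
      linarith
  obtain ⟨b0, hb0⟩ := eventually_atTop.mp hlow
  let S := ∑ i ∈ T, (G i + 1)
  have hS : 0 ≤ S := Finset.sum_nonneg fun i _ => by have := hG i; positivity
  refine ⟨C + S, by positivity, max b0 1, by positivity, fun b hb => ?_⟩
  have hb1 : 1 < b := (le_max_right _ _).trans_lt hb
  by_contra! hcon
  obtain ⟨u, hu, hm, -, hloc⟩ := exists_quasi_min_localized hopen hbdd hne T χ
    (fun i _ => hχ i) (b ^ 2) one_pos one_pos
  have hcu := hu.continuous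
  have hstep : ∀ i ∈ T, S * b * mass Ω (fun y => (χ i y : ℂ) * u y) ≤ G i + 1 -
      (D.c ^ 2 * b ^ 2 - C * b - S * b - lam1 Ω (b ^ 2)) *
        mass Ω (fun y => (χ i y : ℂ) * u y) := fun i hi => by
    have h1 := hb0 b ((le_max_left _ _).trans hb.le) i hi u hu
    have h2 := hloc i hi
    have h3 : ∫ x in Ω, gradSq (χ i) x * ‖u x‖ ^ 2 ≤ G i := by
      have := mass_ofReal_mul_le (χ := fun _ => 1) (G := G i) hopen hbdd continuous_const hcu
        (continuous_gradSq (hχ i)) (fun x hx => by simpa using hGb i x hx)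
      simpa [hm] using this
    linarith
  have hmass : 1 ≤ ∑ i ∈ T, mass Ω (fun y => (χ i y : ℂ) * u y) := by
    have hci : ∀ i, Continuous (χ i) := fun i => (hχ i).continuous
    have hInt : ∀ i, IntegrableOn (fun y => ‖(χ i y : ℂ) * u y‖ ^ 2) Ω := fun i => by
      have := hci i
      exact integrableOn_of_continuous hbdd (by fun_prop)
    simp only [mass]
    rw [← integral_finsetSum _ fun i _ => hInt i, ← hm, mass]
    refine setIntegral_mono_on (integrableOn_of_continuous hbdd (by fun_prop))
      (integrable_finsetSum _ fun i _ => hInt i) hopen.measurableSet fun x hx => ?_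
    have hone : ∃ i ∈ T, χ i x = 1 := by
      by_cases hx0 : x ∈ ⋃ s ∈ t, Metric.ball (P.γ s) (ρ s / 2)
      · simp only [mem_iUnion] at hx0
        obtain ⟨s, hs, hxs⟩ := hx0
        exact ⟨some s, Finset.some_mem_insertNone.mpr hs,
          h1one s x (Metric.ball_subset_closedBall hxs)⟩
      · exact ⟨none, Finset.none_mem_insertNone, h0one x ⟨subset_closure hx, hx0⟩⟩
    obtain ⟨i, hi, hix⟩ := hone
    refine le_trans (le_of_eq ?_)
      (Finset.single_le_sum (f := fun i => ‖(χ i x : ℂ) * u x‖ ^ 2) (fun j _ => sq_nonneg _) hi)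
    simp [hix]
  have htot := Finset.sum_le_sum hstep
  rw [← Finset.mul_sum, Finset.sum_sub_distrib, ← Finset.mul_sum] at htot
  have h4 : 0 < D.c ^ 2 * b ^ 2 - C * b - S * b - lam1 Ω (b ^ 2) := by linarith
  have h5 := mul_pos h4 (one_pos.trans_le hmass)
  have h6 : S ≤ S * b * ∑ i ∈ T, mass Ω (fun y => (χ i y : ℂ) * u y) := by
    have h7 : S * 1 ≤ S * b := mul_le_mul_of_nonneg_left hb1.le hS
    have h8 : S * b * 1 ≤ S * b * ∑ i ∈ T, mass Ω (fun y => (χ i y : ℂ) * u y) :=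
      mul_le_mul_of_nonneg_left hmass (by positivity)
    linarith
  have h9 : ∑ i ∈ T, (G i + 1) = S := rfl
  linarith

lemma lam1_upper (D : HalfLine) (P : BoundaryParam Ω) (hopen : IsOpen Ω)
    (hbdd : Bornology.IsBounded Ω) (s₀ : ℝ) {η : ℝ} (hη : 0 < η) : ∃ b0 > 0, ∀ b > b0,
      lam1 Ω (b ^ 2) ≤ D.c ^ 2 * b ^ 2 - curvOf P.γ s₀ * D.C1 * b + η * b := by
  obtain ⟨b0, hb0, h⟩ := P.exists_trial_upper D hopen hbdd s₀ hη
  refine ⟨b0, hb0, fun b hb => ?_⟩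
  obtain ⟨v, hv, -, hpos, hle⟩ := h b hb
  exact le_of_mul_le_mul_right ((lam1_mul_mass_le hv _).trans hle) hpos

end BoundaryParam

end

section

open scoped Manifold

/-- Gluing local functions with prescribed value and derivative on a compact set. -/
lemma exists_glued {K : Set Plane} (hK : IsCompact K) (f : Plane → ℝ) (T : Plane → Plane →L[ℝ] ℝ)
    (h : ∀ x ∈ K, ∃ U, IsOpen U ∧ x ∈ U ∧ ∃ ψ : Plane → ℝ, ContDiffOn ℝ (⊤ : ℕ∞) ψ U ∧
      ∀ y ∈ U ∩ K, ψ y = f y ∧ fderiv ℝ ψ y = T y) :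
    ∃ φ : Plane → ℝ, ContDiff ℝ (⊤ : ℕ∞) φ ∧ ∀ y ∈ K, fderiv ℝ φ y = T y := by
  choose! U hU hmem ψ hψ hval using h
  obtain ⟨t, htK, ht⟩ := hK.elim_nhds_subcover U fun x hx => (hU x hx).mem_nhds (hmem x hx)
  have hUo : ∀ i : t, IsOpen (U i) := fun i => hU i (htK i i.2)
  obtain ⟨K', hK', hKK', hK'U⟩ := exists_compact_between hK
    (isOpen_iUnion hUo) (by simpa only [iUnion_subtype] using ht)
  obtain ⟨χ, hχ⟩ := SmoothPartitionOfUnity.exists_isSubordinate 𝓘(ℝ, Plane) hK'.isClosed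
    (fun i : t => U i) hUo hK'U
  have hχs : ∀ i, ContDiff ℝ (⊤ : ℕ∞) (χ i) := fun i => (χ i).contMDiff.contDiff
  have hsum : ∀ y ∈ K', ∑ i, χ i y = 1 := fun y hy => by
    rw [← finsum_eq_sum_of_fintype, χ.sum_eq_one hy]
  refine ⟨fun y => ∑ i, χ i y * ψ i y, ContDiff.sum fun i _ =>
    contDiff_of_contDiffOn_of_eq_zero (isClosed_tsupport (χ i)) (hUo i) (hχ i)
      ((hχs i).contDiffOn.mul (hψ i (htK i i.2))) fun z hz => by
        rw [image_eq_zero_of_notMem_tsupport hz, zero_mul], fun y hy => ?_⟩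
  have hd : ∀ i, HasFDerivAt (χ i) (fderiv ℝ (χ i) y) y := fun i =>
    ((hχs i).differentiable (by simp) y).hasFDerivAt
  have hterm : ∀ i, HasFDerivAt (fun z => χ i z * ψ i z)
      (f y • fderiv ℝ (χ i) y + χ i y • T y) y := fun i => by
    by_cases hyU : y ∈ U i
    · have hψi := hψ i (htK i i.2)
      obtain ⟨h1, h2⟩ := hval i (htK i i.2) y ⟨hyU, hy⟩
      have h3 := (hd i).fun_mul (((hψi.contDiffAt ((hUo i).mem_nhds hyU)).differentiableAt
        (by simp)).hasFDerivAt)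
      rwa [h1, h2, add_comm] at h3
    · have hyt : y ∉ tsupport (χ i) := fun h => hyU (hχ i h)
      have h1 : (χ i : Plane → ℝ) =ᶠ[𝓝 y] fun _ => 0 := notMem_tsupport_iff_eventuallyEq.mp hyt
      have h2 : (fun z => χ i z * ψ i z) =ᶠ[𝓝 y] fun _ => 0 := by
        filter_upwards [h1] with z hz
        rw [hz, zero_mul]
      rw [h1.fderiv_eq, image_eq_zero_of_notMem_tsupport hyt]
      simpa using (hasFDerivAt_const (0 : ℝ) y).congr_of_eventuallyEq h2
  have h1 := HasFDerivAt.fun_sum fun i (_ : i ∈ Finset.univ) => hterm i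
  have h2 : HasFDerivAt (fun z => ∑ i, χ i z) (∑ i, fderiv ℝ (χ i) y) y :=
    HasFDerivAt.fun_sum fun i _ => hd i
  have h3 : ∑ i, fderiv ℝ (χ i) y = 0 := by
    refine h2.unique ((hasFDerivAt_const (1 : ℝ) y).congr_of_eventuallyEq ?_)
    filter_upwards [mem_interior_iff_mem_nhds.mp (hKK' hy)] with z hz using hsum z hz
  rw [h1.fderiv, Finset.sum_add_distrib, ← Finset.smul_sum, ← Finset.sum_smul, h3,
    hsum y (interior_subset (hKK' hy)), smul_zero, zero_add, one_smul]

namespace BoundaryParam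
variable {Ω : Set Plane}

/-- The linear form `w ↦ ⟨F₀(x), w⟩`. -/
def F0form (x : Plane) : Plane →L[ℝ] ℝ :=
  (F0 x).1 • ContinuousLinearMap.fst ℝ ℝ ℝ + (F0 x).2 • ContinuousLinearMap.snd ℝ ℝ ℝ

lemma F0form_apply (x w : Plane) : F0form x w = dot2 (F0 x) w := by
  simp [F0form, dot2]

lemma exists_local_gauge (P : BoundaryParam Ω) (s : ℝ) {r : ℝ} (hr : 0 < r) :
    ∃ U, IsOpen U ∧ P.γ s ∈ U ∧ ∃ ψ : Plane → ℝ, ContDiffOn ℝ (⊤ : ℕ∞) ψ U ∧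
      ∀ y ∈ U ∩ frontier Ω, ∃ s', |s' - s| < r ∧ P.γ s' = y ∧ ψ y = P.primF s' ∧
        fderiv ℝ ψ y = F0form y := by
  obtain ⟨e, he, ρ, hρ, hρr, hsrc, hdom, hfr⟩ := P.exists_chart_ball s hr
  have hs : (s, (0 : ℝ)) ∈ e.source := hsrc ▸ Metric.mem_ball_self hρ
  have hψ : ContDiffOn ℝ (⊤ : ℕ∞) (P.gauge ∘ e.symm) e.target :=
    P.contDiffOn_gauge.comp (contDiffOn_chart_symm he hdom) fun y hy => hdom (e.map_target hy)
  refine ⟨e.target, e.open_target, ?_, P.gauge ∘ e.symm, hψ, ?_⟩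
  · have := e.map_source hs
    rwa [he, chart_zero] at this
  rintro y ⟨hy, hyf⟩
  have hz := e.map_target hy
  have hzy : P.chart (e.symm y) = y := by rw [← he, e.right_inv hy]
  have hz2 := hfr _ hz (by rwa [hzy])
  obtain ⟨⟨s', x⟩, hzs⟩ : ∃ z, e.symm y = z := ⟨_, rfl⟩
  rw [hzs] at hz hzy hz2
  obtain rfl : x = 0 := hz2
  rw [chart_zero] at hzy
  refine ⟨s', ?_, hzy, by simp [hzs, gauge, tau], ?_⟩
  · rw [hsrc, ← ball_prod_same] at hz
    exact (Real.dist_eq s' s ▸ hz.1 : |s' - s| < ρ).trans_le hρr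
  have hzd := hdom hz
  have hcy : P.chart (s', 0) = y := by rw [chart_zero, hzy]
  have hdψ : DifferentiableAt ℝ (P.gauge ∘ e.symm) (P.chart (s', 0)) := by
    rw [hcy]
    exact (hψ.contDiffAt (e.open_target.mem_nhds hy)).differentiableAt (by simp)
  have hcomp : P.gauge =ᶠ[𝓝 (s', 0)] (P.gauge ∘ e.symm) ∘ P.chart := by
    filter_upwards [e.open_source.mem_nhds hz] with z hz'
    rw [Function.comp_apply, Function.comp_apply, ← he, e.left_inv hz']
  have hf : fderiv ℝ P.gauge (s', 0) =
      (fderiv ℝ (P.gauge ∘ e.symm) y).comp (fderiv ℝ P.chart (s', 0)) := by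
    rw [hcomp.fderiv_eq, fderiv_comp _ hdψ (differentiableAt_chart hzd), hcy]
  have e1 := congrArg (fun l : Plane →L[ℝ] ℝ => l (1, 0)) hf
  have e2 := congrArg (fun l : Plane →L[ℝ] ℝ => l (0, 1)) hf
  simp only [ContinuousLinearMap.comp_apply, fderiv_gauge_s hzd, fderiv_gauge_x hzd,
    fderiv_chart_s hzd, fderiv_chart_x hzd, hcy, add_zero, ← F0form_apply] at e1 e2
  simp only [show P.q (s', 0) = 1 by simp [q], show P.tauS (s', 0) = 0 by simp [tauS], one_smul,
    zero_smul, add_zero, inv_one] at e1 e2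
  have ht := P.tangent_sq s'
  set T := deriv P.γ s' with hT
  set ν := nuVec P.γ s' with hν
  have hdec : ∀ w : Plane, w = (dot2 w T) • T + (dot2 w ν) • ν := fun w => by
    ext
    · simp only [dot2, hν, nuVec, ← hT, Prod.fst_add, Prod.smul_fst, smul_eq_mul]
      linear_combination (-w.1) * ht
    · simp only [dot2, hν, nuVec, ← hT, Prod.snd_add, Prod.smul_snd, smul_eq_mul]
      linear_combination (-w.2) * ht
  refine ContinuousLinearMap.ext fun w => ?_
  rw [hdec w, map_add, map_add, map_smul, map_smul, map_smul, map_smul, e1, e2]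

/-- Away from one boundary point, the tangential and normal parts of `F₀` can be gauged away. -/
lemma exists_gauge (P : BoundaryParam Ω) (s₀ : ℝ) {r : ℝ} (hr : 0 < r) :
    ∃ φ : Plane → ℝ, ContDiff ℝ (⊤ : ℕ∞) φ ∧ ∀ x ∈ frontier Ω, x ∉ Metric.ball (P.γ s₀) r →
      fderiv ℝ φ x (1, 0) = (F0 x).1 ∧ fderiv ℝ φ x (0, 1) = (F0 x).2 := by
  have hper : ∀ x ∈ frontier Ω \ Metric.ball (P.γ s₀) r,
      ∃ s ∈ Ioo s₀ (s₀ + P.L), P.γ s = x := fun x hx => by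
    obtain ⟨t, rfl⟩ : x ∈ range P.γ := P.range_eq ▸ hx.1
    obtain ⟨t', ht', h⟩ := P.periodic.exists_mem_Ico P.L_pos t s₀
    refine ⟨t', ⟨lt_of_le_of_ne ht'.1 ?_, ht'.2⟩, h.symm⟩
    rintro rfl
    exact hx.2 (h ▸ Metric.mem_ball_self hr)
  choose! σ hσ hγσ using hper
  have hfr : IsCompact (frontier Ω) := by
    rw [← P.range_eq, ← P.periodic.image_Icc P.L_pos 0]
    exact isCompact_Icc.image P.smooth.continuous
  obtain ⟨φ, hφ, h⟩ := exists_glued (hfr.diff (Metric.isOpen_ball (x := P.γ s₀) (ε := r)))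
    (fun x => P.primF (σ x)) F0form fun x hx => by
      have hm : 0 < min (σ x - s₀) (s₀ + P.L - σ x) :=
        lt_min (by linarith [(hσ x hx).1]) (by linarith [(hσ x hx).2])
      obtain ⟨U, hU, hxU, ψ, hψ, hval⟩ := P.exists_local_gauge (σ x) hm
      refine ⟨U, hU, hγσ x hx ▸ hxU, ψ, hψ, fun y hy => ?_⟩
      obtain ⟨s', hs', hγ, h1, h2⟩ := hval y ⟨hy.1, hy.2.1⟩
      obtain ⟨hs1, hs2⟩ := lt_min_iff.mp hs'
      rw [abs_lt] at hs1 hs2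
      have hy' := hσ y hy.2
      have : σ y = s' := P.eq_of_γ_eq ((hγσ y hy.2).trans hγ.symm) (by
        rw [abs_lt]; constructor <;> linarith [hy'.1, hy'.2])
      exact ⟨this ▸ h1, h2⟩
  refine ⟨φ, hφ, fun x hx hxb => ?_⟩
  rw [h x ⟨hx, hxb⟩, F0form_apply, F0form_apply]
  simp [dot2]

end BoundaryParam

end

section

variable {Ω : Set Plane}

/-- A smooth function vanishing on `[-1, 1]` and equal to the identity away from `[-2, 2]`. -/
def softThr (x : ℝ) : ℝ := x * Real.smoothTransition (x ^ 2 - 1)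

lemma contDiff_softThr : ContDiff ℝ 1 softThr :=
  contDiff_id.mul (Real.smoothTransition.contDiff (n := 1).comp
    ((contDiff_id.pow 2).sub contDiff_const))

lemma softThr_eq_zero {x : ℝ} (hx : x ^ 2 ≤ 1) : softThr x = 0 := by
  rw [softThr, Real.smoothTransition.zero_of_nonpos (by linarith), mul_zero]

lemma softThr_eq_self {x : ℝ} (hx : 2 ≤ x ^ 2) : softThr x = x := by
  rw [softThr, Real.smoothTransition.one_of_one_le (by linarith), mul_one]

lemma sq_le_softThr (x : ℝ) : x ^ 2 ≤ softThr x ^ 2 + 2 := by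
  rcases le_total (x ^ 2) 2 with h | h
  · linarith [sq_nonneg (softThr x)]
  · rw [softThr_eq_self h]; linarith

lemma exists_deriv_softThr_bound : ∃ M > 0, ∀ x, deriv softThr x ^ 2 ≤ M := by
  have hc : Continuous fun x => deriv softThr x ^ 2 :=
    (contDiff_softThr.continuous_deriv le_rfl).pow 2
  obtain ⟨M, hM⟩ := (isCompact_Icc (a := (-2 : ℝ)) (b := 2)).exists_bound_of_continuousOn
    hc.continuousOn
  refine ⟨|M| + 1, by positivity, fun x => ?_⟩
  by_cases hx : x ∈ Icc (-2 : ℝ) 2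
  · linarith [(le_abs_self _).trans ((hM x hx).trans (le_abs_self M))]
  · have h2 : 2 < x ^ 2 := by
      by_contra! h
      exact hx (abs_le.mp (abs_le_of_sq_le_sq (by linarith) (by norm_num)))
    have : softThr =ᶠ[𝓝 x] id := by
      filter_upwards [(continuous_pow 2).continuousAt.eventually_const_lt h2] with y hy
      exact softThr_eq_self hy.le
    rw [this.deriv_eq, deriv_id]
    linarith [abs_nonneg M]

/-- The part of a weight exceeding the threshold `ε`. -/
def thr (ε : ℝ) (w : Plane → ℝ) (x : Plane) : ℝ := ε * softThr (ε⁻¹ * w x)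

lemma contDiff_thr (ε : ℝ) {w : Plane → ℝ} (hw : ContDiff ℝ 1 w) : ContDiff ℝ 1 (thr ε w) :=
  contDiff_const.mul (contDiff_softThr.comp (contDiff_const.mul hw))

lemma thr_eq_zero {ε : ℝ} (hε : 0 < ε) {w : Plane → ℝ} {x : Plane} (h : |w x| ≤ ε) :
    thr ε w x = 0 := by
  rw [thr, softThr_eq_zero, mul_zero]
  rw [sq_le_one_iff_abs_le_one, abs_mul, abs_inv, abs_of_pos hε, inv_mul_le_iff₀ hε]
  simpa using h

lemma sq_le_thr {ε : ℝ} (hε : 0 < ε) (w : Plane → ℝ) (x : Plane) :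
    w x ^ 2 ≤ thr ε w x ^ 2 + 2 * ε ^ 2 := by
  have h := mul_le_mul_of_nonneg_left (sq_le_softThr (ε⁻¹ * w x)) (sq_nonneg ε)
  have e : ε ^ 2 * (ε⁻¹ * w x) ^ 2 = w x ^ 2 := by field_simp
  rw [e] at h
  rw [thr]
  linarith

lemma gradSq_thr_le {M : ℝ} (hM : ∀ x, deriv softThr x ^ 2 ≤ M) {ε : ℝ} (hε : 0 < ε)
    {w : Plane → ℝ} (hw : ContDiff ℝ 1 w) (x : Plane) :
    gradSq (thr ε w) x ≤ M * gradSq w x := by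
  have h1 : HasFDerivAt (thr ε w) (deriv softThr (ε⁻¹ * w x) • fderiv ℝ w x) x := by
    have hd := ((hw.differentiable one_ne_zero x).hasFDerivAt.const_mul ε⁻¹)
    have hs := (contDiff_softThr.differentiable one_ne_zero (ε⁻¹ * w x)).hasDerivAt
    have := (hs.comp_hasFDerivAt x hd).const_mul ε
    rwa [smul_comm ε, smul_smul ε, mul_inv_cancel₀ hε.ne', one_smul] at this
  rw [gradSq, h1.fderiv, gradSq]
  simp only [_root_.smul_apply, smul_eq_mul, mul_pow, ← mul_add]
  exact mul_le_mul_of_nonneg_right (hM _) (by positivity)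

/-- Decay of a quasi-minimizer against a weight vanishing on the boundary. -/
lemma interior_decay (hopen : IsOpen Ω) (hbdd : Bornology.IsBounded Ω) {M : ℝ}
    (hM : ∀ x, deriv softThr x ^ 2 ≤ M) {w : Plane → ℝ} (hw : ContDiff ℝ 1 w)
    (hw0 : ∀ x ∈ frontier Ω, w x = 0) {G : ℝ} (hG : ∀ x ∈ Ω, gradSq w x ≤ G) {u : Plane → ℂ}
    (hu : ContDiff ℝ 1 u) (hm : mass Ω u = 1) {b T : ℝ} (hb : 0 < b) (hT : T < 1)
    (hlam : lam1 Ω (b ^ 2) ≤ T * b ^ 2)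
    (hloc : energy Ω (b ^ 2) (fun y => (thr b⁻¹ w y : ℂ) * u y) ≤
      lam1 Ω (b ^ 2) * mass Ω (fun y => (thr b⁻¹ w y : ℂ) * u y) +
        (∫ x in Ω, gradSq (thr b⁻¹ w) x * ‖u x‖ ^ 2) + 1) :
    ∫ x in Ω, w x ^ 2 * ‖u x‖ ^ 2 ≤ ((M * G + 1) / (1 - T) + 2) / b ^ 2 := by
  have hcu := hu.continuous
  have hcw := hw.continuous
  have hbi : 0 < b⁻¹ := inv_pos.mpr hb
  have hcf := contDiff_thr b⁻¹ hw
  have hcf' := hcf.continuous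
  have hcg := continuous_gradSq hcf
  have hK : IsCompact (closure Ω ∩ {x | b⁻¹ ≤ |w x|}) :=
    hbdd.isCompact_closure.inter_right (isClosed_le continuous_const hcw.abs)
  have hKΩ : closure Ω ∩ {x | b⁻¹ ≤ |w x|} ⊆ Ω := fun x hx => by
    by_contra h
    have h2 : b⁻¹ ≤ |w x| := hx.2
    rw [hw0 x ⟨hx.1, hopen.interior_eq.symm ▸ h⟩, abs_zero] at h2
    linarith
  have hInt := interior_lower hopen hK hKΩ (v := fun y => (thr b⁻¹ w y : ℂ) * u y)
    ((Complex.ofRealCLM.contDiff.comp hcf).mul hu).contDiffOn (fun x hx hxK => by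
      have : ¬ b⁻¹ ≤ |w x| := fun h => hxK ⟨subset_closure hx, h⟩
      rw [thr_eq_zero hbi (not_le.mp this).le]; simp) (b ^ 2)
  set m := mass Ω (fun y => (thr b⁻¹ w y : ℂ) * u y) with hmdef
  have hm0 : 0 ≤ m := mass_nonneg _
  have hmeq : m = ∫ x in Ω, thr b⁻¹ w x ^ 2 * ‖u x‖ ^ 2 := by
    simp only [hmdef, mass, norm_mul, mul_pow, Complex.norm_real, Real.norm_eq_abs, sq_abs]
  have hm1 : ∫ x in Ω, ‖u x‖ ^ 2 = 1 := hm
  have hgr := sum_integral_nonneg hopen ![M * G, -1]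
    ![fun x => ‖u x‖ ^ 2, fun x => gradSq (thr b⁻¹ w) x * ‖u x‖ ^ 2] (fun i => by
      fin_cases i
      · exact integrableOn_of_continuous hbdd (by fun_prop : Continuous fun x => ‖u x‖ ^ 2)
      · exact integrableOn_of_continuous hbdd
          (by fun_prop : Continuous fun x => gradSq (thr b⁻¹ w) x * ‖u x‖ ^ 2))
    (fun x hx => by
      have hM0 : 0 ≤ M := (sq_nonneg _).trans (hM 0)
      have q1 := mul_le_mul_of_nonneg_right ((gradSq_thr_le hM hbi hw x).trans
        (mul_le_mul_of_nonneg_left (hG x hx) hM0)) (sq_nonneg ‖u x‖)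
      simp only [Fin.sum_univ_succ, Fin.sum_univ_zero, Matrix.cons_val_zero, Matrix.cons_val_succ]
      linarith only [q1])
  have hwe := sum_integral_nonneg hopen ![1, 2 * b⁻¹ ^ 2, -1]
    ![fun x => thr b⁻¹ w x ^ 2 * ‖u x‖ ^ 2, fun x => ‖u x‖ ^ 2, fun x => w x ^ 2 * ‖u x‖ ^ 2]
    (fun i => by
      fin_cases i
      · exact integrableOn_of_continuous hbdd
          (by fun_prop : Continuous fun x => thr b⁻¹ w x ^ 2 * ‖u x‖ ^ 2)
      · exact integrableOn_of_continuous hbdd (by fun_prop : Continuous fun x => ‖u x‖ ^ 2)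
      · exact integrableOn_of_continuous hbdd
          (by fun_prop : Continuous fun x => w x ^ 2 * ‖u x‖ ^ 2))
    (fun x hx => by
      have q1 := mul_le_mul_of_nonneg_right (sq_le_thr hbi w x) (sq_nonneg ‖u x‖)
      simp only [Fin.sum_univ_succ, Fin.sum_univ_zero, Matrix.cons_val_zero, Matrix.cons_val_succ]
      linarith only [q1])
  simp only [Fin.sum_univ_succ, Fin.sum_univ_zero, Matrix.cons_val_zero, Matrix.cons_val_succ,
    hm1, ← hmeq] at hgr hwe
  have h1 := mul_le_mul_of_nonneg_right hlam hm0
  have h2 : m ≤ (M * G + 1) / (1 - T) / b ^ 2 := by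
    rw [le_div_iff₀ (by positivity), le_div_iff₀ (by linarith)]
    linarith
  rw [add_div]
  have e : 2 / b ^ 2 = 2 * b⁻¹ ^ 2 := by rw [inv_pow]; rfl
  rw [e]
  linarith

/-- Decay of a quasi-minimizer near a region with a spectral gap. -/
lemma gap_decay (hopen : IsOpen Ω) (hbdd : Bornology.IsBounded Ω) {p : Plane} {ρ : ℝ}
    {χ₀ χ₁ : Plane → ℝ} (hχ₀ : ContDiff ℝ 1 χ₀) (hχ₁ : ContDiff ℝ 1 χ₁)
    (hs₀ : tsupport χ₀ ⊆ Metric.ball p ρ) (hs₁ : tsupport χ₁ ⊆ Metric.ball p ρ)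
    {G₀ G₁ : ℝ} (hG₀ : ∀ x ∈ Ω, gradSq χ₀ x ≤ G₀ * χ₁ x ^ 2) (hG₁ : ∀ x ∈ Ω, gradSq χ₁ x ≤ G₁)
    (hG₀' : 0 ≤ G₀)
    {u : Plane → ℂ} (hu : ContDiff ℝ 1 u) (hm : mass Ω u = 1) {b g : ℝ} (hb : 1 ≤ b)
    (hg : 0 < g)
    (hgap : ∀ v : Plane → ℂ, ContDiff ℝ 1 v → tsupport v ⊆ Metric.ball p ρ →
      (lam1 Ω (b ^ 2) + g * b) * mass Ω v ≤ energy Ω (b ^ 2) v)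
    (hloc₀ : energy Ω (b ^ 2) (fun y => (χ₀ y : ℂ) * u y) ≤
      lam1 Ω (b ^ 2) * mass Ω (fun y => (χ₀ y : ℂ) * u y) +
        (∫ x in Ω, gradSq χ₀ x * ‖u x‖ ^ 2) + b⁻¹)
    (hloc₁ : energy Ω (b ^ 2) (fun y => (χ₁ y : ℂ) * u y) ≤
      lam1 Ω (b ^ 2) * mass Ω (fun y => (χ₁ y : ℂ) * u y) +
        (∫ x in Ω, gradSq χ₁ x * ‖u x‖ ^ 2) + b⁻¹) :
    mass Ω (fun y => (χ₀ y : ℂ) * u y) ≤ (G₀ * (G₁ + 1) / g + 1) / g / b ^ 2 := by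
  have hb0 : 0 < b := by linarith
  have hts : ∀ χ : Plane → ℝ, tsupport (fun y => (χ y : ℂ) * u y) ⊆ tsupport χ := fun χ => by
    refine closure_mono fun x hx hx0 => hx ?_
    simp only [hx0, Complex.ofReal_zero, zero_mul]
  have hC : ∀ χ : Plane → ℝ, ContDiff ℝ 1 χ → ContDiff ℝ 1 fun y => (χ y : ℂ) * u y :=
    fun χ h => (Complex.ofRealCLM.contDiff.comp h).mul hu
  have h0 := hgap _ (hC χ₀ hχ₀) ((hts χ₀).trans hs₀)
  have h1 := hgap _ (hC χ₁ hχ₁) ((hts χ₁).trans hs₁)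
  have e0 := mass_ofReal_mul_le hopen hbdd hχ₁.continuous hu.continuous (continuous_gradSq hχ₀) hG₀
  have e1 := mass_ofReal_mul_le hopen hbdd (χ := fun _ => 1) continuous_const hu.continuous
    (continuous_gradSq hχ₁) (G := G₁) (by simpa using hG₁)
  simp only [Complex.ofReal_one, one_mul, hm, mul_one] at e1
  set m₀ := mass Ω (fun y => (χ₀ y : ℂ) * u y)
  set m₁ := mass Ω (fun y => (χ₁ y : ℂ) * u y)
  have hbi : b⁻¹ ≤ 1 := inv_le_one_of_one_le₀ hb
  have k1 : m₁ ≤ (G₁ + 1) / g * b⁻¹ := by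
    rw [← div_eq_mul_inv, le_div_iff₀ hb0, le_div_iff₀ hg]
    linarith
  have k2 : g * b * m₀ ≤ (G₀ * (G₁ + 1) / g + 1) * b⁻¹ := by
    have := mul_le_mul_of_nonneg_left k1 hG₀'
    have e : (G₀ * (G₁ + 1) / g + 1) * b⁻¹ = G₀ * ((G₁ + 1) / g * b⁻¹) + b⁻¹ := by ring
    linarith
  rw [le_div_iff₀ (by positivity), le_div_iff₀ hg]
  have := mul_le_mul_of_nonneg_right k2 hb0.le
  rw [mul_assoc _ b⁻¹ b, inv_mul_cancel₀ hb0.ne', mul_one] at this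
  linarith

end

section

variable {Ω : Set Plane}

/-- The vector potential `F₀ - ∇φ`. -/
def gaugedPot (φ : Plane → ℝ) (x : Plane) : Plane :=
  ((F0 x).1 - fderiv ℝ φ x (1, 0), (F0 x).2 - fderiv ℝ φ x (0, 1))

lemma contDiff_gaugedPot {φ : Plane → ℝ} (hφ : ContDiff ℝ (⊤ : ℕ∞) φ) :
    ContDiff ℝ 1 (gaugedPot φ) := by
  have h : ContDiff ℝ 1 (fderiv ℝ φ) := (hφ.of_le (m := 2) (by norm_cast)).fderiv_right
    (by norm_num)
  have h0 : ContDiff ℝ 1 F0 := by unfold F0; fun_prop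
  exact (h0.fst.sub (h.clm_apply contDiff_const)).prodMk (h0.snd.sub (h.clm_apply contDiff_const))

/-- Quasi-minimizers for which a fixed gauge of the potential is small in mean square. -/
lemma exists_decaying_quasi_min (D : HalfLine) (P : BoundaryParam Ω) (hopen : IsOpen Ω)
    (hbdd : Bornology.IsBounded Ω) (hne : Ω.Nonempty) {s₀ s₁ : ℝ}
    (hs : curvOf P.γ s₀ < curvOf P.γ s₁) :
    ∃ φ : Plane → ℝ, ContDiff ℝ (⊤ : ℕ∞) φ ∧ ∃ C > 0, ∃ b0 > 0, ∀ b > b0, ∀ δ > 0,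
      ∃ u : Plane → ℂ, ContDiff ℝ 1 u ∧ mass Ω u = 1 ∧ energy Ω (b ^ 2) u ≤ lam1 Ω (b ^ 2) + δ ∧
        ∫ x in Ω, esq (gaugedPot φ x) * ‖u x‖ ^ 2 ≤ C / b ^ 2 := by
  set p := P.γ s₀
  set g := (curvOf P.γ s₁ - curvOf P.γ s₀) * D.C1 with hg
  have hg0 : 0 < g := mul_pos (by linarith) D.C1_pos
  obtain ⟨bu, hbu, hup⟩ := BoundaryParam.lam1_upper D P hopen hbdd s₁ (η := g / 4) (by linarith)
  obtain ⟨ρ, hρ, bl, hbl, hlow⟩ :=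
    BoundaryParam.local_lower D P hopen hbdd s₀ (η := g / 4) (by linarith)
  obtain ⟨φ, hφ, hφF⟩ := P.exists_gauge s₀ (r := ρ / 8) (by linarith)
  have hcut : ∀ r R : ℝ, r < R → ∃ χ : Plane → ℝ, ContDiff ℝ (⊤ : ℕ∞) χ ∧
      (∀ x ∈ Metric.closedBall p r, χ x = 1) ∧ tsupport χ ⊆ Metric.ball p R ∧
        ∀ x, χ x ∈ Icc 0 1 := fun r R h =>
    exists_cutoff Metric.isClosed_closedBall Metric.isOpen_ball (Metric.closedBall_subset_ball h)
  obtain ⟨χ₀, hχ₀, h₀1, h₀s, h₀I⟩ := hcut (ρ / 4) (ρ / 2) (by linarith)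
  obtain ⟨χ₁, hχ₁, h₁1, h₁s, h₁I⟩ := hcut (ρ / 2) ρ (by linarith)
  obtain ⟨χ₂, hχ₂, h₂1, h₂s, h₂I⟩ := hcut (ρ / 8) (ρ / 4) (by linarith)
  have hχ₀' : ContDiff ℝ 1 χ₀ := hχ₀.of_le (by norm_cast)
  have hχ₁' : ContDiff ℝ 1 χ₁ := hχ₁.of_le (by norm_cast)
  have hχ₂' : ContDiff ℝ 1 χ₂ := hχ₂.of_le (by norm_cast)
  obtain ⟨G₀, hG₀p, hG₀⟩ := exists_gradSq_bound hbdd hχ₀'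
  obtain ⟨G₁, hG₁p, hG₁⟩ := exists_gradSq_bound hbdd hχ₁'
  have hG₀' : ∀ x ∈ Ω, gradSq χ₀ x ≤ G₀ * χ₁ x ^ 2 := fun x hx => by
    by_cases hxb : x ∈ tsupport χ₀
    · rw [h₁1 x (Metric.ball_subset_closedBall (h₀s hxb))]
      simpa using hG₀ x hx
    · have : gradSq χ₀ x = 0 := by
        have h1 : χ₀ =ᶠ[𝓝 x] fun _ => 0 := notMem_tsupport_iff_eventuallyEq.mp hxb
        simp [gradSq, h1.fderiv_eq]
      rw [this]
      positivity
  have hA := contDiff_gaugedPot hφ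
  set A := gaugedPot φ
  have hAf : ∀ x ∈ frontier Ω, (1 - χ₂ x) • A x = 0 := fun x hx => by
    by_cases hxb : x ∈ Metric.ball p (ρ / 8)
    · rw [h₂1 x (Metric.ball_subset_closedBall hxb), sub_self, zero_smul]
    · obtain ⟨h1, h2⟩ := hφF x hx hxb
      have : A x = 0 := by ext <;> simp [A, gaugedPot, h1, h2]
      rw [this, smul_zero]
  set w₁ : Plane → ℝ := fun x => (1 - χ₂ x) * (A x).1 with hw₁
  set w₂ : Plane → ℝ := fun x => (1 - χ₂ x) * (A x).2 with hw₂
  have hw₁c : ContDiff ℝ 1 w₁ := (contDiff_const.sub hχ₂').mul hA.fst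
  have hw₂c : ContDiff ℝ 1 w₂ := (contDiff_const.sub hχ₂').mul hA.snd
  have hw₁0 : ∀ x ∈ frontier Ω, w₁ x = 0 := fun x hx => congrArg Prod.fst (hAf x hx)
  have hw₂0 : ∀ x ∈ frontier Ω, w₂ x = 0 := fun x hx => congrArg Prod.snd (hAf x hx)
  obtain ⟨Gw₁, hGw₁p, hGw₁⟩ := exists_gradSq_bound hbdd hw₁c
  obtain ⟨Gw₂, hGw₂p, hGw₂⟩ := exists_gradSq_bound hbdd hw₂c
  obtain ⟨M, hMp, hM⟩ := exists_deriv_softThr_bound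
  have hAc := hA.continuous
  have hesq : Continuous fun x => esq (A x) := by unfold esq; fun_prop
  obtain ⟨GA, hGA⟩ := hbdd.isCompact_closure.exists_bound_of_continuousOn hesq.continuousOn
  have hGA' : ∀ x ∈ Ω, esq (A x) ≤ |GA| := fun x hx =>
    (le_abs_self _).trans ((hGA x (subset_closure hx)).trans (le_abs_self GA))
  obtain ⟨K, hK, hcurv⟩ := P.exists_curv_bound
  have hc1 := D.c_lt
  have hc0 := D.c_pos
  have hC1 := D.C1_pos
  have hT1 : (1 + D.c ^ 2) / 2 < 1 := by nlinarith
  have hTc : D.c ^ 2 < (1 + D.c ^ 2) / 2 := by nlinarith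
  set T := (1 + D.c ^ 2) / 2
  set C₁ := (M * Gw₁ + 1) / (1 - T) + 2
  set C₂ := (M * Gw₂ + 1) / (1 - T) + 2
  set C₃ := (G₀ * (G₁ + 1) / (g / 2) + 1) / (g / 2)
  have hT1' : 0 < 1 - T := by linarith
  have hC₁ : 0 < C₁ := by positivity
  have hC₂ : 0 < C₂ := by positivity
  have hC₃ : 0 < C₃ := by positivity
  refine ⟨φ, hφ, 2 * C₁ + 2 * C₂ + 2 * |GA| * C₃, by positivity,
    max (max bu bl) (max 1 ((K * D.C1 + g / 4) / (T - D.c ^ 2))), by positivity,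
    fun b hb δ hδ => ?_⟩
  obtain ⟨hb12, hb34⟩ := max_lt_iff.mp hb
  obtain ⟨hb1, hb2⟩ := max_lt_iff.mp hb12
  obtain ⟨hb3, hb4⟩ := max_lt_iff.mp hb34
  have hb0 : 0 < b := by linarith
  have hbi : b⁻¹ ≤ 1 := inv_le_one_of_one_le₀ hb3.le
  have hup' := hup b hb1
  have hgap : ∀ v : Plane → ℂ, ContDiff ℝ 1 v → tsupport v ⊆ Metric.ball p ρ →
      (lam1 Ω (b ^ 2) + g / 2 * b) * mass Ω v ≤ energy Ω (b ^ 2) v := fun v hv hvs => by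
    refine le_trans (mul_le_mul_of_nonneg_right ?_ (mass_nonneg v)) (hlow b hb2 v hv hvs)
    have : g * b = curvOf P.γ s₁ * D.C1 * b - curvOf P.γ s₀ * D.C1 * b := by rw [hg]; ring
    linarith
  have hlam : lam1 Ω (b ^ 2) ≤ T * b ^ 2 := by
    rw [div_lt_iff₀ (by linarith)] at hb4
    have h1 : -(curvOf P.γ s₁) ≤ K := (neg_le_abs _).trans (hcurv s₁)
    have h2 := mul_le_mul_of_nonneg_right h1 (mul_pos hC1 hb0).le
    have h3 := mul_le_mul_of_nonneg_right hb4.le hb0.le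
    linarith
  obtain ⟨u, hu, hm, he, hloc⟩ := exists_quasi_min_localized hopen hbdd hne Finset.univ
    ![χ₀, χ₁, thr b⁻¹ w₁, thr b⁻¹ w₂] (fun i _ => by
      fin_cases i
      · exact hχ₀'
      · exact hχ₁'
      · exact contDiff_thr _ hw₁c
      · exact contDiff_thr _ hw₂c) (b ^ 2) hδ (inv_pos.mpr hb0)
  refine ⟨u, hu, hm, he, ?_⟩
  have d0 := gap_decay hopen hbdd hχ₀' hχ₁' (h₀s.trans (Metric.ball_subset_ball (by linarith)))
    h₁s hG₀' hG₁ hG₀p.le hu hm hb3.le (half_pos hg0) hgap (hloc 0 (Finset.mem_univ _))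
    (hloc 1 (Finset.mem_univ _))
  have d1 := interior_decay hopen hbdd hM hw₁c hw₁0 hGw₁ hu hm hb0 hT1 hlam
    ((hloc 2 (Finset.mem_univ _)).trans (add_le_add_right hbi _))
  have d2 := interior_decay hopen hbdd hM hw₂c hw₂0 hGw₂ hu hm hb0 hT1 hlam
    ((hloc 3 (Finset.mem_univ _)).trans (add_le_add_right hbi _))
  have hcu := hu.continuous
  have hcw₁ := hw₁c.continuous
  have hcw₂ := hw₂c.continuous
  have hcχ₀ := hχ₀.continuous
  have hsum := sum_integral_nonneg hopen ![2, 2, 2 * |GA|, -1]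
    ![fun x => w₁ x ^ 2 * ‖u x‖ ^ 2, fun x => w₂ x ^ 2 * ‖u x‖ ^ 2,
      fun x => ‖(χ₀ x : ℂ) * u x‖ ^ 2, fun x => esq (A x) * ‖u x‖ ^ 2] (fun i => by
      fin_cases i
      · exact integrableOn_of_continuous hbdd
          (by fun_prop : Continuous fun x => w₁ x ^ 2 * ‖u x‖ ^ 2)
      · exact integrableOn_of_continuous hbdd
          (by fun_prop : Continuous fun x => w₂ x ^ 2 * ‖u x‖ ^ 2)
      · exact integrableOn_of_continuous hbdd
          (by fun_prop : Continuous fun x => ‖(χ₀ x : ℂ) * u x‖ ^ 2)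
      · exact integrableOn_of_continuous hbdd
          (by fun_prop : Continuous fun x => esq (A x) * ‖u x‖ ^ 2))
    (fun x hx => by
      have q1 : χ₂ x ^ 2 ≤ χ₀ x ^ 2 := by
        by_cases hxb : x ∈ tsupport χ₂
        · rw [h₀1 x (Metric.ball_subset_closedBall (h₂s hxb))]
          exact pow_le_pow_left₀ (h₂I x).1 (h₂I x).2 2
        · rw [image_eq_zero_of_notMem_tsupport hxb]
          simpa using sq_nonneg (χ₀ x)
      have q2 : χ₂ x ^ 2 * esq (A x) ≤ |GA| * χ₀ x ^ 2 := by
        rw [mul_comm |GA|]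
        exact mul_le_mul q1 (hGA' x hx) (by unfold esq; positivity) (sq_nonneg _)
      have q3 : esq (A x) ≤ 2 * w₁ x ^ 2 + 2 * w₂ x ^ 2 + 2 * (χ₂ x ^ 2 * esq (A x)) := by
        have : 2 * w₁ x ^ 2 + 2 * w₂ x ^ 2 + 2 * (χ₂ x ^ 2 * esq (A x)) - esq (A x) =
            (1 - 2 * χ₂ x) ^ 2 * esq (A x) := by simp only [hw₁, hw₂, esq]; ring
        have : 0 ≤ (1 - 2 * χ₂ x) ^ 2 * esq (A x) := by unfold esq; positivity
        linarith
      have q4 : esq (A x) ≤ 2 * w₁ x ^ 2 + 2 * w₂ x ^ 2 + 2 * (|GA| * χ₀ x ^ 2) := by linarith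
      have q5 := mul_le_mul_of_nonneg_right q4 (sq_nonneg ‖u x‖)
      simp only [Fin.sum_univ_succ, Fin.sum_univ_zero, Matrix.cons_val_zero, Matrix.cons_val_succ,
        norm_mul, mul_pow, Complex.norm_real, Real.norm_eq_abs, sq_abs]
      linarith only [q5])
  simp only [Fin.sum_univ_succ, Fin.sum_univ_zero, Matrix.cons_val_zero, Matrix.cons_val_succ]
    at hsum
  have d0' := mul_le_mul_of_nonneg_left d0 (by positivity : 0 ≤ 2 * |GA|)
  rw [mass] at d0'
  change _ ≤ 2 * |GA| * (C₃ / b ^ 2) at d0'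
  change _ ≤ C₁ / b ^ 2 at d1
  change _ ≤ C₂ / b ^ 2 at d2
  have e : (2 * C₁ + 2 * C₂ + 2 * |GA| * C₃) / b ^ 2 =
      2 * (C₁ / b ^ 2) + 2 * (C₂ / b ^ 2) + 2 * |GA| * (C₃ / b ^ 2) := by ring
  linarith

end

section

variable {Ω : Set Plane}

lemma magSq_add_gauge {φ : Plane → ℝ} {u : Plane → ℂ} {x : Plane} (hφ : DifferentiableAt ℝ φ x)
    (hu : DifferentiableAt ℝ u x) (B β : ℝ) :
    magSq (B + β) F0 (fun z => Complex.exp (Complex.I * ((1 * (β * φ z) : ℝ) : ℂ)) * u z) x =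
      magSq 1 (fun y => B • F0 y + β • gaugedPot φ y) u x := by
  rw [magSq_gauge 1 _ hu (hφ.const_mul β)]
  have hd : fderiv ℝ (fun y => β * φ y) x = β • fderiv ℝ φ x := fderiv_const_mul hφ β
  have e1 : (B + β) * (F0 x).1 = 1 * (B • F0 x + β • gaugedPot φ x +
      (fderiv ℝ (fun y => β * φ y) x (1, 0), fderiv ℝ (fun y => β * φ y) x (0, 1))).1 := by
    rw [hd]
    simp only [gaugedPot, Prod.fst_add, Prod.smul_fst, _root_.smul_apply, smul_eq_mul]
    ring
  have e2 : (B + β) * (F0 x).2 = 1 * (B • F0 x + β • gaugedPot φ x +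
      (fderiv ℝ (fun y => β * φ y) x (1, 0), fderiv ℝ (fun y => β * φ y) x (0, 1))).2 := by
    rw [hd]
    simp only [gaugedPot, Prod.snd_add, Prod.smul_snd, _root_.smul_apply, smul_eq_mul]
    ring
  rw [magSq, magSq, e1, e2]

lemma magSq_quadratic (F A : Plane → Plane) (u : Plane → ℂ) (x : Plane) (B β : ℝ) :
    magSq 1 (fun y => B • F y + β • A y) u x = magSq B F u x +
      β * (magSq 1 (fun y => B • F y + (1 : ℝ) • A y) u x - magSq B F u x -
        esq (A x) * ‖u x‖ ^ 2) + β ^ 2 * (esq (A x) * ‖u x‖ ^ 2) := by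
  have key : ∀ (q z : ℂ) (f a : ℝ), ‖q - ((1 * (B * f + β * a) : ℝ) : ℂ) * z‖ ^ 2 =
      ‖q - ((B * f : ℝ) : ℂ) * z‖ ^ 2 + β * (‖q - ((1 * (B * f + 1 * a) : ℝ) : ℂ) * z‖ ^ 2 -
        ‖q - ((B * f : ℝ) : ℂ) * z‖ ^ 2 - a ^ 2 * ‖z‖ ^ 2) + β ^ 2 * (a ^ 2 * ‖z‖ ^ 2) :=
    fun q z f a => by
      simp only [← Complex.normSq_eq_norm_sq, Complex.normSq_apply, Complex.sub_re, Complex.sub_im,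
        Complex.re_ofReal_mul, Complex.im_ofReal_mul]
      ring
  have k1 := key (-Complex.I * fderiv ℝ u x (1, 0)) (u x) (F x).1 (A x).1
  have k2 := key (-Complex.I * fderiv ℝ u x (0, 1)) (u x) (F x).2 (A x).2
  simp only [magSq, esq, Prod.fst_add, Prod.snd_add, Prod.smul_fst, Prod.smul_snd, smul_eq_mul]
  rw [k1, k2]
  ring

/-- A quadratic upper bound for the ground state energy from a single trial state. -/
lemma exists_lam1_add_le (hopen : IsOpen Ω) (hbdd : Bornology.IsBounded Ω) {φ : Plane → ℝ}
    (hφ : ContDiff ℝ (⊤ : ℕ∞) φ) {u : Plane → ℂ} (hu : ContDiff ℝ 1 u) (hm : mass Ω u = 1)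
    (B : ℝ) : ∃ l : ℝ, ∀ β : ℝ, lam1 Ω (B + β) ≤ energy Ω B u + β * l +
      β ^ 2 * ∫ x in Ω, esq (gaugedPot φ x) * ‖u x‖ ^ 2 := by
  have hA := contDiff_gaugedPot hφ
  have hAc := hA.continuous
  have hF := continuous_F0
  have hcu := hu.continuous
  set A := gaugedPot φ
  have hesq : Continuous fun x => esq (A x) := by unfold esq; fun_prop
  refine ⟨(∫ x in Ω, magSq 1 (fun y => B • F0 y + (1 : ℝ) • A y) u x) - energy Ω B u -
    ∫ x in Ω, esq (A x) * ‖u x‖ ^ 2, fun β => ?_⟩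
  have hφ1 : ContDiff ℝ 1 fun y => β * φ y := contDiff_const.mul (hφ.of_le (by norm_cast))
  have hv := contDiff_gauge 1 hu hφ1
  have h := lam1_mul_mass_le (Ω := Ω) hv (B + β)
  have hmv : mass Ω (fun z => Complex.exp (Complex.I * ((1 * (β * φ z) : ℝ) : ℂ)) * u z) = 1 := by
    rw [← hm, mass, mass]
    simp only [norm_mul, norm_exp_I_mul_ofReal', one_mul]
  rw [hmv, mul_one] at h
  have he : energy Ω (B + β) (fun z => Complex.exp (Complex.I * ((1 * (β * φ z) : ℝ) : ℂ)) * u z) =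
      ∫ x in Ω, magSq 1 (fun y => B • F0 y + β • A y) u x :=
    setIntegral_congr_fun hopen.measurableSet fun x _ =>
      magSq_add_gauge (hφ.differentiable (by simp) x) (hu.differentiable one_ne_zero x) B β
  rw [he] at h
  have hsum := sum_integral_nonneg hopen ![1, β, -β, -β, β ^ 2, -1]
    ![magSq B F0 u, magSq 1 (fun y => B • F0 y + (1 : ℝ) • A y) u, magSq B F0 u,
      fun x => esq (A x) * ‖u x‖ ^ 2, fun x => esq (A x) * ‖u x‖ ^ 2,
      magSq 1 (fun y => B • F0 y + β • A y) u] (fun i => by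
      have i1 := integrableOn_of_continuous hbdd (continuous_magSq hu B hF)
      have i2 := integrableOn_of_continuous hbdd
        (by fun_prop : Continuous fun x => esq (A x) * ‖u x‖ ^ 2)
      have i3 : ∀ β : ℝ, IntegrableOn (magSq 1 (fun y => B • F0 y + β • A y) u) Ω volume :=
        fun β => integrableOn_of_continuous hbdd (continuous_magSq hu 1 (by fun_prop))
      fin_cases i
      exacts [i1, i3 1, i1, i2, i2, i3 β])
    (fun x hx => by
      have q := magSq_quadratic F0 A u x B β
      simp only [Fin.sum_univ_succ, Fin.sum_univ_zero, Matrix.cons_val_zero, Matrix.cons_val_succ]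
      linarith only [q])
  simp only [Fin.sum_univ_succ, Fin.sum_univ_zero, Matrix.cons_val_zero, Matrix.cons_val_succ]
    at hsum
  rw [energy]
  linarith

/-- A function with two-sided linear asymptotics and uniform quadratic upper bounds is eventually
strictly decreasing under small backward shifts. -/
lemma shift_lt_of_quadratic_bound {lam : ℝ → ℝ} {θ C₁ C₂ B₀ : ℝ} (hθ : 0 < θ) (hC₁ : 0 < C₁)
    (hC₂ : 0 < C₂) (hlow : ∀ B > B₀, θ * B - C₁ * √B ≤ lam B)
    (hup : ∀ B > B₀, lam B ≤ θ * B + C₁ * √B)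
    (hquad : ∀ B > B₀, ∀ δ > 0, ∃ l, ∀ β, lam (B + β) ≤ lam B + δ + β * l + β ^ 2 * (C₂ / B)) :
    ∃ B₁ ≥ B₀, ∀ B > B₁, ∀ ε ∈ Ioc (0 : ℝ) 1, lam (B - ε) < lam B := by
  set η := min 1 (θ / (4 * C₂)) with hη
  have hη0 : 0 < η := by positivity
  have hη1 : η ≤ 1 := min_le_left _ _
  have hηC : η * C₂ ≤ θ / 4 := by
    have := mul_le_mul_of_nonneg_right (min_le_right 1 (θ / (4 * C₂))) hC₂.le
    rwa [← hη, show θ / (4 * C₂) * C₂ = θ / 4 by field_simp] at this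
  set R := (3 * C₁ + 1) * 4 / (η * θ) with hR
  have hR0 : 0 < R := by positivity
  refine ⟨max B₀ (max (max 1 (R ^ 2)) (4 * C₂ / θ)), le_max_left _ _, fun B hB ε hε => ?_⟩
  obtain ⟨hB0, hB'⟩ := max_lt_iff.mp hB
  obtain ⟨hB'', hB3⟩ := max_lt_iff.mp hB'
  obtain ⟨hB1, hB2⟩ := max_lt_iff.mp hB''
  have hBp : 0 < B := by linarith
  obtain ⟨l, hl⟩ := hquad B hB0 (min 1 (ε * θ / 8)) (lt_min one_pos (by have := hε.1; positivity))
  set S := √B with hS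
  have hSB : S * S = B := Real.mul_self_sqrt hBp.le
  have hS1 : 1 ≤ S := Real.one_le_sqrt.mpr hB1.le
  have hRS : R ≤ S := Real.le_sqrt_of_sq_le hB2.le
  have hl0 : θ / 2 ≤ l := by
    have h1 := hl (η * B)
    have h2 := hlow (B + η * B) (by nlinarith)
    have h3 := hup B hB0
    have h4 : √(B + η * B) ≤ 2 * S := by
      refine Real.sqrt_le_iff.mpr ⟨by positivity, ?_⟩
      nlinarith
    have h5 := mul_le_mul_of_nonneg_left h4 hC₁.le
    have h6 := min_le_left 1 (ε * θ / 8)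
    have e1 : (η * B) ^ 2 * (C₂ / B) = η * B * (η * C₂) := by field_simp
    rw [e1] at h1
    have h7 := mul_le_mul_of_nonneg_left hηC (by positivity : 0 ≤ η * B)
    have h8 : 3 * C₁ * S + 1 ≤ η * B * (θ / 4) := by
      have h9 : 3 * C₁ * S + 1 ≤ (3 * C₁ + 1) * S := by linarith
      have h10 : (3 * C₁ + 1) * S = R * (η * θ / 4) * S := by rw [hR]; field_simp
      have h11 : R * (η * θ / 4) * S ≤ S * (η * θ / 4) * S := by gcongr
      have h12 : S * (η * θ / 4) * S = η * B * (θ / 4) := by rw [← hSB]; ring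
      linarith
    have h13 : η * B * (θ / 2) ≤ η * B * l := by linarith
    exact le_of_mul_le_mul_left h13 (by positivity)
  have h1 := hl (-ε)
  have h2 : C₂ / B ≤ θ / 4 := by
    rw [div_lt_iff₀ hθ] at hB3
    rw [div_le_iff₀ hBp]
    linarith
  have h3 := min_le_right 1 (ε * θ / 8)
  have h4 := mul_le_mul_of_nonneg_left hl0 hε.1.le
  have h5 : (-ε) ^ 2 * (C₂ / B) ≤ ε * (θ / 4) := by
    have h6 : (-ε) ^ 2 ≤ ε := by nlinarith [hε.1, hε.2]
    exact mul_le_mul h6 h2 (by positivity) hε.1.le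
  have h6 := mul_pos hε.1 hθ
  rw [← sub_eq_add_neg] at h1
  linarith

lemma strictMonoOn_of_shift_lt {f : ℝ → ℝ} {B₁ : ℝ}
    (h : ∀ B > B₁, ∀ ε ∈ Ioc (0 : ℝ) 1, f (B - ε) < f B) : StrictMonoOn f (Ioi B₁) := by
  have key : ∀ n : ℕ, ∀ B > B₁, ∀ B', B < B' → B' ≤ B + n → f B < f B' := fun n => by
    induction n with
    | zero => intro B hB B' h1 h2; simp at h2; linarith
    | succ n ih =>
      intro B hB B' h1 h2
      push_cast at h2
      rcases le_or_gt B' (B + 1) with h3 | h3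
      · have := h B' (by linarith) (B' - B) ⟨by linarith, by linarith⟩
        rwa [sub_sub_cancel] at this
      · have h4 := h B' (by linarith) 1 ⟨one_pos, le_rfl⟩
        exact (ih B hB (B' - 1) (by linarith) (by linarith)).trans h4
  intro B hB B' _ hlt
  obtain ⟨n, hn⟩ := exists_nat_ge (B' - B)
  exact key n B hB B' hlt (by linarith)

lemma strictMonoOn_lam1 (D : HalfLine) (P : BoundaryParam Ω) (hopen : IsOpen Ω)
    (hbdd : Bornology.IsBounded Ω) (hne : Ω.Nonempty) {s₀ s₁ : ℝ}
    (hs : curvOf P.γ s₀ < curvOf P.γ s₁) : ∃ B₁ > 0, StrictMonoOn (lam1 Ω) (Ioi B₁) := by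
  obtain ⟨φ, hφ, C, hC, bq, hbq, hq⟩ := exists_decaying_quasi_min D P hopen hbdd hne hs
  obtain ⟨Cl, hCl, bl, hbl, hlow⟩ := BoundaryParam.lam1_lower D P hopen hbdd hne
  obtain ⟨bu, hbu, hup⟩ := BoundaryParam.lam1_upper D P hopen hbdd s₁ one_pos
  obtain ⟨K, hK, hcurv⟩ := P.exists_curv_bound
  have hC1 := D.C1_pos
  have hsqrt : ∀ {c B : ℝ}, 0 < c → c ^ 2 < B → c < √B := fun hc h => Real.lt_sqrt_of_sq_lt h
  obtain ⟨B₁, hB₁, h⟩ := shift_lt_of_quadratic_bound (lam := lam1 Ω) (θ := D.c ^ 2)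
    (C₁ := Cl + (K * D.C1 + 1)) (C₂ := C) (B₀ := max (bq ^ 2) (max (bl ^ 2) (bu ^ 2)))
    (pow_pos D.c_pos 2) (by positivity) hC
    (fun B hB => by
      obtain ⟨-, hB'⟩ := max_lt_iff.mp hB
      obtain ⟨hB1, -⟩ := max_lt_iff.mp hB'
      have hs2 : √B ^ 2 = B := Real.sq_sqrt ((sq_nonneg _).trans hB1.le)
      have := hlow (√B) (hsqrt hbl hB1)
      rw [hs2] at this
      have h2 : 0 ≤ (K * D.C1 + 1) * √B := by positivity
      linarith)
    (fun B hB => by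
      obtain ⟨-, hB'⟩ := max_lt_iff.mp hB
      obtain ⟨-, hB1⟩ := max_lt_iff.mp hB'
      have hs2 : √B ^ 2 = B := Real.sq_sqrt ((sq_nonneg _).trans hB1.le)
      have := hup (√B) (hsqrt hbu hB1)
      rw [hs2] at this
      have h1 : -(curvOf P.γ s₁) ≤ K := (neg_le_abs _).trans (hcurv s₁)
      have h2 := mul_le_mul_of_nonneg_right h1 (by positivity : 0 ≤ D.C1 * √B)
      have h3 : 0 ≤ Cl * √B := by positivity
      linarith)
    (fun B hB δ hδ => by
      obtain ⟨hB1, -⟩ := max_lt_iff.mp hB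
      have hs2 : √B ^ 2 = B := Real.sq_sqrt ((sq_nonneg _).trans hB1.le)
      obtain ⟨u, hu, hm, he, hd⟩ := hq (√B) (hsqrt hbq hB1) δ hδ
      rw [hs2] at he hd
      obtain ⟨l, hl⟩ := exists_lam1_add_le hopen hbdd hφ hu hm B
      exact ⟨l, fun β => (hl β).trans (by gcongr)⟩)
  exact ⟨B₁, lt_of_lt_of_le (lt_max_of_lt_left (by positivity)) hB₁, strictMonoOn_of_shift_lt h⟩

lemma BoundaryParam.nonempty (P : BoundaryParam Ω) : Ω.Nonempty := by
  obtain ⟨ε, hε, h⟩ := P.inward 0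
  exact ⟨_, h (ε / 2) ⟨by linarith, by linarith⟩⟩

lemma NonDegen.exists_curv_lt {P : BoundaryParam Ω} (h : NonDegen P) :
    ∃ s₀ s₁, curvOf P.γ s₀ < curvOf P.γ s₁ := by
  obtain ⟨N, s, hN, -, hmax, hlt, -⟩ := h
  obtain ⟨t, ht, hts⟩ := ((Ico_infinite P.L_pos).sdiff (finite_range s)).nonempty
  refine ⟨t, s ⟨0, hN⟩, ?_⟩
  rw [hmax]
  exact hlt t ht fun j hj => hts ⟨j, hj.symm⟩

/-- For large `κ` there is exactly one field strength with ground state energy `κ²`. -/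
lemma existsUnique_lam1_eq (P : BoundaryParam Ω) (hnd : NonDegen P) (hopen : IsOpen Ω)
    (hbdd : Bornology.IsBounded Ω) :
    ∃ κ₀ > 0, ∀ κ ≥ κ₀, ∃! H : ℝ, 0 < H ∧ lam1 Ω (κ * H) = κ ^ 2 := by
  have hne := P.nonempty
  obtain ⟨D⟩ := exists_halfLine
  obtain ⟨s₀, s₁, hs⟩ := hnd.exists_curv_lt
  obtain ⟨B₁, hB₁, hmono⟩ := strictMonoOn_lam1 D P hopen hbdd hne hs
  obtain ⟨C, hC, hF⟩ := exists_esq_F0_bound hbdd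
  obtain ⟨Cl, hCl, bl, hbl, hlow⟩ := BoundaryParam.lam1_lower D P hopen hbdd hne
  have hle := lam1_le_sq hopen hbdd hne hF
  have hcont := continuous_lam1 hopen hbdd hne
  have hc := D.c_pos
  refine ⟨√C * (B₁ + 1), by positivity, fun κ hκ => ?_⟩
  have hκ0 : 0 < κ := lt_of_lt_of_le (by positivity) hκ
  have hκ2 : C * (B₁ + 1) ^ 2 ≤ κ ^ 2 := by
    have := pow_le_pow_left₀ (by positivity) hκ 2
    rwa [mul_pow, Real.sq_sqrt hC.le] at this
  have hbig : ∀ B, 0 ≤ B → lam1 Ω B = κ ^ 2 → B₁ < B := fun B hB hBe => by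
    by_contra! h
    have h1 := hle B
    have h2 : C * B ^ 2 < C * (B₁ + 1) ^ 2 := by gcongr; linarith
    linarith
  obtain ⟨b, hb1, hb2⟩ : ∃ b : ℝ, 0 < b ∧ κ ^ 2 ≤ lam1 Ω (b ^ 2) := by
    set b := max (bl + 1) ((Cl + κ ^ 2 + 1) / D.c ^ 2 + 1) with hb
    have h1 : bl + 1 ≤ b := le_max_left _ _
    have h2 : (Cl + κ ^ 2 + 1) / D.c ^ 2 + 1 ≤ b := le_max_right _ _
    have hpos : 0 ≤ (Cl + κ ^ 2 + 1) / D.c ^ 2 := by positivity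
    have h3 : (Cl + κ ^ 2 + 1) ≤ b * D.c ^ 2 := by
      rw [← div_le_iff₀ (by positivity)]; linarith
    refine ⟨b, by linarith, le_trans ?_ (hlow b (by linarith))⟩
    have h4 := mul_le_mul_of_nonneg_right h3 (by linarith : 0 ≤ b)
    nlinarith [sq_nonneg κ]
  have hzero : lam1 Ω 0 ≤ κ ^ 2 := (hle 0).trans (by simp; positivity)
  obtain ⟨B, hB, hBe⟩ := intermediate_value_Icc (sq_nonneg b) hcont.continuousOn ⟨hzero, hb2⟩
  have hBB := hbig B hB.1 hBe
  refine ⟨B / κ, ⟨div_pos (by linarith) hκ0, ?_⟩, fun H ⟨hH0, hHe⟩ => ?_⟩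
  · rw [mul_div_cancel₀ _ hκ0.ne', hBe]
  · have h1 := hbig (κ * H) (by positivity) hHe
    rw [eq_div_iff hκ0.ne', mul_comm]
    exact hmono.injOn h1 hBB (hHe.trans hBe.symm)

end

end SC

/-- Under the non-degeneracy assumption, for large `κ` the equation
`λ₁(κH) = κ²` has exactly one solution `H > 0`. -/
theorem unique_solution_of_local_equation
    (Ω : Set SC.Plane) (hΩ_open : IsOpen Ω) (hΩ_bdd : Bornology.IsBounded Ω)
    (hΩ_sc : SimplyConnectedSpace ↥Ω) (P : SC.BoundaryParam Ω) (hnd : SC.NonDegen P) :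
    ∃ κ₀ > 0, ∀ κ ≥ κ₀, ∃! H : ℝ, 0 < H ∧ SC.lam1 Ω (κ * H) = κ ^ 2 :=
  SC.existsUnique_lam1_eq P hnd hΩ_open hΩ_bdd
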